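/- Model the cotangent bundle T*S¹ by ℝ² with coordinates (x, ξ) and 2π-periodicity in x. Suppose the smooth function p : ℝ² → ℝ, with p(x + 2π, ξ) = p(x, ξ), admits a non-degenerate well along a non-contractible closed curve γ = c(ℝ) with minimal value b₀, and set I₀ := (1/(2π)) ∫₀^{2π} c₂(t) c₁'(t) dt. Then there exist ε > 0, R > 0, a smooth function g on a neighborhood of 0 in ℝ with g(0) = 0 and g'(0) ≠ 0, and a bijection σ : ℝ² → ℝ² such that: σ and σ⁻¹ are smooth; σ(x + 2π, ξ) = σ(x, ξ) + (2π, 0); the Jacobian determinant of σ is identically 1; σ equals the identity outside {(x, ξ) : |ξ| ≤ R}; σ is a Hamiltonian diffeomorphism, meaning there exist a smooth H : [0, 1] × ℝ² → ℝ, 2π-periodic in x and supported in {|ξ| ≤ R}, and a smooth Σ : [0, 1] × ℝ² → ℝ² with Σ(0, z) = z, Σ(1, z) = σ(z), and ∂_s Σ(s, z) = (∂_ξ H(s, Σ(s, z)), −∂_x H(s, Σ(s, z))) for all s, z; and for every (x, ξ) with ξ ∈ (I₀ − ε, I₀ + ε), one has p(σ(x, ξ)) = b₀ + g(ξ − I₀)².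 -/

import Mathlib

open Real Set

/-- A smooth `2π`-periodic-in-`x` function `p` on `T*S¹ ≃ ℝ²/(2πℤ × {0})` admits a
non-degenerate well along the non-contractible closed curve `γ = c(ℝ)` (winding number 1)
with minimal value `b₀`. -/
def NondegenerateWellCylinder (p : ℝ × ℝ → ℝ) (c : ℝ → ℝ × ℝ) (b₀ : ℝ) : Prop :=
  ContDiff ℝ (⊤ : ℕ∞) p ∧ (∀ x ξ : ℝ, p (x + 2 * π, ξ) = p (x, ξ)) ∧
  ContDiff ℝ (⊤ : ℕ∞) c ∧
  (∀ t, c (t + 2 * π) = c t + (2 * π, 0)) ∧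
  (∀ t, deriv c t ≠ 0) ∧
  (∀ t s : ℝ, (∃ k : ℤ, c t - c s = (2 * π * k, 0)) → ∃ k : ℤ, t - s = 2 * π * k) ∧
  (∃ Ω : Set (ℝ × ℝ), IsOpen Ω ∧ Set.range c ⊆ Ω ∧
    (∀ z : ℝ × ℝ, z ∈ Ω ↔ z + (2 * π, 0) ∈ Ω) ∧
    (∀ m ∈ Set.range c, p m = b₀) ∧ (∀ m ∈ Ω \ Set.range c, b₀ < p m)) ∧
  (∀ t, ∀ ν : ℝ × ℝ, ν ≠ 0 → ν.1 * (deriv c t).1 + ν.2 * (deriv c t).2 = 0 →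
    iteratedFDeriv ℝ 2 p (c t) ![ν, ν] ≠ 0)

section Superposition

variable {K E F : Type} [TopologicalSpace K] [CompactSpace K]
  [NormedAddCommGroup E] [NormedSpace ℝ E] [NormedAddCommGroup F] [NormedSpace ℝ F]

/-- Pointwise application of a continuous family of continuous linear maps. -/
noncomputable def pointwiseApply :
    C(K, E →L[ℝ] F) →L[ℝ] C(K, E) →L[ℝ] C(K, F) :=
  LinearMap.mkContinuous₂
    (LinearMap.mk₂ ℝ
      (fun (A : C(K, E →L[ℝ] F)) (h : C(K, E)) =>
        (⟨fun x => A x (h x), A.continuous.clm_apply h.continuous⟩ : C(K, F)))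
      (fun _ _ _ => by ext; simp) (fun _ _ _ => by ext; simp)
      (fun _ _ _ => by ext; simp) (fun _ _ _ => by ext; simp)) 1
    (fun A h => by
      rw [ContinuousMap.norm_le _ (by positivity), one_mul]
      intro x
      exact (A x).le_of_opNorm_le_of_le (A.norm_coe_le_norm x) (h.norm_coe_le_norm x))

@[simp]
theorem pointwiseApply_apply (A : C(K, E →L[ℝ] F)) (h : C(K, E)) (x : K) :
    pointwiseApply A h x = A x (h x) := rfl

theorem hasFDerivAt_superposition (v : C(E, F)) (v' : C(E, E →L[ℝ] F))
    (hv : ∀ y, HasFDerivAt v (v' y) y) (u : C(K, E)) :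
    HasFDerivAt (fun u : C(K, E) => v.comp u) (pointwiseApply (v'.comp u)) u := by
  rw [hasFDerivAt_iff_isLittleO_nhds_zero, Asymptotics.isLittleO_iff]
  intro ε hε
  have hc : ContinuousAt (fun w : C(K, E) => v'.comp w) u :=
    (ContinuousMap.continuous_postcomp v').continuousAt
  have hm : ∀ ε > 0, ∃ δ > 0, ∀ ⦃w : C(K, E)⦄, dist w u < δ →
      dist (v'.comp w) (v'.comp u) < ε := Metric.continuousAt_iff.1 (by exact hc)
  obtain ⟨δ, hδ, hd⟩ := hm ε hε
  filter_upwards [Metric.ball_mem_nhds (0 : C(K, E)) hδ] with h hh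
  rw [ContinuousMap.norm_le _ (by positivity)]
  intro x
  rw [mem_ball_zero_iff] at hh
  have key : ∀ y ∈ segment ℝ (u x) (u x + h x), ‖v' y - v' (u x)‖ ≤ ε := by
    intro y hy
    rw [segment_eq_image'] at hy
    obtain ⟨t, ht, rfl⟩ := hy
    have h1 : dist (u + t • h) u < δ := by
      rw [dist_eq_norm, add_sub_cancel_left, norm_smul, Real.norm_eq_abs, abs_of_nonneg ht.1]
      exact lt_of_le_of_lt (mul_le_of_le_one_left (norm_nonneg _) ht.2) hh
    have h3 : dist (v'.comp (u + t • h) x) (v'.comp u x) ≤ ε :=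
      (ContinuousMap.dist_apply_le_dist x).trans (hd h1).le
    rw [dist_eq_norm] at h3
    simpa using h3
  have := (convex_segment (𝕜 := ℝ) (u x) (u x + h x)).norm_image_sub_le_of_norm_hasFDerivWithin_le'
    (fun y _ => (hv y).hasFDerivWithinAt) key (left_mem_segment _ _ _) (right_mem_segment _ _ _)
  simp only [add_sub_cancel_left] at this
  have h4 : ε * ‖h x‖ ≤ ε * ‖h‖ := by gcongr; exact h.norm_coe_le_norm x
  simpa using this.trans h4

theorem contDiff_superposition_nat (n : ℕ) : ∀ {F : Type} [NormedAddCommGroup F] [NormedSpace ℝ F]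
    (v : C(E, F)), ContDiff ℝ (⊤ : ℕ∞) v → ContDiff ℝ n (fun u : C(K, E) => v.comp u) := by
  induction n with
  | zero =>
    intro F _ _ v _
    exact contDiff_zero.2 (ContinuousMap.continuous_postcomp v)
  | succ n ih =>
    intro F _ _ v hv
    let v' : C(E, E →L[ℝ] F) := ⟨fderiv ℝ v, hv.continuous_fderiv (by simp)⟩
    have hv' : ContDiff ℝ (⊤ : ℕ∞) v' := hv.fderiv_right (m := (⊤ : ℕ∞)) (by simp)
    have hd : ∀ u : C(K, E), HasFDerivAt (fun u : C(K, E) => v.comp u)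
        (pointwiseApply (v'.comp u)) u := hasFDerivAt_superposition v v'
          (fun y => ((hv.differentiable (by simp)) y).hasFDerivAt)
    rw [Nat.cast_succ, contDiff_succ_iff_fderiv]
    refine ⟨fun u => (hd u).differentiableAt, by simp, ?_⟩
    have : fderiv ℝ (fun u : C(K, E) => v.comp u) = fun u => pointwiseApply (v'.comp u) :=
      funext fun u => (hd u).fderiv
    rw [this]
    exact pointwiseApply.contDiff.comp (ih v' hv')

theorem contDiff_superposition (v : C(E, F)) (hv : ContDiff ℝ (⊤ : ℕ∞) v) :
    ContDiff ℝ (⊤ : ℕ∞) (fun u : C(K, E) => v.comp u) :=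
  contDiff_infty.2 fun n => contDiff_superposition_nat n v hv

end Superposition

section ParametricIntegral

variable {E F : Type} [NormedAddCommGroup E] [NormedSpace ℝ E]
  [NormedAddCommGroup F] [NormedSpace ℝ F]

/-- The constant functions, as a continuous linear map. -/
noncomputable def constCLM (K E : Type) [TopologicalSpace K] [CompactSpace K]
    [NormedAddCommGroup E] [NormedSpace ℝ E] : E →L[ℝ] C(K, E) :=
  LinearMap.mkContinuous
    { toFun := fun z => ContinuousMap.const K z
      map_add' := fun _ _ => by ext; simp
      map_smul' := fun _ _ => by ext; simp } 1
    (fun z => by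
      rw [ContinuousMap.norm_le _ (by positivity), one_mul]
      intro x
      simp)

@[simp]
theorem constCLM_apply (K : Type) [TopologicalSpace K] [CompactSpace K] (z : E) (x : K) :
    constCLM K E z x = z := rfl

/-- The primitive of a continuous function on `[0, 1]`, as a continuous linear map. -/
noncomputable def primitiveCLM (F : Type) [NormedAddCommGroup F] [NormedSpace ℝ F] :
    C(Icc (0:ℝ) 1, F) →L[ℝ] C(Icc (0:ℝ) 1, F) :=
  LinearMap.mkContinuous
    { toFun := fun u => ⟨fun τ => ∫ s in (0:ℝ)..τ, u (projIcc 0 1 zero_le_one s), by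
        have : Continuous fun τ : ℝ => ∫ s in (0:ℝ)..τ, u (projIcc 0 1 zero_le_one s) :=
          intervalIntegral.continuous_primitive
            (fun a b => (u.continuous.comp continuous_projIcc).intervalIntegrable a b) 0
        exact this.comp continuous_subtype_val⟩
      map_add' := fun u w => by
        ext τ
        simp only [ContinuousMap.add_apply, ContinuousMap.coe_mk]
        exact intervalIntegral.integral_add
          ((u.continuous.comp continuous_projIcc).intervalIntegrable _ _)
          ((w.continuous.comp continuous_projIcc).intervalIntegrable _ _)
      map_smul' := fun r u => by
        ext τ
        simp } 1
    (fun u => by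
      rw [ContinuousMap.norm_le _ (by positivity), one_mul]
      intro τ
      simp only [LinearMap.coe_mk, AddHom.coe_mk, ContinuousMap.coe_mk]
      refine (intervalIntegral.norm_integral_le_of_norm_le_const
        (fun s _ => u.norm_coe_le_norm _)).trans ?_
      rw [sub_zero, abs_of_nonneg τ.2.1]
      exact mul_le_of_le_one_right (norm_nonneg _) τ.2.2)

theorem primitiveCLM_apply (u : C(Icc (0:ℝ) 1, F)) (τ : Icc (0:ℝ) 1) :
    primitiveCLM F u τ = ∫ s in (0:ℝ)..τ, u (projIcc 0 1 zero_le_one s) := rfl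

theorem contDiff_parametric_integral (f : E × ℝ → F) (hf : ContDiff ℝ (⊤ : ℕ∞) f) :
    ContDiff ℝ (⊤ : ℕ∞) (fun z => ∫ s in (0:ℝ)..1, f (z, s)) := by
  let I := Icc (0:ℝ) 1
  let path : E → C(I, E × ℝ) := fun z =>
    constCLM I (E × ℝ) (z, 0) + ⟨fun s : I => ((0 : E), (s : ℝ)), by fun_prop⟩
  have hpath : ContDiff ℝ (⊤ : ℕ∞) path :=
    ((constCLM I (E × ℝ)).contDiff.comp (by fun_prop)).add contDiff_const
  let v : C(E × ℝ, F) := ⟨f, hf.continuous⟩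
  have h1 : ContDiff ℝ (⊤ : ℕ∞) (fun z => primitiveCLM F (v.comp (path z))) :=
    (primitiveCLM F).contDiff.comp ((contDiff_superposition v hf).comp hpath)
  let one : I := ⟨1, by simp [I]⟩
  have h2 := (ContinuousMap.evalCLM (M := F) ℝ one).contDiff (n := (⊤ : ℕ∞)).comp h1
  convert h2 using 1
  ext z
  simp only [Function.comp_apply, ContinuousMap.evalCLM_apply]
  refine intervalIntegral.integral_congr fun s hs => ?_
  rw [uIcc_of_le zero_le_one] at hs
  simp [path, v, projIcc_of_mem zero_le_one hs, I]

/-- A smooth function has a smooth antiderivative in its real variable. -/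
theorem exists_smooth_antideriv [CompleteSpace F] (f : E × ℝ → F) (hf : ContDiff ℝ (⊤ : ℕ∞) f)
    (t₀ : ℝ) :
    ∃ G : E × ℝ → F, ContDiff ℝ (⊤ : ℕ∞) G ∧ (∀ z, G (z, t₀) = 0) ∧
      (∀ z t, G (z, t) = ∫ s in t₀..t, f (z, s)) ∧
      ∀ z t, HasDerivAt (fun t => G (z, t)) (f (z, t)) t := by
  have hG : ∀ z t, ∫ s in t₀..t, f (z, s) =
      (t - t₀) • ∫ s in (0:ℝ)..1, f (z, t₀ + s * (t - t₀)) := by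
    intro z t
    have := intervalIntegral.smul_integral_comp_add_mul (a := 0) (b := 1)
      (fun s => f (z, s)) (t - t₀) t₀
    simp only [mul_zero, add_zero, mul_one, add_sub_cancel] at this
    rw [← this]
    simp only [mul_comm]
  refine ⟨fun q => ∫ s in t₀..q.2, f (q.1, s), ?_, ?_, fun _ _ => rfl, ?_⟩
  · simp only [hG]
    have h1 : ContDiff ℝ (⊤ : ℕ∞) (fun q : (E × ℝ) × ℝ => f (q.1.1, t₀ + q.2 * (q.1.2 - t₀))) :=
      hf.comp (by fun_prop)
    exact (contDiff_snd.sub contDiff_const).smul (contDiff_parametric_integral _ h1)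
  · intro z
    simp
  · intro z t
    have hc : Continuous fun s => f (z, s) := hf.continuous.comp (by fun_prop)
    exact intervalIntegral.integral_hasDerivAt_right (hc.intervalIntegrable _ _)
      hc.aestronglyMeasurable.stronglyMeasurableAtFilter hc.continuousAt

/-- Hadamard's lemma. -/
theorem exists_smooth_quotient [CompleteSpace F] (f : E × ℝ → F) (hf : ContDiff ℝ (⊤ : ℕ∞) f)
    (h0 : ∀ z, f (z, 0) = 0) :
    ∃ k : E × ℝ → F, ContDiff ℝ (⊤ : ℕ∞) k ∧ ∀ z r, f (z, r) = r • k (z, r) := by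
  let f' : E × ℝ → F := fun q => fderiv ℝ f q (0, 1)
  have hf' : ContDiff ℝ (⊤ : ℕ∞) f' :=
    (hf.fderiv_right (m := (⊤ : ℕ∞)) (by simp)).clm_apply contDiff_const
  have hd : ∀ z t, HasDerivAt (fun t => f (z, t)) (f' (z, t)) t := by
    intro z t
    have h1 : HasFDerivAt f (fderiv ℝ f (z, t)) (z, t) :=
      ((hf.differentiable (by simp)) _).hasFDerivAt
    have h2 : HasDerivAt (fun t : ℝ => (z, t)) ((0 : E), (1 : ℝ)) t :=
      (hasDerivAt_const t z).prodMk (hasDerivAt_id t)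
    exact h1.comp_hasDerivAt t h2
  refine ⟨fun q => ∫ s in (0:ℝ)..1, f' (q.1, s * q.2), ?_, ?_⟩
  · have h1 : ContDiff ℝ (⊤ : ℕ∞) (fun q : (E × ℝ) × ℝ => f' (q.1.1, q.2 * q.1.2)) :=
      hf'.comp (by fun_prop)
    exact contDiff_parametric_integral _ h1
  · intro z r
    have hc : Continuous fun s => f' (z, s) := hf'.continuous.comp (by fun_prop)
    have h1 : ∫ s in (0:ℝ)..r, f' (z, s) = f (z, r) - f (z, 0) :=
      intervalIntegral.integral_eq_sub_of_hasDerivAt (fun t _ => hd z t)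
        (hc.intervalIntegrable _ _)
    have := intervalIntegral.smul_integral_comp_mul_right (a := 0) (b := 1)
      (fun s => f' (z, s)) r
    simp only [zero_mul, one_mul] at this
    rw [this, h1, h0, sub_zero]

end ParametricIntegral

section Flow

open scoped NNReal Topology

variable {E : Type} [NormedAddCommGroup E] [NormedSpace ℝ E]

theorem norm_primitiveCLM_le : ‖primitiveCLM E‖ ≤ 1 :=
  LinearMap.mkContinuous_norm_le _ zero_le_one _

theorem norm_pointwiseApply_apply_le {K F : Type} [TopologicalSpace K] [CompactSpace K]
    [NormedAddCommGroup F] [NormedSpace ℝ F] (A : C(K, E →L[ℝ] F)) {M : ℝ} (hM : 0 ≤ M)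
    (hA : ∀ x, ‖A x‖ ≤ M) (h : C(K, E)) : ‖pointwiseApply A h‖ ≤ M * ‖h‖ := by
  rw [ContinuousMap.norm_le _ (by positivity)]
  intro x
  exact (A x).le_of_opNorm_le_of_le (hA x) (h.norm_coe_le_norm x)

theorem flow_curve_unique {v : E → E} {K : ℝ≥0} (hL : LipschitzWith K v) {α β : ℝ → E}
    (hα : ∀ t, HasDerivAt α (v (α t)) t) (hβ : ∀ t, HasDerivAt β (v (β t)) t)
    (h0 : α 0 = β 0) : α = β :=
  ODE_solution_unique_univ (v := fun _ => v) (s := fun _ => univ) (t₀ := 0)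
    (fun _ => hL.lipschitzOnWith) (fun t => ⟨hα t, mem_univ _⟩) (fun t => ⟨hβ t, mem_univ _⟩) h0

variable [CompleteSpace E]

theorem exists_global_curve {v : E → E} {K C : ℝ≥0} (hL : LipschitzWith K v)
    (hb : ∀ z, ‖v z‖ ≤ C) (z : E) :
    ∃ α : ℝ → E, α 0 = z ∧ ∀ t, HasDerivAt α (v (α t)) t := by
  have h1 : ∀ T : ℝ≥0, ∃ α : ℝ → E, α 0 = z ∧
      ∀ t ∈ Ioo (-T : ℝ) T, HasDerivAt α (v (α t)) t := by
    intro T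
    have hp : IsPicardLindelof (fun _ => v)
        (⟨0, by simp⟩ : Icc (-T : ℝ) T) z (C * T) 0 C K :=
      IsPicardLindelof.of_time_independent (fun x _ => hb x) hL.lipschitzOnWith (by simp)
    obtain ⟨α, h0, hα⟩ := hp.exists_eq_forall_mem_Icc_hasDerivWithinAt₀
    exact ⟨α, h0, fun t ht => (hα t (Ioo_subset_Icc_self ht)).hasDerivAt (Icc_mem_nhds ht.1 ht.2)⟩
  choose α h0 hα using h1
  have heq : ∀ T T' : ℝ≥0, T ≤ T' → ∀ t ∈ Ioo (-T : ℝ) T, α T t = α T' t := by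
    intro T T' hT t ht
    have hT' : (T : ℝ) ≤ T' := hT
    have hpos : (0 : ℝ) < T := by linarith [ht.1, ht.2]
    exact ODE_solution_unique_of_mem_Ioo (v := fun _ => v) (s := fun _ => univ)
      (fun _ _ => hL.lipschitzOnWith) (t₀ := 0) (by constructor <;> linarith)
      (fun t ht => ⟨hα T t ht, mem_univ _⟩)
      (fun t ht => ⟨hα T' t ⟨by linarith [ht.1], by linarith [ht.2]⟩, mem_univ _⟩)
      ((h0 T).trans (h0 T').symm) ht
  refine ⟨fun t => α (‖t‖₊ + 1) t, h0 _, fun t => ?_⟩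
  have ht : t ∈ Ioo (-(‖t‖₊ + 1 : ℝ≥0) : ℝ) (‖t‖₊ + 1 : ℝ≥0) := by
    simp only [NNReal.coe_add, coe_nnnorm, Real.norm_eq_abs, NNReal.coe_one]
    exact ⟨by linarith [neg_abs_le t], by linarith [le_abs_self t]⟩
  refine (hα (‖t‖₊ + 1) t ht).congr_of_eventuallyEq ?_
  filter_upwards [isOpen_Ioo.mem_nhds ht] with s hs
  have hs' : s ∈ Ioo (-(‖s‖₊ + 1 : ℝ≥0) : ℝ) (‖s‖₊ + 1 : ℝ≥0) := by
    simp only [NNReal.coe_add, coe_nnnorm, Real.norm_eq_abs, NNReal.coe_one]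
    exact ⟨by linarith [neg_abs_le s], by linarith [le_abs_self s]⟩
  rcases le_total (‖s‖₊ + 1) (‖t‖₊ + 1) with h | h
  · exact heq _ _ h s hs'
  · exact (heq _ _ h s hs).symm

/-- The map whose zeros are the integral curves, rescaled to the unit interval. -/
noncomputable def flowEquation (v : C(E, E)) (q : (ℝ × E) × C(Icc (0:ℝ) 1, E)) :
    C(Icc (0:ℝ) 1, E) :=
  q.2 - constCLM _ E q.1.2 - q.1.1 • primitiveCLM E (v.comp q.2)

omit [CompleteSpace E] in
theorem contDiff_flowEquation (v : C(E, E)) (hv : ContDiff ℝ (⊤ : ℕ∞) v) :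
    ContDiff ℝ (⊤ : ℕ∞) (flowEquation v) := by
  have h1 : ContDiff ℝ (⊤ : ℕ∞) (fun q : (ℝ × E) × C(Icc (0:ℝ) 1, E) =>
      primitiveCLM E (v.comp q.2)) :=
    (primitiveCLM E).contDiff.comp ((contDiff_superposition v hv).comp contDiff_snd)
  exact (contDiff_snd.sub ((constCLM _ E).contDiff.comp (contDiff_snd.comp contDiff_fst))).sub
    ((contDiff_fst.comp contDiff_fst).smul h1)

omit [CompleteSpace E] in
theorem flowEquation_unique {v : C(E, E)} {K : ℝ≥0} (hL : LipschitzWith K v) {s : ℝ}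
    (hs : |s| * K < 1) {z : E} {u w : C(Icc (0:ℝ) 1, E)} (hu : flowEquation v ((s, z), u) = 0)
    (hw : flowEquation v ((s, z), w) = 0) : u = w := by
  have h1 : u - w = s • primitiveCLM E (v.comp u - v.comp w) := by
    rw [map_sub, smul_sub]
    simp only [flowEquation] at hu hw
    rw [sub_sub, sub_eq_zero] at hu hw
    nth_rewrite 1 [hu, hw]
    abel
  have h2 : ‖v.comp u - v.comp w‖ ≤ K * ‖u - w‖ := by
    rw [ContinuousMap.norm_le _ (by positivity)]
    intro x
    have h3 := hL.dist_le_mul (u x) (w x)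
    rw [dist_eq_norm, dist_eq_norm] at h3
    have h4 : ‖u x - w x‖ ≤ ‖u - w‖ := (u - w).norm_coe_le_norm x
    simpa using h3.trans (by gcongr)
  have h5 : ‖u - w‖ ≤ |s| * (K * ‖u - w‖) := by
    nth_rewrite 1 [h1]
    rw [norm_smul, Real.norm_eq_abs]
    gcongr
    refine ((primitiveCLM E).le_of_opNorm_le norm_primitiveCLM_le _).trans ?_
    rwa [one_mul]
  by_contra hne
  have h6 : 0 < ‖u - w‖ := norm_pos_iff.2 (sub_ne_zero.2 hne)
  nlinarith

theorem isInvertible_one_sub {X : Type} [NormedAddCommGroup X] [NormedSpace ℝ X] [CompleteSpace X]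
    (T : X →L[ℝ] X) (hT : ‖T‖ < 1) : (ContinuousLinearMap.id ℝ X - T).IsInvertible := by
  refine ⟨ContinuousLinearEquiv.unitsEquiv ℝ X (Units.oneSub T hT), ?_⟩
  rfl

theorem flow_contDiffAt_small {v : E → E} (hv : ContDiff ℝ (⊤ : ℕ∞) v) {K : ℝ≥0}
    (hL : LipschitzWith K v) {Φ : ℝ × E → E} (h0 : ∀ z, Φ (0, z) = z)
    (hΦ : ∀ z s, HasDerivAt (fun s => Φ (s, z)) (v (Φ (s, z))) s) (x₀ : ℝ × E)
    (hx : |x₀.1| * K < 1) : ContDiffAt ℝ (⊤ : ℕ∞) Φ x₀ := by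
  let V : C(E, E) := ⟨v, hv.continuous⟩
  have hc : ∀ z, Continuous fun s => Φ (s, z) := fun z =>
    continuous_iff_continuousAt.2 fun s => (hΦ z s).continuousAt
  let U : ℝ × E → C(Icc (0:ℝ) 1, E) := fun x =>
    ⟨fun τ => Φ (x.1 * τ, x.2), (hc x.2).comp (by fun_prop)⟩
  have hU : ∀ x, flowEquation V (x, U x) = 0 := by
    rintro ⟨s, z⟩
    ext τ
    have h1 : ∫ r in (0:ℝ)..τ, s • v (Φ (s * r, z)) = Φ (s * τ, z) - Φ (s * 0, z) := by
      refine intervalIntegral.integral_eq_sub_of_hasDerivAt (f := fun r => Φ (s * r, z))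
        (fun r _ => ?_) ?_
      · have h2 : HasDerivAt (fun r : ℝ => s * r) s r := by
          simpa using (hasDerivAt_id r).const_mul s
        exact (hΦ z (s * r)).scomp r h2
      · refine Continuous.intervalIntegrable ?_ _ _
        exact continuous_const.smul (hv.continuous.comp ((hc z).comp (by fun_prop)))
    have h3 : ∫ r in (0:ℝ)..τ, v (Φ (s * (projIcc 0 1 zero_le_one r : ℝ), z)) =
        ∫ r in (0:ℝ)..τ, v (Φ (s * r, z)) := by
      refine intervalIntegral.integral_congr fun r hr => ?_
      rw [uIcc_of_le τ.2.1] at hr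
      rw [projIcc_of_mem zero_le_one ⟨hr.1, hr.2.trans τ.2.2⟩]
    rw [mul_zero, h0, intervalIntegral.integral_smul] at h1
    simp only [flowEquation, ContinuousMap.sub_apply, ContinuousMap.smul_apply,
      primitiveCLM_apply, constCLM_apply, ContinuousMap.comp_apply, ContinuousMap.coe_mk, U, V,
      ContinuousMap.zero_apply]
    rw [h3, h1]
    abel
  have hG := contDiff_flowEquation V hv
  have hGat : ContDiffAt ℝ (⊤ : ℕ∞) (flowEquation V) (x₀, U x₀) := hG.contDiffAt
  obtain ⟨v', hv'd, hv'K⟩ : ∃ v' : C(E, E →L[ℝ] E), (∀ y, HasFDerivAt v (v' y) y) ∧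
      ∀ y, ‖v' y‖ ≤ K :=
    ⟨⟨fderiv ℝ v, hv.continuous_fderiv (by simp)⟩,
      fun y => ((hv.differentiable (by simp)) y).hasFDerivAt,
      fun y => norm_fderiv_le_of_lipschitz ℝ hL⟩
  let T : C(Icc (0:ℝ) 1, E) →L[ℝ] C(Icc (0:ℝ) 1, E) :=
    x₀.1 • (primitiveCLM E).comp (pointwiseApply (v'.comp (U x₀)))
  have hT : ‖T‖ < 1 := by
    refine lt_of_le_of_lt (ContinuousLinearMap.opNorm_le_bound _ (by positivity) fun h => ?_) hx
    change ‖x₀.1 • primitiveCLM E (pointwiseApply (v'.comp (U x₀)) h)‖ ≤ _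
    rw [norm_smul, Real.norm_eq_abs, mul_assoc]
    gcongr
    refine ((primitiveCLM E).le_of_opNorm_le norm_primitiveCLM_le _).trans ?_
    rw [one_mul]
    refine norm_pointwiseApply_apply_le _ K.2 (fun x => ?_) h
    rw [ContinuousMap.comp_apply]
    exact hv'K _
  have hderiv : fderiv ℝ (flowEquation V) (x₀, U x₀) ∘L
      .inr ℝ (ℝ × E) C(Icc (0:ℝ) 1, E) = ContinuousLinearMap.id ℝ _ - T := by
    have h1 : HasFDerivAt (fun u => flowEquation V (x₀, u))
        (fderiv ℝ (flowEquation V) (x₀, U x₀) ∘L .inr ℝ (ℝ × E) C(Icc (0:ℝ) 1, E)) (U x₀) := by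
      have := ((hG.differentiable (by simp)) (x₀, U x₀)).hasFDerivAt
      exact this.comp (U x₀) (hasFDerivAt_prodMk_right x₀ (U x₀))
    have h2 : HasFDerivAt (fun u => flowEquation V (x₀, u)) (ContinuousLinearMap.id ℝ _ - T)
        (U x₀) := by
      have h3 := hasFDerivAt_superposition V v' hv'd (U x₀)
      have h4 := ((primitiveCLM E).hasFDerivAt.comp (U x₀) h3).const_smul x₀.1
      exact ((hasFDerivAt_id (U x₀)).sub_const (constCLM _ E x₀.2)).sub h4
    exact h1.unique h2
  have hinv : (fderiv ℝ (flowEquation V) (x₀, U x₀) ∘L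
      .inr ℝ (ℝ × E) C(Icc (0:ℝ) 1, E)).IsInvertible := by
    rw [hderiv]
    exact isInvertible_one_sub T hT
  have hψ := hGat.contDiffAt_implicitFunction (by simp) hinv
  have hev := hGat.eventually_apply_implicitFunction (by simp) hinv
  let one : Icc (0:ℝ) 1 := ⟨1, by simp⟩
  have h5 := (ContinuousMap.evalCLM (M := E) ℝ one).contDiff.contDiffAt.comp x₀ hψ
  refine h5.congr_of_eventuallyEq ?_
  have hopen : ∀ᶠ x : ℝ × E in 𝓝 x₀, |x.1| * K < 1 :=
    (isOpen_lt (by fun_prop) continuous_const).mem_nhds hx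
  filter_upwards [hev, hopen] with x hx1 hx2
  rw [hU x₀] at hx1
  have : U x = hGat.implicitFunction (by simp) hinv x := flowEquation_unique hL hx2 (hU x) hx1
  simp only [Function.comp_apply, ContinuousMap.evalCLM_apply, ← this]
  simp [U, one]

/-- A bounded Lipschitz smooth vector field has a global smooth flow. -/
theorem exists_smooth_flow {v : E → E} (hv : ContDiff ℝ (⊤ : ℕ∞) v) {K C : ℝ≥0}
    (hL : LipschitzWith K v) (hb : ∀ z, ‖v z‖ ≤ C) :
    ∃ Φ : ℝ × E → E, ContDiff ℝ (⊤ : ℕ∞) Φ ∧ (∀ z, Φ (0, z) = z) ∧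
      (∀ z s, HasDerivAt (fun s => Φ (s, z)) (v (Φ (s, z))) s) ∧
      ∀ s t z, Φ (s + t, z) = Φ (s, Φ (t, z)) := by
  choose α h0 hα using exists_global_curve hL hb
  let Φ : ℝ × E → E := fun q => α q.2 q.1
  have hgroup : ∀ s t z, Φ (s + t, z) = Φ (s, Φ (t, z)) := by
    intro s t z
    have h1 : ∀ s, HasDerivAt (fun s => α z (s + t)) (v (α z (s + t))) s := fun s =>
      (hα z (s + t)).comp_add_const s t
    have := flow_curve_unique hL h1 (hα (α z t)) (by simp [h0])
    exact congrFun this s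
  have hder : ∀ z s, HasDerivAt (fun s => Φ (s, z)) (v (Φ (s, z))) s := hα
  refine ⟨Φ, ?_, h0, hder, hgroup⟩
  obtain ⟨a, ha, haK⟩ : ∃ a : ℝ, 0 < a ∧ a * K < 1 := by
    refine ⟨1 / (K + 1), by positivity, ?_⟩
    rw [one_div_mul_eq_div, div_lt_one (by positivity)]
    linarith
  have hsmall : ∀ x : ℝ × E, |x.1| < a → ContDiffAt ℝ (⊤ : ℕ∞) Φ x := fun x hx =>
    flow_contDiffAt_small hv hL h0 hder x
      (lt_of_le_of_lt (mul_le_mul_of_nonneg_right hx.le K.2) haK)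
  have hind : ∀ n : ℕ, ∀ x : ℝ × E, |x.1| < (n + 1) * a → ContDiffAt ℝ (⊤ : ℕ∞) Φ x := by
    intro n
    induction n with
    | zero =>
      intro x hx
      exact hsmall x (by simpa using hx)
    | succ n ih =>
      intro x hx
      push_cast at hx
      have hn : (0 : ℝ) < n + 1 + 1 := by positivity
      have e1 : Φ = fun x : ℝ × E => Φ (x.1 * (1 / (n + 1 + 1)),
          Φ (x.1 * ((n + 1) / (n + 1 + 1)), x.2)) := by
        ext y
        have e2 : y.1 * (1 / (n + 1 + 1)) + y.1 * ((n + 1) / (n + 1 + 1)) = y.1 := by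
          field_simp
          ring
        rw [← hgroup, e2]
      rw [e1]
      have h1 : ContDiffAt ℝ (⊤ : ℕ∞) (fun x : ℝ × E =>
          Φ (x.1 * ((n + 1) / (n + 1 + 1)), x.2)) x := by
        refine ContDiffAt.comp (f := fun x : ℝ × E => (x.1 * ((n + 1) / (n + 1 + 1)), x.2)) x
          (ih _ ?_) (ContDiff.contDiffAt (by fun_prop))
        simp only
        rw [abs_mul, abs_of_nonneg (by positivity : (0 : ℝ) ≤ (n + 1) / (n + 1 + 1)),
          mul_div_assoc', div_lt_iff₀ hn]
        nlinarith
      refine ContDiffAt.comp (f := fun x : ℝ × E => (x.1 * (1 / ((n : ℝ) + 1 + 1)),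
          Φ (x.1 * ((n + 1) / (n + 1 + 1)), x.2))) x (hsmall _ ?_)
        (ContDiffAt.prodMk (ContDiff.contDiffAt (by fun_prop)) h1)
      simp only
      rw [abs_mul, abs_of_nonneg (by positivity : (0 : ℝ) ≤ 1 / (n + 1 + 1)),
          mul_div_assoc', div_lt_iff₀ hn]
      linarith
  rw [contDiff_iff_contDiffAt]
  intro x
  obtain ⟨n, hn⟩ := exists_nat_gt (|x.1| / a)
  refine hind n x ?_
  rw [div_lt_iff₀ ha] at hn
  nlinarith

end Flow

section PartialDerivatives

variable {G : Type} [NormedAddCommGroup G] [NormedSpace ℝ G]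

/-- The partial derivative in the first coordinate. -/
noncomputable def d1 (F : ℝ × ℝ → G) (q : ℝ × ℝ) : G := fderiv ℝ F q (1, 0)

/-- The partial derivative in the second coordinate. -/
noncomputable def d2 (F : ℝ × ℝ → G) (q : ℝ × ℝ) : G := fderiv ℝ F q (0, 1)

theorem contDiff_d1 {F : ℝ × ℝ → G} (hF : ContDiff ℝ (⊤ : ℕ∞) F) : ContDiff ℝ (⊤ : ℕ∞) (d1 F) :=
  (hF.fderiv_right (m := (⊤ : ℕ∞)) (by simp)).clm_apply contDiff_const

theorem contDiff_d2 {F : ℝ × ℝ → G} (hF : ContDiff ℝ (⊤ : ℕ∞) F) : ContDiff ℝ (⊤ : ℕ∞) (d2 F) :=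
  (hF.fderiv_right (m := (⊤ : ℕ∞)) (by simp)).clm_apply contDiff_const

theorem ContDiff.hasFDerivAt_fderiv {X Y : Type} [NormedAddCommGroup X] [NormedSpace ℝ X]
    [NormedAddCommGroup Y] [NormedSpace ℝ Y] {F : X → Y} (hF : ContDiff ℝ (⊤ : ℕ∞) F) (q : X) :
    HasFDerivAt F (fderiv ℝ F q) q :=
  ((hF.differentiable (by simp)) q).hasFDerivAt

theorem fderiv_eq_d1_d2 (F : ℝ × ℝ → G) (q w : ℝ × ℝ) :
    fderiv ℝ F q w = w.1 • d1 F q + w.2 • d2 F q := by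
  have : w = w.1 • ((1 : ℝ), (0 : ℝ)) + w.2 • ((0 : ℝ), (1 : ℝ)) := by
    ext <;> simp
  conv_lhs => rw [this]
  rw [map_add, map_smul, map_smul]
  rfl

theorem hasDerivAt_d1 {F : ℝ × ℝ → G} (hF : ContDiff ℝ (⊤ : ℕ∞) F) (x r : ℝ) :
    HasDerivAt (fun x => F (x, r)) (d1 F (x, r)) x :=
  (hF.hasFDerivAt_fderiv (x, r)).comp_hasDerivAt x
    ((hasDerivAt_id x).prodMk (hasDerivAt_const x r))

theorem hasDerivAt_d2 {F : ℝ × ℝ → G} (hF : ContDiff ℝ (⊤ : ℕ∞) F) (x r : ℝ) :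
    HasDerivAt (fun r => F (x, r)) (d2 F (x, r)) r :=
  (hF.hasFDerivAt_fderiv (x, r)).comp_hasDerivAt r
    ((hasDerivAt_const r x).prodMk (hasDerivAt_id r))

/-- The chain rule along a curve. -/
theorem hasDerivAt_comp_curve {F : ℝ × ℝ → G} (hF : ContDiff ℝ (⊤ : ℕ∞) F) {a b : ℝ → ℝ}
    {a' b' t : ℝ} (ha : HasDerivAt a a' t) (hb : HasDerivAt b b' t) :
    HasDerivAt (fun t => F (a t, b t)) (a' • d1 F (a t, b t) + b' • d2 F (a t, b t)) t := by
  have := (hF.hasFDerivAt_fderiv (a t, b t)).comp_hasDerivAt t (ha.prodMk hb)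
  rwa [fderiv_eq_d1_d2] at this

theorem fderiv_fderiv_comm {X Y : Type} [NormedAddCommGroup X] [NormedSpace ℝ X]
    [NormedAddCommGroup Y] [NormedSpace ℝ Y] {F : X → Y} (hF : ContDiff ℝ (⊤ : ℕ∞) F) (q a b : X) :
    fderiv ℝ (fun q => fderiv ℝ F q a) q b = fderiv ℝ (fun q => fderiv ℝ F q b) q a := by
  have h1 : DifferentiableAt ℝ (fderiv ℝ F) q :=
    (hF.fderiv_right (m := (⊤ : ℕ∞)) (by simp)).differentiable (by simp) q
  have h2 : ∀ w, fderiv ℝ (fun q => fderiv ℝ F q w) q = (fderiv ℝ (fderiv ℝ F) q).flip w := by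
    intro w
    have := (h1.hasFDerivAt.clm_apply (hasFDerivAt_const w q)).fderiv
    rw [this]
    ext
    simp
  have h3 : IsSymmSndFDerivAt ℝ F q := hF.contDiffAt.isSymmSndFDerivAt (by
    simp only [minSmoothness_of_isRCLikeNormedField]
    exact WithTop.coe_le_coe.2 (le_top : (2 : ℕ∞) ≤ ⊤))
  rw [h2, h2]
  exact h3.eq b a

theorem d1_d2_comm {F : ℝ × ℝ → G} (hF : ContDiff ℝ (⊤ : ℕ∞) F) : d1 (d2 F) = d2 (d1 F) :=
  funext fun q => fderiv_fderiv_comm hF q (0, 1) (1, 0)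

theorem d1_of_hasDerivAt {F : ℝ × ℝ → G} (hF : ContDiff ℝ (⊤ : ℕ∞) F) {x r : ℝ} {f' : G}
    (h : HasDerivAt (fun x => F (x, r)) f' x) : d1 F (x, r) = f' :=
  (hasDerivAt_d1 hF x r).unique h

theorem d2_of_hasDerivAt {F : ℝ × ℝ → G} (hF : ContDiff ℝ (⊤ : ℕ∞) F) {x r : ℝ} {f' : G}
    (h : HasDerivAt (fun r => F (x, r)) f' r) : d2 F (x, r) = f' :=
  (hasDerivAt_d2 hF x r).unique h

/-- The Jacobian determinant in coordinates. -/
noncomputable def jac (F : ℝ × ℝ → ℝ × ℝ) (q : ℝ × ℝ) : ℝ :=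
  (d1 F q).1 * (d2 F q).2 - (d2 F q).1 * (d1 F q).2

theorem det_prod (A : ℝ × ℝ →L[ℝ] ℝ × ℝ) :
    A.det = (A (1, 0)).1 * (A (0, 1)).2 - (A (0, 1)).1 * (A (1, 0)).2 := by
  rw [ContinuousLinearMap.det, ← LinearMap.det_toMatrix (Module.Basis.finTwoProd ℝ),
    Matrix.det_fin_two]
  simp [LinearMap.toMatrix_apply]

theorem det_fderiv_eq_jac (F : ℝ × ℝ → ℝ × ℝ) (q : ℝ × ℝ) : (fderiv ℝ F q).det = jac F q :=
  det_prod _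

theorem jac_comp {F H : ℝ × ℝ → ℝ × ℝ} (hF : ContDiff ℝ (⊤ : ℕ∞) F) (hH : ContDiff ℝ (⊤ : ℕ∞) H)
    (q : ℝ × ℝ) : jac (fun q => F (H q)) q = jac F (H q) * jac H q := by
  have h1 := ((hF.hasFDerivAt_fderiv (H q)).comp q (hH.hasFDerivAt_fderiv q)).fderiv
  rw [← det_fderiv_eq_jac, ← det_fderiv_eq_jac, ← det_fderiv_eq_jac]
  change (fderiv ℝ (F ∘ H) q).det = _
  rw [h1]
  exact LinearMap.det_comp _ _

end PartialDerivatives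

section SmoothInverse

open scoped Topology

theorem smooth_inverse {f g : ℝ × ℝ → ℝ × ℝ} {s : Set (ℝ × ℝ)} (hs : IsOpen s)
    (hf : ContDiffOn ℝ (⊤ : ℕ∞) f s) (hdet : ∀ x ∈ s, (fderiv ℝ f x).det ≠ 0)
    (hg : ∀ x ∈ s, g (f x) = x) :
    IsOpen (f '' s) ∧ ∀ y ∈ f '' s, ContDiffAt ℝ (⊤ : ℕ∞) g y := by
  have key : ∀ x ∈ s, ContDiffAt ℝ (⊤ : ℕ∞) g (f x) ∧ f '' s ∈ 𝓝 (f x) := by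
    intro x hx
    have h1 : ContDiffAt ℝ (⊤ : ℕ∞) f x := hf.contDiffAt (hs.mem_nhds hx)
    have h2 : HasFDerivAt f
        ((fderiv ℝ f x).toContinuousLinearEquivOfDetNeZero (hdet x hx) :
          ℝ × ℝ →L[ℝ] ℝ × ℝ) x := by
      rw [ContinuousLinearMap.coe_toContinuousLinearEquivOfDetNeZero]
      exact (h1.differentiableAt (by simp)).hasFDerivAt
    have h3 := h1.to_localInverse h2 (by simp)
    have h4 := (h1.hasStrictFDerivAt' h2 (by simp)).eventually_right_inverse
    have h5 : h1.localInverse h2 (by simp) (f x) = x := h1.localInverse_apply_image h2 (by simp)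
    have h6 : ∀ᶠ y in 𝓝 (f x), h1.localInverse h2 (by simp) y ∈ s := by
      refine h3.continuousAt.eventually_mem ?_
      rw [h5]
      exact hs.mem_nhds hx
    refine ⟨h3.congr_of_eventuallyEq ?_, ?_⟩
    · filter_upwards [h4, h6] with y hy1 hy2
      have := hg _ hy2
      rw [← this]
      congr 1
      exact hy1.symm
    · filter_upwards [h4, h6] with y hy1 hy2
      exact ⟨_, hy2, hy1⟩
  constructor
  · rw [isOpen_iff_mem_nhds]
    rintro _ ⟨x, hx, rfl⟩
    exact (key x hx).2
  · rintro _ ⟨x, hx, rfl⟩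
    exact (key x hx).1

end SmoothInverse

section PeriodicBounds

open scoped NNReal Topology

theorem bounded_of_periodic {X : Type} [NormedAddCommGroup X] {G : ℝ × ℝ → X} (hG : Continuous G)
    (hper : ∀ x ξ, G (x + 2 * π, ξ) = G (x, ξ)) {R M : ℝ}
    (hR : ∀ z : ℝ × ℝ, R < |z.2| → ‖G z‖ ≤ M) : ∃ C : ℝ≥0, ∀ z, ‖G z‖ ≤ C := by
  obtain ⟨C, hC⟩ := (isCompact_Icc.prod isCompact_Icc :
    IsCompact (Icc (0:ℝ) (2 * π) ×ˢ Icc (-R) R)).exists_bound_of_continuousOn hG.continuousOn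
  refine ⟨(max C M).toNNReal, fun z => le_trans ?_ (Real.le_coe_toNNReal _)⟩
  by_cases hz : R < |z.2|
  · exact (hR z hz).trans (le_max_right _ _)
  · have hp : Function.Periodic (fun x => G (x, z.2)) (2 * π) := fun x => hper x z.2
    obtain ⟨y, hy, h⟩ := hp.exists_mem_Ico₀ two_pi_pos z.1
    have h' : G z = G (y, z.2) := h
    rw [h']
    exact (hC (y, z.2) ⟨Ico_subset_Icc_self hy, abs_le.1 (not_lt.1 hz)⟩).trans (le_max_left _ _)

theorem lipschitz_of_periodic {v : ℝ × ℝ → ℝ × ℝ} (hv : ContDiff ℝ (⊤ : ℕ∞) v)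
    (hper : ∀ x ξ, v (x + 2 * π, ξ) = v (x, ξ)) {R : ℝ} {w : ℝ × ℝ}
    (hR : ∀ z : ℝ × ℝ, R ≤ |z.2| → v z = w) :
    ∃ K C : ℝ≥0, LipschitzWith K v ∧ ∀ z, ‖v z‖ ≤ C := by
  obtain ⟨C, hC⟩ := bounded_of_periodic hv.continuous hper (R := R) (M := ‖w‖)
    (fun z hz => by rw [hR z hz.le])
  obtain ⟨K, hK⟩ := bounded_of_periodic (G := fderiv ℝ v) (hv.continuous_fderiv (by simp))
    (fun x ξ => by
      have h1 : v = fun z => v (z + (2 * π, 0)) := by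
        ext1 z
        have := hper z.1 z.2
        simpa [Prod.add_def] using this.symm
      have h2 : fderiv ℝ (fun z => v (z + (2 * π, 0))) (x, ξ) =
          fderiv ℝ v ((x, ξ) + (2 * π, 0)) := fderiv_comp_add_right _
      rw [← h1] at h2
      rw [h2]
      simp) (R := R) (M := 0)
    (fun z hz => by
      have h1 : v =ᶠ[𝓝 z] fun _ => w := by
        have : ∀ᶠ z' : ℝ × ℝ in 𝓝 z, R < |z'.2| :=
          (isOpen_lt continuous_const (by fun_prop)).mem_nhds hz
        filter_upwards [this] with z' hz'
        exact hR z' hz'.le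
      rw [h1.fderiv_eq]
      simp)
  exact ⟨K, C, lipschitzWith_of_nnnorm_fderiv_le (hv.differentiable (by simp))
    (fun z => by exact_mod_cast hK z), hC⟩

end PeriodicBounds

section PlaneFlow

open scoped NNReal Topology

theorem hasDerivAt_fst {f : ℝ → ℝ × ℝ} {f' : ℝ × ℝ} {t : ℝ} (hf : HasDerivAt f f' t) :
    HasDerivAt (fun t => (f t).1) f'.1 t :=
  (ContinuousLinearMap.fst ℝ ℝ ℝ).hasFDerivAt.comp_hasDerivAt t hf

theorem hasDerivAt_snd {f : ℝ → ℝ × ℝ} {f' : ℝ × ℝ} {t : ℝ} (hf : HasDerivAt f f' t) :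
    HasDerivAt (fun t => (f t).2) f'.2 t :=
  (ContinuousLinearMap.snd ℝ ℝ ℝ).hasFDerivAt.comp_hasDerivAt t hf

/-- `Φ` is the global smooth flow of the Lipschitz vector field `v` on the plane. -/
structure IsPlaneFlow (v : ℝ × ℝ → ℝ × ℝ) (Φ : ℝ × (ℝ × ℝ) → ℝ × ℝ) : Prop where
  smooth_field : ContDiff ℝ (⊤ : ℕ∞) v
  lipschitz : ∃ K : ℝ≥0, LipschitzWith K v
  smooth : ContDiff ℝ (⊤ : ℕ∞) Φ
  zero : ∀ z, Φ (0, z) = z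
  deriv : ∀ z s, HasDerivAt (fun s => Φ (s, z)) (v (Φ (s, z))) s
  add : ∀ s t z, Φ (s + t, z) = Φ (s, Φ (t, z))

theorem exists_planeFlow {v : ℝ × ℝ → ℝ × ℝ} (hv : ContDiff ℝ (⊤ : ℕ∞) v)
    (hper : ∀ x ξ, v (x + 2 * π, ξ) = v (x, ξ)) {R : ℝ} {w : ℝ × ℝ}
    (hR : ∀ z : ℝ × ℝ, R ≤ |z.2| → v z = w) : ∃ Φ, IsPlaneFlow v Φ := by
  obtain ⟨K, C, hK, hC⟩ := lipschitz_of_periodic hv hper hR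
  obtain ⟨Φ, h1, h2, h3, h4⟩ := exists_smooth_flow hv hK hC
  exact ⟨Φ, hv, ⟨K, hK⟩, h1, h2, h3, h4⟩

namespace IsPlaneFlow

variable {v : ℝ × ℝ → ℝ × ℝ} {Φ : ℝ × (ℝ × ℝ) → ℝ × ℝ} (h : IsPlaneFlow v Φ)
include h

theorem neg_left (s : ℝ) (z : ℝ × ℝ) : Φ (-s, Φ (s, z)) = z := by
  rw [← h.add, neg_add_cancel, h.zero]

theorem neg_right (s : ℝ) (z : ℝ × ℝ) : Φ (s, Φ (-s, z)) = z := by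
  rw [← h.add, add_neg_cancel, h.zero]

theorem injective (s : ℝ) : Function.Injective fun z => Φ (s, z) := fun a b hab => by
  rw [← h.neg_left s a, ← h.neg_left s b]
  exact congrArg (fun w => Φ (-s, w)) hab

theorem continuous_curve (z : ℝ × ℝ) : Continuous fun s => Φ (s, z) :=
  h.smooth.continuous.comp (by fun_prop)

theorem unique_of_nonneg {β : ℝ → ℝ × ℝ} {s : ℝ} (hs : 0 ≤ s)
    (hβ : ∀ t ∈ Icc 0 s, HasDerivAt β (v (β t)) t) : β s = Φ (s, β 0) := by
  obtain ⟨K, hK⟩ := h.lipschitz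
  exact ODE_solution_unique (v := fun _ => v) (fun _ => hK)
    (fun t ht => (hβ t ht).continuousAt.continuousWithinAt)
    (fun t ht => (hβ t (Ico_subset_Icc_self ht)).hasDerivWithinAt)
    (h.continuous_curve _).continuousOn
    (fun t _ => (h.deriv _ t).hasDerivWithinAt) (h.zero _).symm ⟨hs, le_rfl⟩

theorem unique {β : ℝ → ℝ × ℝ} (hβ : ∀ t, HasDerivAt β (v (β t)) t) (s : ℝ) :
    β s = Φ (s, β 0) := by
  obtain ⟨K, hK⟩ := h.lipschitz
  exact congrFun (flow_curve_unique hK hβ (h.deriv (β 0)) (h.zero _).symm) s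

/-- Where the field is vertical, the flow is a vertical translation. -/
theorem eq_translation {z : ℝ × ℝ} {s : ℝ} (hs : 0 ≤ s)
    (hv : ∀ t ∈ Icc 0 s, v (z.1, z.2 + t) = (0, 1)) : Φ (s, z) = (z.1, z.2 + s) := by
  have := h.unique_of_nonneg (β := fun t => (z.1, z.2 + t)) hs (fun t ht => by
    rw [hv t ht]
    exact (hasDerivAt_const t z.1).prodMk ((hasDerivAt_id t).const_add z.2))
  simp only [add_zero] at this
  exact this.symm

theorem eq_translation_neg {z : ℝ × ℝ} {s : ℝ} (hs : 0 ≤ s)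
    (hv : ∀ t ∈ Icc 0 s, v (z.1, z.2 - t) = (0, 1)) : Φ (-s, z) = (z.1, z.2 - s) := by
  have := h.eq_translation (z := (z.1, z.2 - s)) hs (fun t ht => by
    have := hv (s - t) ⟨by linarith [ht.2], by linarith [ht.1]⟩
    simpa [sub_sub_eq_add_sub, sub_add_eq_add_sub] using this)
  simp only [sub_add_cancel] at this
  calc Φ (-s, z) = Φ (-s, Φ (s, (z.1, z.2 - s))) := by rw [this]
    _ = (z.1, z.2 - s) := h.neg_left _ _

theorem equivariant {a : ℝ × ℝ} (hper : ∀ z, v (z + a) = v z) (s : ℝ) (z : ℝ × ℝ) :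
    Φ (s, z + a) = Φ (s, z) + a := by
  have := h.unique (β := fun t => Φ (t, z) + a) (fun t => by
    rw [hper]
    exact (h.deriv z t).add_const a) s
  simp only [h.zero] at this
  exact this.symm

theorem contDiff_slice (s : ℝ) : ContDiff ℝ (⊤ : ℕ∞) fun z => Φ (s, z) :=
  h.smooth.comp (by fun_prop)

theorem fderiv_slice (s : ℝ) (z w : ℝ × ℝ) :
    fderiv ℝ (fun z => Φ (s, z)) z w = fderiv ℝ Φ (s, z) (0, w) := by
  have h1 := ((h.smooth.hasFDerivAt_fderiv (s, z)).comp z (hasFDerivAt_prodMk_right s z)).fderiv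
  change fderiv ℝ (Φ ∘ fun z => (s, z)) z w = _
  rw [h1]
  rfl

theorem fderiv_time (q : ℝ × (ℝ × ℝ)) : fderiv ℝ Φ q (1, 0) = v (Φ q) := by
  have h1 : HasDerivAt (fun s => Φ (s, q.2)) (fderiv ℝ Φ q (1, 0)) q.1 :=
    (h.smooth.hasFDerivAt_fderiv q).comp_hasDerivAt q.1
      ((hasDerivAt_id q.1).prodMk (hasDerivAt_const q.1 q.2))
  exact h1.unique (h.deriv q.2 q.1)

theorem variation (z w : ℝ × ℝ) (s : ℝ) :
    HasDerivAt (fun s => fderiv ℝ (fun z => Φ (s, z)) z w)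
      (fderiv ℝ v (Φ (s, z)) (fderiv ℝ (fun z => Φ (s, z)) z w)) s := by
  simp only [h.fderiv_slice]
  have h0 : ContDiff ℝ (⊤ : ℕ∞) fun q => fderiv ℝ Φ q (0, w) :=
    (h.smooth.fderiv_right (m := (⊤ : ℕ∞)) (by simp)).clm_apply contDiff_const
  have h0' := h0.hasFDerivAt_fderiv (s, z)
  have h1 : HasDerivAt (fun s => fderiv ℝ Φ (s, z) (0, w))
      (fderiv ℝ (fun q => fderiv ℝ Φ q (0, w)) (s, z) (1, 0)) s :=
    HasFDerivAt.comp_hasDerivAt (f := fun s => (s, z)) s h0'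
      ((hasDerivAt_id s).prodMk (hasDerivAt_const s z))
  rw [fderiv_fderiv_comm h.smooth] at h1
  have h2 : (fun q => fderiv ℝ Φ q (1, 0)) = fun q => v (Φ q) := funext h.fderiv_time
  rw [h2] at h1
  have h3 := ((h.smooth_field.hasFDerivAt_fderiv (Φ (s, z))).comp (s, z)
    (h.smooth.hasFDerivAt_fderiv (s, z))).fderiv
  have h4 : (fun q => v (Φ q)) = v ∘ Φ := rfl
  rw [h4, h3] at h1
  exact h1

theorem jac_zero (z : ℝ × ℝ) : jac (fun z => Φ (0, z)) z = 1 := by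
  have : (fun z => Φ (0, z)) = id := funext h.zero
  rw [this, jac, d1, d2]
  simp

theorem jac_ne_zero (s : ℝ) (z : ℝ × ℝ) : jac (fun z => Φ (s, z)) z ≠ 0 := by
  have h1 := jac_comp (h.contDiff_slice (-s)) (h.contDiff_slice s) z
  simp only [h.neg_left] at h1
  have h2 : jac (fun z : ℝ × ℝ => z) z = 1 := by
    rw [jac, d1, d2]
    simp
  rw [h2] at h1
  intro h3
  rw [h3, mul_zero] at h1
  exact one_ne_zero h1

theorem continuous_jac (z : ℝ × ℝ) : Continuous fun s => jac (fun z => Φ (s, z)) z := by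
  have h1 : ∀ w : ℝ × ℝ, Continuous fun s => fderiv ℝ (fun z => Φ (s, z)) z w := fun w =>
    continuous_iff_continuousAt.2 fun s => (h.variation z w s).continuousAt
  exact (((h1 (1, 0)).fst).mul ((h1 (0, 1)).snd)).sub (((h1 (0, 1)).fst).mul ((h1 (1, 0)).snd))

theorem jac_pos (s : ℝ) (z : ℝ × ℝ) : 0 < jac (fun z => Φ (s, z)) z := by
  by_contra hneg
  rw [not_lt] at hneg
  have h1 : (0 : ℝ) ∈ Icc (jac (fun z => Φ (s, z)) z) (jac (fun z => Φ (0, z)) z) :=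
    ⟨hneg, by rw [h.jac_zero]; exact zero_le_one⟩
  obtain ⟨t, ht⟩ := mem_range_of_exists_le_of_exists_ge (h.continuous_jac z) ⟨s, h1.1⟩ ⟨0, h1.2⟩
  exact h.jac_ne_zero t z ht

theorem jac_eq_one (hdiv : ∀ z, (d1 v z).1 + (d2 v z).2 = 0) (s : ℝ) (z : ℝ × ℝ) :
    jac (fun z => Φ (s, z)) z = 1 := by
  have h1 : ∀ s, HasDerivAt (fun s => jac (fun z => Φ (s, z)) z) 0 s := by
    intro s
    have a := h.variation z (1, 0) s
    have b := h.variation z (0, 1) s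
    have := ((hasDerivAt_fst a).mul (hasDerivAt_snd b)).sub
      ((hasDerivAt_fst b).mul (hasDerivAt_snd a))
    refine this.congr_deriv ?_
    rw [fderiv_eq_d1_d2 v, fderiv_eq_d1_d2 v]
    simp only [Prod.fst_add, Prod.smul_fst, smul_eq_mul, Prod.snd_add, Prod.smul_snd]
    have hd := hdiv (Φ (s, z))
    generalize fderiv ℝ (fun z => Φ (s, z)) z (1, 0) = A
    generalize fderiv ℝ (fun z => Φ (s, z)) z (0, 1) = B
    linear_combination (A.1 * B.2 - A.2 * B.1) * hd
  have h2 := is_const_of_deriv_eq_zero (fun s => (h1 s).differentiableAt)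
    (fun s => (h1 s).deriv) s 0
  exact h2.trans (h.jac_zero z)

end IsPlaneFlow

end PlaneFlow

section AngleLifts

open scoped Topology

theorem int_valued_const {X : Type*} [TopologicalSpace X] {S : Set X} (hS : IsPreconnected S)
    {D : X → ℝ} (hD : ContinuousOn D S) (a : ℝ)
    (h : ∀ q ∈ S, ∃ k : ℤ, D q = a + k * (2 * π)) {x y : X} (hx : x ∈ S) (hy : y ∈ S) :
    D x = D y := by
  have key : ∀ {x y : X}, x ∈ S → y ∈ S → ¬ D x < D y := by
    intro x y hx hy hlt
    obtain ⟨k, hk⟩ := h x hx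
    obtain ⟨l, hl⟩ := h y hy
    have hkl : k + 1 ≤ l := by
      by_contra hcon
      have : (l : ℝ) ≤ k := by exact_mod_cast (by omega : l ≤ k)
      nlinarith [Real.pi_pos]
    have hkl' : (k : ℝ) + 1 ≤ l := by exact_mod_cast hkl
    obtain ⟨q, hq, hqD⟩ : D x + π ∈ D '' S := by
      apply (hS.image D hD).ordConnected.out ⟨x, hx, rfl⟩ ⟨y, hy, rfl⟩
      constructor <;> nlinarith [Real.pi_pos]
    obtain ⟨m, hm⟩ := h q hq
    have h1 : ((2 * m : ℤ) : ℝ) = ((2 * k + 1 : ℤ) : ℝ) := by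
      have : (2 * (m : ℝ)) * π = (2 * k + 1) * π := by linarith
      push_cast
      exact mul_right_cancel₀ Real.pi_ne_zero this
    have h2 : 2 * m = 2 * k + 1 := by exact_mod_cast h1
    omega
  exact le_antisymm (not_lt.1 (key hy hx)) (not_lt.1 (key hx hy))

/-- A nowhere vanishing continuous planar function on an open convex set has a continuous
angle function. -/
theorem exists_angle {E : Type*} [NormedAddCommGroup E] [NormedSpace ℝ E] {S : Set E}
    (hS : Convex ℝ S) (ho : IsOpen S) {f : E → ℝ × ℝ}
    (hf : ContinuousOn f S) (hne : ∀ q ∈ S, f q ≠ 0) :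
    ∃ φ : E → ℝ, ContinuousOn φ S ∧
      ∀ q ∈ S, ∃ ρ > 0, f q = (ρ * cos (φ q), ρ * sin (φ q)) := by
  classical
  rcases S.eq_empty_or_nonempty with rfl | hSne
  · exact ⟨fun _ => 0, by simp, by simp⟩
  obtain ⟨q₀, hq₀⟩ := hSne
  have := hS.contractibleSpace ⟨q₀, hq₀⟩
  have : LocallyPathConnectedSpace S := ho.locallyPathConnectedSpace
  let g : C(S, ℂ) := ⟨fun q => ((f q).1 : ℂ) + ((f q).2 : ℂ) * Complex.I, by
    have h1 : Continuous fun q : S => f q := hf.domRestrict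
    exact (Complex.continuous_ofReal.comp (continuous_fst.comp h1)).add
      ((Complex.continuous_ofReal.comp (continuous_snd.comp h1)).mul continuous_const)⟩
  have hg : ∀ q, g q ∈ ({0}ᶜ : Set ℂ) := by
    intro q hq
    apply hne q q.2
    have h0 : ((f q).1 : ℂ) + ((f q).2 : ℂ) * Complex.I = 0 := hq
    have h1 := congrArg Complex.re h0
    have h2 := congrArg Complex.im h0
    simp at h1 h2
    exact Prod.ext h1 h2
  obtain ⟨F, ⟨-, hF⟩, -⟩ := Complex.isCoveringMapOn_exp.existsUnique_continuousMap_lifts g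
    (a₀ := ⟨q₀, hq₀⟩) (e₀ := Complex.log (g ⟨q₀, hq₀⟩)) (Complex.exp_log (hg _)) hg
  have hF' : ∀ q, Complex.exp (F q) = g q := fun q => congrFun hF q
  refine ⟨fun q => if hq : q ∈ S then (F ⟨q, hq⟩).im else 0, ?_, ?_⟩
  · rw [continuousOn_iff_continuous_domRestrict]
    have : S.domRestrict (fun q => if hq : q ∈ S then (F ⟨q, hq⟩).im else 0)
        = fun q => (F q).im := by
      funext q
      exact dif_pos q.2
    rw [this]
    exact Complex.continuous_im.comp F.continuous
  · intro q hq
    refine ⟨Real.exp (F ⟨q, hq⟩).re, Real.exp_pos _, ?_⟩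
    have h0 : Complex.exp (F ⟨q, hq⟩) = ((f q).1 : ℂ) + ((f q).2 : ℂ) * Complex.I := hF' ⟨q, hq⟩
    have h1 := congrArg Complex.re h0
    have h2 := congrArg Complex.im h0
    rw [Complex.exp_re] at h1
    rw [Complex.exp_im] at h2
    simp at h1 h2
    simp only [hq, dif_pos]
    exact Prod.ext h1.symm h2.symm

theorem cos_nonneg_narrow {χ : ℝ → ℝ} (hχ : Continuous χ) (h : ∀ s, 0 ≤ cos (χ s)) (a b : ℝ) :
    χ a < χ b + 2 * π := by
  by_contra hcon
  push Not at hcon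
  set m := toIcoMod Real.two_pi_pos (χ b) π with hm
  have h1 : m ∈ Ico (χ b) (χ b + 2 * π) := toIcoMod_mem_Ico _ _ _
  obtain ⟨s, hs⟩ : m ∈ range χ := by
    apply (isPreconnected_range hχ).ordConnected.out ⟨b, rfl⟩ ⟨a, rfl⟩
    exact ⟨h1.1, h1.2.le.trans hcon⟩
  have h2 : cos m = -1 := by
    rw [hm, toIcoMod]
    simp only [zsmul_eq_mul]
    rw [Real.cos_sub_int_mul_two_pi, Real.cos_pi]
  have := h s
  rw [hs, h2] at this
  linarith

theorem neg_polar {ρ ρ' a b : ℝ} (hρ : 0 < ρ) (hρ' : 0 < ρ') (h1 : ρ * cos a = -(ρ' * cos b))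
    (h2 : ρ * sin a = -(ρ' * sin b)) : cos (a - b) = -1 := by
  have e1 := Real.sin_sq_add_cos_sq a
  have e2 := Real.sin_sq_add_cos_sq b
  have h3 : ρ ^ 2 = ρ' ^ 2 := by
    have : (ρ * cos a) ^ 2 + (ρ * sin a) ^ 2 = (ρ' * cos b) ^ 2 + (ρ' * sin b) ^ 2 := by
      rw [h1, h2]; ring
    nlinarith
  have h4 : ρ = ρ' := by nlinarith
  subst h4
  have h5 : cos a = - cos b := by
    apply mul_left_cancel₀ hρ.ne'; linarith
  have h6 : sin a = - sin b := by
    apply mul_left_cancel₀ hρ.ne'; linarith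
  rw [Real.cos_sub, h5, h6]; nlinarith

theorem pos_polar {ρ ρ' a b : ℝ} (hρ : 0 < ρ) (hρ' : 0 < ρ') (h1 : ρ * cos a = ρ' * cos b)
    (h2 : ρ * sin a = ρ' * sin b) : cos (a - b) = 1 := by
  have := neg_polar (a := a) (b := b + π) hρ hρ' (by rw [Real.cos_add_pi]; linarith)
    (by rw [Real.sin_add_pi]; linarith)
  rw [← sub_sub, Real.cos_sub_pi] at this
  linarith

theorem cos_eq_neg_one_form {x : ℝ} (h : cos x = -1) : ∃ k : ℤ, x = π + k * (2 * π) := by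
  obtain ⟨k, hk⟩ := Real.cos_eq_neg_one_iff.1 h
  exact ⟨k, by linarith⟩

theorem cos_eq_one_form {x : ℝ} (h : cos x = 1) : ∃ k : ℤ, x = 0 + k * (2 * π) := by
  obtain ⟨k, hk⟩ := Real.cos_eq_one_iff x |>.1 h
  exact ⟨k, by linarith⟩

/-- A simple closed curve cannot have all its short chords within a right angle of a continuous
periodic angle function. -/
theorem no_closed_loop_chords {ℓ : ℝ → ℝ × ℝ} {T : ℝ} (hℓ : Continuous ℓ)
    (hper : ∀ s, ℓ (s + T) = ℓ s) (hinj : ∀ s t, s < t → t < s + T → ℓ t ≠ ℓ s)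
    {ω : ℝ → ℝ} (hω : Continuous ω) (hωper : ∀ s, ω (s + T) = ω s) {δ : ℝ} (hδ : 0 < δ)
    (hδT : δ < T)
    (hch : ∀ s, 0 ≤ ((ℓ (s + δ)).1 - (ℓ s).1) * cos (ω s)
      + ((ℓ (s + δ)).2 - (ℓ s).2) * sin (ω s)) : False := by
  set S : Set (ℝ × ℝ) := {q | q.1 < q.2 ∧ q.2 < q.1 + T} with hSdef
  have hSc : Convex ℝ S := by
    rw [convex_iff_forall_pos]
    rintro ⟨s, t⟩ ⟨h1, h2⟩ ⟨s', t'⟩ ⟨h1', h2'⟩ a b ha hb hab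
    simp only [smul_eq_mul, Prod.smul_mk, Prod.mk_add_mk, hSdef, mem_ofPred_eq] at *
    constructor
    · nlinarith
    · have : T = a * T + b * T := by rw [← add_mul, hab, one_mul]
      nlinarith
  have hSo : IsOpen S :=
    (isOpen_lt continuous_fst continuous_snd).inter
      (isOpen_lt continuous_snd (continuous_fst.add continuous_const))
  obtain ⟨φ, hφ, hφ'⟩ := exists_angle hSc hSo (f := fun q => ℓ q.2 - ℓ q.1)
    (by fun_prop) (fun q hq => sub_ne_zero.2 (hinj _ _ hq.1 hq.2))
  have hmem : ∀ q ∈ S, ((q.2, q.1 + T) : ℝ × ℝ) ∈ S := by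
    rintro ⟨s, t⟩ ⟨h1, h2⟩
    exact ⟨h2, by simpa using h1⟩
  have hDc : ContinuousOn (fun q : ℝ × ℝ => φ (q.2, q.1 + T) - φ q) S := by
    apply ContinuousOn.sub _ hφ
    exact hφ.comp (by fun_prop) hmem
  have hD : ∀ q ∈ S, ∃ k : ℤ, φ (q.2, q.1 + T) - φ q = π + k * (2 * π) := by
    intro q hq
    obtain ⟨ρ, hρ, e1⟩ := hφ' q hq
    obtain ⟨ρ', hρ', e2⟩ := hφ' _ (hmem q hq)
    apply cos_eq_neg_one_form
    simp only [hper, Prod.ext_iff, Prod.fst_sub, Prod.snd_sub] at e1 e2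
    apply neg_polar hρ' hρ
    · rw [← e1.1, ← e2.1]; ring
    · rw [← e1.2, ← e2.2]; ring
  have hchord : ∀ s, ((s, s + δ) : ℝ × ℝ) ∈ S := fun s => ⟨by simpa using hδ, by simpa using hδT⟩
  have hconst := fun {x y : ℝ × ℝ} (hx : x ∈ S) (hy : y ∈ S) =>
    int_valued_const hSc.isPreconnected hDc π hD hx hy
  obtain ⟨k, hk⟩ := hD _ (hchord 0)
  set χ : ℝ → ℝ := fun s => φ (s, s + δ) - ω s with hχ
  have hχc : Continuous χ :=
    (hφ.comp_continuous (f := fun s : ℝ => ((s, s + δ) : ℝ × ℝ)) (by fun_prop) hchord).sub hω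
  have hχ0 : ∀ s, 0 ≤ cos (χ s) := by
    intro s
    obtain ⟨ρ, hρ, e1⟩ := hφ' _ (hchord s)
    simp only [Prod.ext_iff, Prod.fst_sub, Prod.snd_sub] at e1
    have := hch s
    rw [e1.1, e1.2] at this
    rw [hχ]
    simp only
    rw [Real.cos_sub]
    by_contra hneg
    push Not at hneg
    nlinarith
  have hjump : χ T - χ 0 = 2 * (π + k * (2 * π)) := by
    have h1 := hconst (hchord 0) (hchord 0)
    have h2 := hconst (hmem _ (hchord 0)) (hchord 0)
    simp only [hχ]
    have h3 := hωper 0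
    simp only [zero_add] at *
    have h4 : δ + T = T + δ := add_comm _ _
    rw [h4, ] at h2
    rw [h3]
    linarith
  have b1 := cos_nonneg_narrow hχc hχ0 T 0
  have b2 := cos_nonneg_narrow hχc hχ0 0 T
  rcases le_or_gt 0 k with hk0 | hk0
  · have : (0 : ℝ) ≤ k := by exact_mod_cast hk0
    nlinarith [Real.pi_pos]
  · have : (k : ℝ) ≤ -1 := by exact_mod_cast (by omega : k ≤ -1)
    nlinarith [Real.pi_pos]

theorem monotoneOn_of_rightDeriv {g g' : ℝ → ℝ} {a b : ℝ} (hg : ContinuousOn g (Icc a b))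
    (hd : ∀ x ∈ Ico a b, HasDerivWithinAt g (g' x) (Ici x) x) (h0 : ∀ x ∈ Ico a b, 0 ≤ g' x)
    (hab : a ≤ b) : g a ≤ g b := by
  have := image_le_of_deriv_right_le_deriv_boundary (f := fun x => - g x) (f' := fun x => - g' x)
    (B := fun _ => - g a) (B' := fun _ => 0) hg.neg (fun x hx => (hd x hx).neg) le_rfl
    continuousOn_const (fun x _ => hasDerivWithinAt_const _ _ _)
    (fun x hx => by simpa using h0 x hx) (x := b) ⟨hab, le_rfl⟩
  simpa using this

theorem uniform_of_periodic {ω : ℝ → ℝ} {T : ℝ} (hT : 0 < T) (hω : Continuous ω)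
    (hper : ∀ s, ω (s + T) = ω s) {κ : ℝ} (hκ : 0 < κ) :
    ∃ δ > 0, δ < T ∧ ∀ s u, s ≤ u → u ≤ s + δ → |ω u - ω s| ≤ κ := by
  have huc := isCompact_Icc.uniformContinuousOn_of_continuous
    (hω.continuousOn (s := Icc 0 (2 * T)))
  obtain ⟨δ, hδ, h⟩ := Metric.uniformContinuousOn_iff.1 huc κ hκ
  refine ⟨min (δ / 2) (T / 2), by positivity, (min_le_right _ _).trans_lt (by linarith), ?_⟩
  intro s u hsu hu
  have hP : Function.Periodic ω T := hper
  obtain ⟨n, hn⟩ : ∃ n : ℤ, s - n * T ∈ Ico 0 T := by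
    refine ⟨⌊s / T⌋, ?_, ?_⟩
    · have := Int.floor_le (s / T)
      rw [le_div_iff₀ hT] at this
      linarith
    · have := Int.lt_floor_add_one (s / T)
      rw [div_lt_iff₀ hT] at this
      linarith
  have h1 := min_le_left (δ / 2) (T / 2)
  have h2 := min_le_right (δ / 2) (T / 2)
  have := h (u - n * T) ⟨by linarith [hn.1], by linarith [hn.2]⟩ (s - n * T)
    ⟨hn.1, by linarith [hn.2]⟩ (by
      rw [Real.dist_eq, abs_lt]; constructor <;> linarith)
  rw [hP.sub_int_mul_eq, hP.sub_int_mul_eq, Real.dist_eq] at this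
  exact this.le

theorem no_closed_loop {ℓ : ℝ → ℝ × ℝ} {T κ : ℝ} (hT : 0 < T) (hℓ : Continuous ℓ)
    (hper : ∀ s, ℓ (s + T) = ℓ s) (hinj : ∀ s t, s < t → t < s + T → ℓ t ≠ ℓ s)
    {Θ : ℝ × ℝ → ℝ} (hΘ : Continuous Θ) (hκ : 0 < κ)
    (hd : ∀ s, ∃ ρ ≥ 0, ∃ α, |α - Θ (ℓ s)| ≤ π / 2 - κ ∧
      HasDerivWithinAt ℓ (ρ * cos α, ρ * sin α) (Ici s) s) : False := by
  have hper' : ∀ s, Θ (ℓ (s + T)) = Θ (ℓ s) := fun s => by rw [hper]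
  obtain ⟨δ, hδ, hδT, h⟩ := uniform_of_periodic (ω := fun s => Θ (ℓ s)) hT (hΘ.comp hℓ) hper' hκ
  choose ρ hρ α hα hder using hd
  refine no_closed_loop_chords hℓ hper hinj (hΘ.comp hℓ) hper' hδ hδT fun s => ?_
  have := monotoneOn_of_rightDeriv
    (g := fun u => (ℓ u).1 * cos (Θ (ℓ s)) + (ℓ u).2 * sin (Θ (ℓ s)))
    (g' := fun u => ρ u * cos (α u - Θ (ℓ s))) (a := s) (b := s + δ) (by fun_prop) ?_ ?_
    (by linarith)
  · simp only [Function.comp] at this ⊢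
    linarith
  · intro u _
    have h1 : HasDerivWithinAt (fun u => (ℓ u).1) (ρ u * cos (α u)) (Ici u) u :=
      (ContinuousLinearMap.fst ℝ ℝ ℝ).hasFDerivAt.comp_hasDerivWithinAt u (hder u)
    have h2 : HasDerivWithinAt (fun u => (ℓ u).2) (ρ u * sin (α u)) (Ici u) u :=
      (ContinuousLinearMap.snd ℝ ℝ ℝ).hasFDerivAt.comp_hasDerivWithinAt u (hder u)
    refine ((h1.mul_const _).add (h2.mul_const _)).congr_deriv ?_
    rw [Real.cos_sub]; ring
  · intro u hu
    have h1 := abs_le.1 (hα u)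
    have h2 := abs_le.1 (h s u hu.1 hu.2.le)
    apply mul_nonneg (hρ u)
    apply Real.cos_nonneg_of_neg_pi_div_two_le_of_le <;> linarith

theorem no_bigon {Θ : ℝ × ℝ → ℝ} (hΘ : Continuous Θ) {κ a b : ℝ} (hκ : 0 < κ) (ha : 0 < a)
    (hb : 0 ≤ b) {z η : ℝ → ℝ × ℝ}
    (hz : ∀ t ∈ Icc 0 a, ∃ ρ ≥ 0, ∃ α, |α - Θ (z t)| ≤ π / 2 - κ ∧
      HasDerivAt z (ρ * cos α, ρ * sin α) t)
    (hη : ∀ t ∈ Icc 0 b, ∃ ρ ≥ 0, ∃ α, |α - Θ (η t)| ≤ π / 2 - κ ∧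
      HasDerivAt η (ρ * cos α, ρ * sin α) t)
    (h1 : η 0 = z a) (h2 : η b = z 0) (hzi : InjOn z (Ico 0 a)) (hηi : InjOn η (Ico 0 b))
    (hne : ∀ t ∈ Ico 0 a, ∀ r ∈ Ico 0 b, z t ≠ η r) : False := by
  have hT : 0 < a + b := by linarith
  have : Fact (0 < a + b) := ⟨hT⟩
  set f : ℝ → ℝ × ℝ := fun t => if t ≤ a then z t else η (t - a) with hf
  have hfa : ∀ t, a ≤ t → f t = η (t - a) := by
    intro t ht
    rcases ht.eq_or_lt with rfl | ht
    · simp [hf, h1]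
    · simp [hf, not_le.2 ht]
  have hfz : ∀ t, t ≤ a → f t = z t := fun t ht => by simp [hf, ht]
  have hfc : ContinuousOn f (Icc 0 (a + b)) := by
    have e : Icc 0 (a + b) = Icc 0 a ∪ Icc a (a + b) := (Icc_union_Icc_eq_Icc ha.le (by linarith)).symm
    rw [e]
    apply ContinuousOn.union_of_isClosed _ _ isClosed_Icc isClosed_Icc
    · have : ContinuousOn z (Icc 0 a) := fun t ht => by
        obtain ⟨_, _, _, _, h⟩ := hz t ht
        exact h.continuousAt.continuousWithinAt
      exact this.congr fun t ht => hfz t ht.2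
    · have : ContinuousOn η (Icc 0 b) := fun t ht => by
        obtain ⟨_, _, _, _, h⟩ := hη t ht
        exact h.continuousAt.continuousWithinAt
      have h3 : ContinuousOn (fun t => η (t - a)) (Icc a (a + b)) :=
        this.comp (by fun_prop) fun t ht => ⟨by linarith [ht.1], by linarith [ht.2]⟩
      exact h3.congr fun t ht => hfa t ht.1
  have hf0 : f 0 = f (a + b) := by
    rw [hfz 0 ha.le, hfa _ (by linarith), add_sub_cancel_left, h2]
  have hfi : InjOn f (Ico 0 (a + b)) := by
    intro s hs t ht hst
    rcases lt_or_ge s a with hsa | hsa <;> rcases lt_or_ge t a with hta | hta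
    · rw [hfz s hsa.le, hfz t hta.le] at hst
      exact hzi ⟨hs.1, hsa⟩ ⟨ht.1, hta⟩ hst
    · rw [hfz s hsa.le, hfa t hta] at hst
      exact absurd hst (hne s ⟨hs.1, hsa⟩ _ ⟨by linarith, by linarith [ht.2]⟩)
    · rw [hfa s hsa, hfz t hta.le] at hst
      exact absurd hst.symm (hne t ⟨ht.1, hta⟩ _ ⟨by linarith, by linarith [hs.2]⟩)
    · rw [hfa s hsa, hfa t hta] at hst
      have := hηi (x₁ := s - a) ⟨by linarith, by linarith [hs.2]⟩ (x₂ := t - a)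
        ⟨by linarith, by linarith [ht.2]⟩ hst
      linarith
  set ℓ : ℝ → ℝ × ℝ := fun t => AddCircle.liftIco (a + b) 0 f (t : AddCircle (a + b)) with hℓ
  have hℓf : ∀ t ∈ Ico 0 (a + b), ℓ t = f t := fun t ht =>
    AddCircle.liftIco_coe_apply (by simpa using ht)
  have hℓc : Continuous ℓ :=
    (AddCircle.liftIco_zero_continuous hf0 hfc).comp (AddCircle.continuous_mk' _)
  have hℓp : ∀ s, ℓ (s + (a + b)) = ℓ s := fun s => by
    simp only [hℓ, AddCircle.coe_add_period]
  have hP : Function.Periodic ℓ (a + b) := hℓp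
  have hred : ∀ s : ℝ, ∃ n : ℤ, s - n * (a + b) ∈ Ico 0 (a + b) := by
    intro s
    refine ⟨⌊s / (a + b)⌋, ?_, ?_⟩
    · have := Int.floor_le (s / (a + b))
      rw [le_div_iff₀ hT] at this
      linarith
    · have := Int.lt_floor_add_one (s / (a + b))
      rw [div_lt_iff₀ hT] at this
      linarith
  refine no_closed_loop hT hℓc hℓp ?_ hΘ hκ ?_
  · intro s t hst htT heq
    obtain ⟨n, hn⟩ := hred s
    obtain ⟨m, hm⟩ := hred t
    have e1 := hℓf _ hn
    have e2 := hℓf _ hm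
    rw [hP.sub_int_mul_eq] at e1 e2
    have := hfi hn hm (by rw [← e1, ← e2, heq])
    have hmn : ((m - n : ℤ) : ℝ) * (a + b) = t - s := by push_cast; linarith
    have k1 : (0 : ℝ) < ((m - n : ℤ) : ℝ) := by
      by_contra hc
      push Not at hc
      nlinarith
    have k2 : ((m - n : ℤ) : ℝ) < 1 := by
      by_contra hc
      push Not at hc
      nlinarith
    have k1' : 0 < m - n := by exact_mod_cast k1
    have k2' : m - n < 1 := by exact_mod_cast k2
    omega
  · intro s
    obtain ⟨n, hn⟩ := hred s
    suffices H : ∀ u ∈ Ico 0 (a + b), ∃ ρ ≥ 0, ∃ α, |α - Θ (ℓ u)| ≤ π / 2 - κ ∧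
        HasDerivWithinAt ℓ (ρ * cos α, ρ * sin α) (Ici u) u by
      obtain ⟨ρ, hρ, α, hα, hd⟩ := H _ hn
      refine ⟨ρ, hρ, α, by rwa [hP.sub_int_mul_eq] at hα, ?_⟩
      have h3 : HasDerivWithinAt (fun t : ℝ => t - n * (a + b)) 1 (Ici s) s :=
        ((hasDerivAt_id s).sub_const _).hasDerivWithinAt
      have h4 := hd.scomp s h3 (fun t ht => by
        simp only [mem_Ici] at ht ⊢
        linarith)
      rw [one_smul] at h4
      refine h4.congr (fun t _ => ?_) ?_
      · simp only [Function.comp, hP.sub_int_mul_eq]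
      · simp only [Function.comp, hP.sub_int_mul_eq]
    intro u hu
    rcases lt_or_ge u a with hua | hua
    · obtain ⟨ρ, hρ, α, hα, hd⟩ := hz u ⟨hu.1, hua.le⟩
      refine ⟨ρ, hρ, α, by rwa [hℓf u hu, hfz u hua.le], ?_⟩
      refine hd.hasDerivWithinAt.congr_of_eventuallyEq ?_ (by rw [hℓf u hu, hfz u hua.le])
      filter_upwards [self_mem_nhdsWithin, mem_nhdsWithin_of_mem_nhds (Iio_mem_nhds hua)] with t h3 h4
      rw [hℓf t ⟨hu.1.trans h3, by linarith [mem_Iio.1 h4]⟩, hfz t h4.le]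
    · obtain ⟨ρ, hρ, α, hα, hd⟩ := hη (u - a) ⟨by linarith, by linarith [hu.2]⟩
      refine ⟨ρ, hρ, α, by rwa [hℓf u hu, hfa u hua], ?_⟩
      have h5 := hd.comp_sub_const u a
      refine h5.hasDerivWithinAt.congr_of_eventuallyEq ?_ (by rw [hℓf u hu, hfa u hua])
      filter_upwards [self_mem_nhdsWithin, mem_nhdsWithin_of_mem_nhds (Iio_mem_nhds hu.2)] with t h3 h4
      rw [hℓf t ⟨hu.1.trans h3, h4⟩, hfa t (hua.trans h3)]

theorem angle_stays {χ : ℝ → ℝ} (hχ : Continuous χ) {m : ℝ} (h : ∀ s, 0 < cos (χ s - m))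
    (h0 : |χ 0 - m| < π / 2) (s : ℝ) : |χ s - m| < π / 2 := by
  by_contra hcon
  push Not at hcon
  have hc : Continuous fun s => |χ s - m| := by fun_prop
  obtain ⟨u, hu⟩ : π / 2 ∈ range fun s => |χ s - m| :=
    (isPreconnected_range hc).ordConnected.out ⟨0, rfl⟩ ⟨s, rfl⟩ ⟨h0.le, hcon⟩
  have h1 := h u
  rw [← Real.cos_abs] at h1
  simp only at hu
  rw [hu, Real.cos_pi_div_two] at h1
  exact lt_irrefl _ h1

/-- A path crossing a square from left to right meets a path crossing it from bottom to top. -/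
theorem exists_crossing {a b : ℝ → ℝ × ℝ} (ha : Continuous a) (hb : Continuous b)
    (h1 : ∀ τ ∈ Icc (0 : ℝ) 1, (a 0).1 < (b τ).1) (h2 : ∀ τ ∈ Icc (0 : ℝ) 1, (b τ).1 < (a 1).1)
    (h3 : ∀ s ∈ Icc (0 : ℝ) 1, (b 0).2 < (a s).2) (h4 : ∀ s ∈ Icc (0 : ℝ) 1, (a s).2 < (b 1).2) :
    ∃ s ∈ Icc (0 : ℝ) 1, ∃ τ ∈ Icc (0 : ℝ) 1, a s = b τ := by
  by_contra hcon
  push Not at hcon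
  set cl : ℝ → ℝ := fun s => max 0 (min s 1) with hcl
  have hclc : Continuous cl := by fun_prop
  have hclm : ∀ s, cl s ∈ Icc (0 : ℝ) 1 := fun s =>
    ⟨le_max_left _ _, max_le zero_le_one (min_le_right _ _)⟩
  have hcl0 : cl 0 = 0 := by simp [hcl]
  have hcl1 : cl 1 = 1 := by simp [hcl]
  obtain ⟨φ, hφc, hφ⟩ := exists_angle (S := (univ : Set (ℝ × ℝ))) convex_univ isOpen_univ
    (f := fun q => b (cl q.2) - a (cl q.1)) (by fun_prop)
    (fun q _ => sub_ne_zero.2 fun h => hcon _ (hclm _) _ (hclm _) h.symm)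
  rw [← continuousOn_univ.symm.eq] at hφc
  have hφc : Continuous φ := hφc
  choose ρ hρ hφ using fun q => hφ q (mem_univ q)
  simp only [Prod.ext_iff, Prod.fst_sub, Prod.snd_sub] at hφ
  have cos_pos : ∀ q, 0 < (b (cl q.2)).1 - (a (cl q.1)).1 → 0 < cos (φ q) := fun q hq => by
    rw [(hφ q).1] at hq
    exact pos_of_mul_pos_right hq (hρ q).le
  have cos_neg : ∀ q, (b (cl q.2)).1 - (a (cl q.1)).1 < 0 → cos (φ q) < 0 := fun q hq => by
    rw [(hφ q).1] at hq
    nlinarith [hρ q]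
  have sin_pos : ∀ q, 0 < (b (cl q.2)).2 - (a (cl q.1)).2 → 0 < sin (φ q) := fun q hq => by
    rw [(hφ q).2] at hq
    exact pos_of_mul_pos_right hq (hρ q).le
  have sin_neg : ∀ q, (b (cl q.2)).2 - (a (cl q.1)).2 < 0 → sin (φ q) < 0 := fun q hq => by
    rw [(hφ q).2] at hq
    nlinarith [hρ q]
  -- the base corner, normalised
  have hL : ∀ τ, 0 < cos (φ (0, τ)) := fun τ => cos_pos _ (by
    simp only [hcl0]; linarith [h1 _ (hclm τ)])
  have hR : ∀ τ, cos (φ (1, τ)) < 0 := fun τ => cos_neg _ (by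
    simp only [hcl1]; linarith [h2 _ (hclm τ)])
  have hB : ∀ s, sin (φ (s, 0)) < 0 := fun s => sin_neg _ (by
    simp only [hcl0]; linarith [h3 _ (hclm s)])
  have hT : ∀ s, 0 < sin (φ (s, 1)) := fun s => sin_pos _ (by
    simp only [hcl1]; linarith [h4 _ (hclm s)])
  set n := toIocDiv Real.two_pi_pos (-π) (φ (0, 0)) with hn
  have hmod : φ (0, 0) - n * (2 * π) ∈ Ioc (-π) (-π + 2 * π) := by
    have := toIocMod_mem_Ioc Real.two_pi_pos (-π) (φ (0, 0))
    rw [toIocMod] at this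
    simpa [hn] using this
  set ψ : ℝ × ℝ → ℝ := fun q => φ q - n * (2 * π) with hψ
  have hψc : Continuous ψ := by fun_prop
  have hsin : ∀ q, sin (ψ q) = sin (φ q) := fun q => Real.sin_sub_int_mul_two_pi _ _
  have hcos : ∀ q, cos (ψ q) = cos (φ q) := fun q => Real.cos_sub_int_mul_two_pi _ _
  have hpi := Real.pi_pos
  have q00 : -(π / 2) < ψ (0, 0) ∧ ψ (0, 0) < 0 := by
    have m1 : ψ (0, 0) ∈ Ioc (-π) (-π + 2 * π) := hmod
    have s1 : sin (ψ (0, 0)) < 0 := by rw [hsin]; exact hB 0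
    have c1 : 0 < cos (ψ (0, 0)) := by rw [hcos]; exact hL 0
    have lt0 : ψ (0, 0) < 0 := by
      by_contra hc
      push Not at hc
      have := Real.sin_nonneg_of_nonneg_of_le_pi hc (by linarith [m1.2])
      linarith
    refine ⟨?_, lt0⟩
    by_contra hc
    push Not at hc
    have := Real.cos_nonpos_of_pi_div_two_le_of_le (x := -ψ (0, 0)) (by linarith)
      (by linarith [m1.1])
    rw [Real.cos_neg] at this
    linarith
  have left : |ψ (0, 1) - 0| < π / 2 := angle_stays (χ := fun τ => ψ (0, τ)) (by fun_prop)
    (fun s => by rw [sub_zero, hcos]; exact hL s) (by rw [abs_lt]; constructor <;> linarith) 1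
  have q01 : 0 < ψ (0, 1) := by
    rw [sub_zero, abs_lt] at left
    by_contra hc
    push Not at hc
    have := Real.sin_nonpos_of_nonpos_of_neg_pi_le hc (by linarith)
    rw [hsin] at this
    linarith [hT 0]
  rw [sub_zero, abs_lt] at left
  have top : |ψ (1, 1) - π / 2| < π / 2 := angle_stays (χ := fun s => ψ (s, 1)) (by fun_prop)
    (fun s => by rw [Real.cos_sub_pi_div_two, hsin]; exact hT s)
    (by rw [abs_lt]; constructor <;> linarith) 1
  rw [abs_lt] at top
  have q11 : π / 2 < ψ (1, 1) := by
    by_contra hc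
    push Not at hc
    have := Real.cos_nonneg_of_neg_pi_div_two_le_of_le (x := ψ (1, 1)) (by linarith) hc
    rw [hcos] at this
    linarith [hR 1]
  have right : |ψ (1, 1 - 1) - π| < π / 2 := angle_stays (χ := fun τ => ψ (1, 1 - τ))
    (by fun_prop) (fun s => by rw [Real.cos_sub_pi, hcos]; linarith [hR (1 - s)])
    (by rw [abs_lt]; simp only [sub_zero]; constructor <;> linarith) 1
  have bottom : |ψ (1, 0) - (-(π / 2))| < π / 2 := angle_stays (χ := fun s => ψ (s, 0))
    (by fun_prop)
    (fun s => by
      rw [sub_neg_eq_add, Real.cos_add_pi_div_two, hsin]; linarith [hB s])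
    (by rw [abs_lt]; constructor <;> linarith) 1
  rw [sub_self] at right
  rw [abs_lt] at right bottom
  linarith

end AngleLifts

section CurveAngle

open scoped Topology

/-- A smooth regular simple closed curve winding once around the cylinder, lifted to the plane. -/
structure IsCylinderCurve (c : ℝ → ℝ × ℝ) : Prop where
  smooth : ContDiff ℝ (⊤ : ℕ∞) c
  shift : ∀ t, c (t + 2 * π) = c t + (2 * π, 0)
  regular : ∀ t, deriv c t ≠ 0
  inj : ∀ s t (k : ℤ), c t - c s = (2 * π * k, 0) → t - s = 2 * π * k

namespace IsCylinderCurve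

variable {c : ℝ → ℝ × ℝ} (h : IsCylinderCurve c)
include h

theorem injective : Function.Injective c := fun s t hst => by
  have := h.inj t s 0 (by rw [hst]; simp; rfl)
  simp at this
  linarith

theorem hasDerivAt (t : ℝ) : HasDerivAt c (deriv c t) t :=
  (h.smooth.differentiable (by simp) t).hasDerivAt

theorem continuous_deriv : Continuous (deriv c) :=
  h.smooth.continuous_deriv (by simp)

theorem shift_int (t : ℝ) (k : ℤ) : c (t + k * (2 * π)) = c t + (k * (2 * π), 0) := by
  have hp : Function.Periodic (fun t => c t - (t, 0)) (2 * π) := fun t => by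
    simp only [h.shift]
    ext <;> simp
  have := hp.int_mul k t
  have h2 : c (t + k * (2 * π)) = c t - (t, 0) + (t + k * (2 * π), 0) := by
    rw [← this]; simp
  rw [h2]
  ext
  · simp; ring
  · simp

theorem deriv_shift (t : ℝ) : deriv c (t + 2 * π) = deriv c t := by
  have h1 : HasDerivAt (fun t => c (t + 2 * π)) (deriv c (t + 2 * π)) t :=
    (h.hasDerivAt (t + 2 * π)).comp_add_const t (2 * π)
  have h2 : HasDerivAt (fun t => c t + ((2 * π, 0) : ℝ × ℝ)) (deriv c t) t :=
    (h.hasDerivAt t).add_const _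
  have : (fun t => c (t + 2 * π)) = fun t => c t + ((2 * π, 0) : ℝ × ℝ) := funext h.shift
  rw [this] at h1
  exact h1.unique h2

theorem exists_far : ∃ M > 0, ∀ s t, s + M ≤ t → (c s).1 < (c t).1 := by
  have hp : Function.Periodic (fun t => (c t).1 - t) (2 * π) := fun t => by
    simp only [h.shift]; simp
  have hc : Continuous fun t => (c t).1 - t := by
    have := h.smooth.continuous
    fun_prop
  obtain ⟨M, hM⟩ := isCompact_Icc.exists_bound_of_continuousOn (hc.continuousOn (s := Icc 0 (2 * π)))
  have hM' : ∀ t, |(c t).1 - t| ≤ M := by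
    intro t
    obtain ⟨y, hy, hyt⟩ := hp.exists_mem_Ico₀ Real.two_pi_pos t
    rw [hyt]
    exact hM y ⟨hy.1, hy.2.le⟩
  have hM0 : 0 ≤ M := (abs_nonneg _).trans (hM' 0)
  refine ⟨2 * M + 1, by linarith, fun s t hst => ?_⟩
  have h1 := abs_le.1 (hM' s)
  have h2 := abs_le.1 (hM' t)
  linarith

theorem exists_max : ∃ tA, ∀ t, (c t).2 ≤ (c tA).2 := by
  have hp : Function.Periodic (fun t => (c t).2) (2 * π) := fun t => by
    simp only [h.shift]; simp
  have hc : Continuous fun t => (c t).2 := by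
    have := h.smooth.continuous
    fun_prop
  obtain ⟨tA, -, hA⟩ := isCompact_Icc.exists_isMaxOn (nonempty_Icc.2 Real.two_pi_pos.le)
    (hc.continuousOn (s := Icc 0 (2 * π)))
  refine ⟨tA, fun t => ?_⟩
  obtain ⟨y, hy, hyt⟩ := hp.exists_mem_Ico₀ Real.two_pi_pos t
  rw [hyt]
  exact hA ⟨hy.1, hy.2.le⟩

theorem exists_min : ∃ tB, ∀ t, (c tB).2 ≤ (c t).2 := by
  have hp : Function.Periodic (fun t => (c t).2) (2 * π) := fun t => by
    simp only [h.shift]; simp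
  have hc : Continuous fun t => (c t).2 := by
    have := h.smooth.continuous
    fun_prop
  obtain ⟨tA, -, hA⟩ := isCompact_Icc.exists_isMinOn (nonempty_Icc.2 Real.two_pi_pos.le)
    (hc.continuousOn (s := Icc 0 (2 * π)))
  refine ⟨tA, fun t => ?_⟩
  obtain ⟨y, hy, hyt⟩ := hp.exists_mem_Ico₀ Real.two_pi_pos t
  rw [hyt]
  exact hA ⟨hy.1, hy.2.le⟩

end IsCylinderCurve

theorem angle_stays_nonneg {χ : ℝ → ℝ} (hχ : Continuous χ) {m : ℝ} (h : ∀ s, 0 ≤ cos (χ s - m))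
    (h0 : |χ 0 - m| < π) (s : ℝ) : |χ s - m| < π := by
  by_contra hcon
  push Not at hcon
  have hc : Continuous fun s => |χ s - m| := by fun_prop
  obtain ⟨u, hu⟩ : π ∈ range fun s => |χ s - m| :=
    (isPreconnected_range hc).ordConnected.out ⟨0, rfl⟩ ⟨s, rfl⟩ ⟨h0.le, hcon⟩
  have h1 := h u
  rw [← Real.cos_abs] at h1
  simp only at hu
  rw [hu, Real.cos_pi] at h1
  linarith

theorem angle_eq_zero_of_extremum {χ₁ χ₂ : ℝ → ℝ} (h₁ : Continuous χ₁) (h₂ : Continuous χ₂)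
    (s₁ : ∀ u, sin (χ₁ u) ≤ 0) (s₂ : ∀ u, 0 ≤ sin (χ₂ u)) (z₁ : |χ₁ 0| < π / 2)
    (z₂ : |χ₂ 0| < π / 2) {v : ℝ} (e₁ : χ₁ 1 = v) (e₂ : χ₂ 1 = v) : v = 0 := by
  rw [abs_lt] at z₁ z₂
  have a₁ := angle_stays_nonneg h₁ (m := -(π / 2))
    (fun s => by rw [sub_neg_eq_add, Real.cos_add_pi_div_two]; linarith [s₁ s])
    (by rw [abs_lt]; constructor <;> linarith) 1
  have a₂ := angle_stays_nonneg h₂ (m := π / 2)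
    (fun s => by rw [Real.cos_sub_pi_div_two]; linarith [s₂ s])
    (by rw [abs_lt]; constructor <;> linarith) 1
  have b₁ := s₁ 1
  have b₂ := s₂ 1
  rw [e₁] at a₁ b₁
  rw [e₂] at a₂ b₂
  rw [abs_lt] at a₁ a₂
  exact (Real.sin_eq_zero_iff_of_lt_of_lt (by linarith) (by linarith)).1 (le_antisymm b₁ b₂)

theorem IsCylinderCurve.exists_tangent_angle {c : ℝ → ℝ × ℝ} (h : IsCylinderCurve c) :
    ∃ θc : ℝ → ℝ, Continuous θc ∧ (∀ t, θc (t + 2 * π) = θc t) ∧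
      (∀ t, ∃ ρ > 0, deriv c t = (ρ * cos (θc t), ρ * sin (θc t))) ∧
      (∀ a, (∀ t, (c t).2 ≤ (c a).2) → θc a = 0) ∧
      (∀ a, (∀ t, (c a).2 ≤ (c t).2) → θc a = 0) := by
  set F : ℝ × ℝ → ℝ × ℝ := fun q => ∫ σ in (0:ℝ)..1, deriv c (q.1 + σ * (q.2 - q.1)) with hF
  have hFc : Continuous F := by
    have hd : ContDiff ℝ (⊤ : ℕ∞) (deriv c) := by
      have := (contDiff_succ_iff_deriv (n := ((⊤ : ℕ∞) : WithTop ℕ∞)) (f := c)).1 (by simpa using h.smooth)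
      exact this.2.2
    exact (contDiff_parametric_integral
      (fun q : (ℝ × ℝ) × ℝ => deriv c (q.1.1 + q.2 * (q.1.2 - q.1.1)))
      (hd.comp (by fun_prop))).continuous
  have hFs : ∀ s t, (t - s) • F (s, t) = c t - c s := by
    intro s t
    have := intervalIntegral.integral_unitInterval_deriv_eq_sub (𝕜 := ℝ) (f := c) (f' := deriv c)
      (z₀ := s) (z₁ := t - s)
      ((h.continuous_deriv.comp (by fun_prop)).continuousOn) (fun σ _ => h.hasDerivAt _)
    simpa [hF] using this
  have hF0 : ∀ t, F (t, t) = deriv c t := fun t => by simp [hF]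
  have hFne : ∀ q ∈ (univ : Set (ℝ × ℝ)), F q ≠ 0 := by
    rintro ⟨s, t⟩ - h0
    rcases eq_or_ne s t with rfl | hst
    · exact h.regular s (by rw [← hF0, h0])
    · have := hFs s t
      rw [h0, smul_zero] at this
      exact hst (h.injective (sub_eq_zero.1 this.symm)).symm
  have hFsymm : ∀ s t, F (s, t) = F (t, s) := by
    intro s t
    rcases eq_or_ne s t with rfl | hst
    · rfl
    · apply smul_right_injective _ (sub_ne_zero.2 hst.symm)
      simp only
      rw [hFs, ← neg_sub s t, neg_smul, hFs, neg_sub]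
  have hFper : ∀ s t, F (s + 2 * π, t + 2 * π) = F (s, t) := by
    intro s t
    simp only [hF]
    congr 1
    ext1 σ
    rw [← h.deriv_shift (s + σ * (t - s))]
    congr 1
    ring
  obtain ⟨φ, hφc, hφ⟩ := exists_angle convex_univ isOpen_univ hFc.continuousOn hFne
  rw [continuousOn_univ] at hφc
  choose ρ hρ hφ using fun q => hφ q (mem_univ q)
  obtain ⟨M, hM0, hM⟩ := h.exists_far
  have hpi := Real.pi_pos
  have hcos : ∀ s t, s + M ≤ t → 0 < cos (φ (s, t)) := by
    intro s t hst
    have h1 := congrArg Prod.fst (hFs s t)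
    rw [hφ] at h1
    simp only [Prod.smul_mk, smul_eq_mul, Prod.fst_sub] at h1
    have h2 := hM s t hst
    have h3 : 0 < t - s := by linarith
    by_contra hc
    push Not at hc
    have : (t - s) * (ρ (s, t) * cos (φ (s, t))) ≤ 0 :=
      mul_nonpos_of_nonneg_of_nonpos h3.le (mul_nonpos_of_nonneg_of_nonpos (hρ _).le hc)
    linarith
  have hsymm : ∀ s t, φ (t, s) = φ (s, t) := by
    intro s t
    have := int_valued_const (S := (univ : Set (ℝ × ℝ))) isPreconnected_univ
      (D := fun q => φ (q.2, q.1) - φ q)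
      (by fun_prop) 0 (fun q _ => cos_eq_one_form (pos_polar (hρ (q.2, q.1)) (hρ q)
        (by have e1 := hφ (q.2, q.1); have e2 := hφ q
            rw [hFsymm, show ((q.1, q.2) : ℝ × ℝ) = q from rfl, e2, Prod.ext_iff] at e1
            exact e1.1.symm)
        (by have e1 := hφ (q.2, q.1); have e2 := hφ q
            rw [hFsymm, show ((q.1, q.2) : ℝ × ℝ) = q from rfl, e2, Prod.ext_iff] at e1
            exact e1.2.symm)))
      (mem_univ (s, t)) (mem_univ (s, s))
    simp only [sub_self] at this
    linarith
  have hper : ∀ s t, φ (s + 2 * π, t + 2 * π) = φ (s, t) := by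
    have h_int : ∀ q ∈ (univ : Set (ℝ × ℝ)), ∃ k : ℤ,
        φ (q.1 + 2 * π, q.2 + 2 * π) - φ q = 0 + k * (2 * π) := fun q _ =>
      cos_eq_one_form (pos_polar (hρ (q.1 + 2 * π, q.2 + 2 * π)) (hρ q)
        (by have e1 := hφ (q.1 + 2 * π, q.2 + 2 * π); have e2 := hφ q
            rw [hFper, show ((q.1, q.2) : ℝ × ℝ) = q from rfl, e2, Prod.ext_iff] at e1
            exact e1.1.symm)
        (by have e1 := hφ (q.1 + 2 * π, q.2 + 2 * π); have e2 := hφ q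
            rw [hFper, show ((q.1, q.2) : ℝ × ℝ) = q from rfl, e2, Prod.ext_iff] at e1
            exact e1.2.symm))
    have hconst := fun s t => int_valued_const (S := (univ : Set (ℝ × ℝ))) isPreconnected_univ
      (D := fun q => φ (q.1 + 2 * π, q.2 + 2 * π) - φ q) (by fun_prop) 0 h_int
      (mem_univ (s, t)) (mem_univ (0, M))
    obtain ⟨k, hk⟩ := h_int (0, M) (mem_univ _)
    have b1 := cos_nonneg_narrow (χ := fun s => φ (s, s + M)) (by fun_prop)
      (fun s => (hcos s _ le_rfl).le) (2 * π) 0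
    have b2 := cos_nonneg_narrow (χ := fun s => φ (s, s + M)) (by fun_prop)
      (fun s => (hcos s _ le_rfl).le) 0 (2 * π)
    simp only [zero_add] at b1 b2 hk
    rw [add_comm M] at hk
    have k0 : k = 0 := by
      have k1 : (k : ℝ) < 1 := by nlinarith
      have k2 : (-1 : ℝ) < k := by nlinarith
      have k1' : k < 1 := by exact_mod_cast k1
      have k2' : -1 < k := by exact_mod_cast k2
      omega
    intro s t
    have := hconst s t
    simp only [zero_add] at this
    rw [add_comm M, hk, k0] at this
    simp at this
    linarith
  -- normalisation
  obtain ⟨n, hn⟩ : ∃ n : ℤ, |φ (0, M) - n * (2 * π)| < π / 2 := by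
    set n := toIocDiv Real.two_pi_pos (-π) (φ (0, M)) with hn
    have hmod : φ (0, M) - n * (2 * π) ∈ Ioc (-π) (-π + 2 * π) := by
      have := toIocMod_mem_Ioc Real.two_pi_pos (-π) (φ (0, M))
      rw [toIocMod] at this
      simpa [hn] using this
    refine ⟨n, ?_⟩
    by_contra hc
    push Not at hc
    have h1 := hcos 0 M (by simp)
    rw [← Real.cos_sub_int_mul_two_pi _ n, ← Real.cos_abs] at h1
    have : |φ (0, M) - n * (2 * π)| ≤ π := abs_le.2 ⟨hmod.1.le, by linarith [hmod.2]⟩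
    have := Real.cos_nonpos_of_pi_div_two_le_of_le hc (by linarith)
    linarith
  set ψ : ℝ × ℝ → ℝ := fun q => φ q - n * (2 * π) with hψ
  have hψc : Continuous ψ := by fun_prop
  have hψM : ∀ s, |ψ (s, s + M)| < π / 2 := by
    intro s
    have := angle_stays (χ := fun s => ψ (s, s + M)) (by fun_prop) (m := 0)
      (fun s => by
        rw [sub_zero, hψ]; simp only
        rw [Real.cos_sub_int_mul_two_pi]
        exact hcos _ _ le_rfl) (by simpa [hψ] using hn) s
    simpa using this
  have hsin : ∀ s t, (t - s) * (ρ (s, t) * sin (ψ (s, t))) = (c t).2 - (c s).2 := by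
    intro s t
    have h1 := congrArg Prod.snd (hFs s t)
    rw [hφ] at h1
    simp only [hψ, Real.sin_sub_int_mul_two_pi]
    simpa using h1
  have hψsymm : ∀ s t, ψ (t, s) = ψ (s, t) := fun s t => by simp only [hψ, hsymm s t]
  have hsgn : ∀ a b x : ℝ, 0 < a → 0 ≤ a * (b * x) → 0 < b → 0 ≤ x := by
    intro a b x ha hx hb
    by_contra hc
    push Not at hc
    have : a * (b * x) < 0 := mul_neg_of_pos_of_neg ha (mul_neg_of_pos_of_neg hb hc)
    linarith
  have hdiag : ∀ t, ∃ ρ > 0, deriv c t = (ρ * cos (ψ (t, t)), ρ * sin (ψ (t, t))) := fun t => by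
    refine ⟨ρ (t, t), hρ _, ?_⟩
    rw [← hF0, hφ]
    simp only [hψ, Real.sin_sub_int_mul_two_pi, Real.cos_sub_int_mul_two_pi]
  have hsin0 : ∀ a, deriv (fun t => (c t).2) a = 0 → sin (ψ (a, a)) = 0 := by
    intro a ha
    have h1 := (hasDerivAt_snd (h.hasDerivAt a)).deriv
    obtain ⟨r, hr, e⟩ := hdiag a
    rw [ha, e] at h1
    simp only at h1
    exact (mul_eq_zero.1 h1.symm).resolve_left hr.ne'
  have clampM : ∀ u : ℝ, 0 ≤ M * max (1 - u) 0 := fun u => by positivity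
  refine ⟨fun t => ψ (t, t), by fun_prop, fun t => by simp only [hψ, hper], hdiag, ?_, ?_⟩
  · intro a ha
    have hs0 : sin (ψ (a, a)) = 0 := hsin0 a (IsLocalMax.deriv_eq_zero
      (Filter.Eventually.of_forall ha))
    refine angle_eq_zero_of_extremum (χ₁ := fun u => ψ (a, a + M * max (1 - u) 0))
      (χ₂ := fun u => ψ (a - M * max (1 - u) 0, a)) (by fun_prop) (by fun_prop) ?_ ?_ ?_ ?_
      (by simp) (by simp)
    · intro u
      rcases (clampM u).eq_or_lt with h0 | h0
      · rw [← h0, add_zero, hs0]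
      · have := hsin a (a + M * max (1 - u) 0)
        have h3 := hsgn (M * max (1 - u) 0) (ρ (a, a + M * max (1 - u) 0))
          (- sin (ψ (a, a + M * max (1 - u) 0))) h0 (by
            rw [add_sub_cancel_left] at this
            linarith [ha (a + M * max (1 - u) 0)]) (hρ _)
        linarith
    · intro u
      rcases (clampM u).eq_or_lt with h0 | h0
      · rw [← h0, sub_zero, hs0]
      · have := hsin (a - M * max (1 - u) 0) a
        exact hsgn (M * max (1 - u) 0) (ρ (a - M * max (1 - u) 0, a))
          (sin (ψ (a - M * max (1 - u) 0, a))) h0 (by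
            rw [sub_sub_cancel] at this
            linarith [ha (a - M * max (1 - u) 0)]) (hρ _)
    · simpa using hψM a
    · have := hψM (a - M)
      simpa using this
  · intro a ha
    have hs0 : sin (ψ (a, a)) = 0 := hsin0 a (IsLocalMin.deriv_eq_zero
      (Filter.Eventually.of_forall ha))
    refine angle_eq_zero_of_extremum (χ₂ := fun u => ψ (a, a + M * max (1 - u) 0))
      (χ₁ := fun u => ψ (a - M * max (1 - u) 0, a)) (by fun_prop) (by fun_prop) ?_ ?_ ?_ ?_
      (by simp) (by simp)
    · intro u
      rcases (clampM u).eq_or_lt with h0 | h0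
      · rw [← h0, sub_zero, hs0]
      · have := hsin (a - M * max (1 - u) 0) a
        have h3 := hsgn (M * max (1 - u) 0) (ρ (a - M * max (1 - u) 0, a))
          (- sin (ψ (a - M * max (1 - u) 0, a))) h0 (by
            rw [sub_sub_cancel] at this
            linarith [ha (a - M * max (1 - u) 0)]) (hρ _)
        linarith
    · intro u
      rcases (clampM u).eq_or_lt with h0 | h0
      · rw [← h0, add_zero, hs0]
      · have := hsin a (a + M * max (1 - u) 0)
        exact hsgn (M * max (1 - u) 0) (ρ (a, a + M * max (1 - u) 0))
          (sin (ψ (a, a + M * max (1 - u) 0))) h0 (by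
            rw [add_sub_cancel_left] at this
            linarith [ha (a + M * max (1 - u) 0)]) (hρ _)
    · have := hψM (a - M)
      simpa using this
    · simpa using hψM a

end CurveAngle

section AngleField

open scoped Topology Manifold ContDiff

/-- A smooth periodic angle function on the plane which is close to the tangent angle along the
curve `c`, and vanishes far away and along vertical half-lines above a highest point and below a
lowest point of `c`. -/
structure IsAngleField (c : ℝ → ℝ × ℝ) (θc : ℝ → ℝ) (θ : ℝ × ℝ → ℝ) (R tA tB : ℝ) : Prop
    extends IsCylinderCurve c where
  polar : ∀ t, ∃ ρ > 0, deriv c t = (ρ * cos (θc t), ρ * sin (θc t))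
  smooth_angle : ContDiff ℝ (⊤ : ℕ∞) θ
  periodic : ∀ x ξ, θ (x + 2 * π, ξ) = θ (x, ξ)
  close : ∀ t, |θ (c t) - θc t| < π / 8
  le_top : ∀ t, (c t).2 ≤ (c tA).2
  bot_le : ∀ t, (c tB).2 ≤ (c t).2
  ray_max : ∀ (k : ℤ) (ξ : ℝ), (c tA).2 ≤ ξ → θ ((c tA).1 + k * (2 * π), ξ) = 0
  ray_min : ∀ (k : ℤ) (ξ : ℝ), ξ ≤ (c tB).2 → θ ((c tB).1 + k * (2 * π), ξ) = 0
  outer : ∀ z : ℝ × ℝ, R ≤ |z.2| → θ z = 0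
  bound : ∀ t, |(c t).2| < R

theorem exp_mul_I_eq_iff (x y : ℝ) :
    Complex.exp (x * Complex.I) = Complex.exp (y * Complex.I) ↔ ∃ k : ℤ, x = y + k * (2 * π) := by
  rw [Complex.exp_eq_exp_iff_exists_int]
  refine exists_congr fun k => ?_
  rw [show (y : ℂ) * Complex.I + k * (2 * π * Complex.I)
    = ((y + k * (2 * π) : ℝ) : ℂ) * Complex.I by push_cast; ring]
  rw [mul_left_inj' Complex.I_ne_zero, Complex.ofReal_inj]

theorem IsCylinderCurve.exists_angleField {c : ℝ → ℝ × ℝ} (h : IsCylinderCurve c) :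
    ∃ θc θ R tA tB, IsAngleField c θc θ R tA tB := by
  obtain ⟨θc, hθc, hper, hpol, hmax, hmin⟩ := h.exists_tangent_angle
  obtain ⟨tA, hA⟩ := h.exists_max
  obtain ⟨tB, hB⟩ := h.exists_min
  obtain ⟨R, hR⟩ : ∃ R, ∀ t, |(c t).2| < R := by
    refine ⟨max |(c tA).2| |(c tB).2| + 1, fun t => ?_⟩
    have h1 := hA t
    have h2 := hB t
    have h3 := le_abs_self (c tA).2
    have h4 := neg_abs_le (c tB).2
    have h5 := le_max_left |(c tA).2| |(c tB).2|
    have h6 := le_max_right |(c tA).2| |(c tB).2|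
    rw [abs_lt]
    constructor <;> linarith
  have hcc := h.smooth.continuous
  have hpP : Function.Periodic θc (2 * π) := hper
  set γ : ℝ → ℂ × ℝ := fun t => (Complex.exp ((c t).1 * Complex.I), (c t).2) with hγ
  have hγc : Continuous γ := by fun_prop
  have hγeq : ∀ s t, γ s = γ t → ∃ k : ℤ, s = t + k * (2 * π) := by
    intro s t hst
    rw [hγ, Prod.ext_iff] at hst
    obtain ⟨k, hk⟩ := (exp_mul_I_eq_iff _ _).1 hst.1
    refine ⟨k, ?_⟩
    have := h.inj t s k (Prod.ext (by simp only [Prod.fst_sub]; linarith)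
      (by simp only [Prod.snd_sub]; linarith [show (c s).2 = (c t).2 from hst.2]))
    linarith
  have hγp : ∀ t (k : ℤ), γ (t + k * (2 * π)) = γ t := by
    intro t k
    simp only [hγ, h.shift_int]
    refine Prod.ext ((exp_mul_I_eq_iff _ _).2 ⟨k, ?_⟩) ?_ <;> simp
  have hθeq : ∀ s t, γ s = γ t → θc s = θc t := by
    intro s t hst
    obtain ⟨k, rfl⟩ := hγeq s t hst
    exact hpP.int_mul k t
  have hred : ∀ t : ℝ, ∃ s ∈ Icc 0 (2 * π), γ s = γ t ∧ θc s = θc t := by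
    intro t
    have hm := toIcoMod_mem_Ico Real.two_pi_pos 0 t
    rw [zero_add] at hm
    refine ⟨_, ⟨hm.1, hm.2.le⟩, ?_⟩
    have e : γ (toIcoMod Real.two_pi_pos 0 t) = γ t := by
      rw [toIcoMod, zsmul_eq_mul, ← hγp t (-toIcoDiv Real.two_pi_pos 0 t)]
      congr 1
      push_cast
      ring
    exact ⟨e, hθeq _ _ e⟩
  set Z : Set (ℂ × ℝ) := {q | R ≤ |q.2|} ∪ ({q | q.1 = Complex.exp ((c tA).1 * Complex.I)} ∩
    {q | (c tA).2 ≤ q.2} ∪ {q | q.1 = Complex.exp ((c tB).1 * Complex.I)} ∩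
    {q | q.2 ≤ (c tB).2}) with hZ
  have hZc : IsClosed Z := by
    refine (isClosed_le continuous_const (by fun_prop)).union ((IsClosed.inter ?_ ?_).union
      (IsClosed.inter ?_ ?_))
    · exact isClosed_eq continuous_fst continuous_const
    · exact isClosed_le continuous_const continuous_snd
    · exact isClosed_eq continuous_fst continuous_const
    · exact isClosed_le continuous_snd continuous_const
  have hγZ : ∀ t, γ t ∈ Z → θc t = 0 := by
    rintro t (ht | ⟨h1, h2⟩ | ⟨h1, h2⟩)
    · exact absurd (hR t) (not_lt.2 ht)
    · have : γ t = γ tA := Prod.ext h1 (le_antisymm (hA t) h2)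
      rw [hθeq _ _ this, hmax _ hA]
    · have : γ t = γ tB := Prod.ext h1 (le_antisymm h2 (hB t))
      rw [hθeq _ _ this, hmin _ hB]
  obtain ⟨f, hf⟩ := exists_contMDiffMap_forall_mem_convex_of_local_const (n := ⊤)
    (M := ℂ × ℝ) 𝓘(ℝ, ℂ × ℝ)
    (t := fun q => {y : ℝ | (∀ t, γ t = q → |y - θc t| < π / 8) ∧ (q ∈ Z → y = 0)})
    (by
      intro q
      have e : {y : ℝ | (∀ t, γ t = q → |y - θc t| < π / 8) ∧ (q ∈ Z → y = 0)}
          = (⋂ t, ⋂ (_ : γ t = q), Metric.ball (θc t) (π / 8)) ∩ ⋂ (_ : q ∈ Z), {0} := by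
        ext y
        simp [Real.dist_eq]
      rw [e]
      exact (convex_iInter fun t => convex_iInter fun _ => convex_ball _ _).inter
        (convex_iInter fun _ => convex_singleton _))
    (by
      intro q
      by_cases hq : ∃ t, γ t = q
      · obtain ⟨t₀, rfl⟩ := hq
        set K : Set (ℂ × ℝ) := γ '' (Icc 0 (2 * π) ∩ {t | π / 8 ≤ |θc t₀ - θc t|}) with hK
        have hKc : IsClosed K := by
          refine (IsCompact.image (isCompact_Icc.inter_right ?_) hγc).isClosed
          exact isClosed_le continuous_const (by fun_prop)
        have hKq : γ t₀ ∉ K := by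
          rintro ⟨t, ⟨-, ht⟩, he⟩
          rw [mem_ofPred_eq, hθeq _ _ he, sub_self, abs_zero] at ht
          linarith [Real.pi_pos]
        have h1 : ∀ᶠ y in 𝓝 (γ t₀), y ∉ K := hKc.isOpen_compl.mem_nhds hKq
        have h2 : ∀ᶠ y in 𝓝 (γ t₀), y ∈ Z → θc t₀ = 0 := by
          by_cases hz : γ t₀ ∈ Z
          · exact Filter.Eventually.of_forall fun _ _ => hγZ _ hz
          · filter_upwards [hZc.isOpen_compl.mem_nhds hz] with y hy hyz
            exact absurd hyz hy
        refine ⟨θc t₀, ?_⟩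
        filter_upwards [h1, h2] with y hy1 hy2
        refine ⟨fun t ht => ?_, hy2⟩
        by_contra hc
        push Not at hc
        obtain ⟨s, hs, e1, e2⟩ := hred t
        exact hy1 ⟨s, ⟨hs, by rw [mem_ofPred_eq, e2]; exact hc⟩, e1.trans ht⟩
      · refine ⟨0, ?_⟩
        have hcl : IsClosed (γ '' Icc 0 (2 * π)) := (isCompact_Icc.image hγc).isClosed
        have hq' : q ∉ γ '' Icc 0 (2 * π) := fun ⟨t, _, ht⟩ => hq ⟨t, ht⟩
        filter_upwards [hcl.isOpen_compl.mem_nhds hq'] with y hy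
        refine ⟨fun t ht => ?_, fun _ => rfl⟩
        obtain ⟨s, hs, e1, e2⟩ := hred t
        exact absurd ⟨s, hs, e1.trans ht⟩ hy)
  have hfs : ContDiff ℝ (⊤ : ℕ∞) f := f.contMDiff.contDiff
  refine ⟨θc, fun z => f (Complex.exp (z.1 * Complex.I), z.2), R, tA, tB, h, hpol, ?_, ?_,
    fun t => (hf (γ t)).1 t rfl, hA, hB, ?_, ?_, fun z hz => (hf _).2 (Or.inl hz), hR⟩
  · refine hfs.comp (ContDiff.prodMk ?_ contDiff_snd)
    refine ContDiff.cexp (ContDiff.mul ?_ contDiff_const)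
    exact Complex.ofRealCLM.contDiff.comp contDiff_fst
  · intro x ξ
    simp only [(exp_mul_I_eq_iff (x + 2 * π) x).2 ⟨1, by simp⟩]
  · intro k ξ hξ
    exact (hf _).2 (Or.inr (Or.inl ⟨(exp_mul_I_eq_iff _ _).2 ⟨k, rfl⟩, hξ⟩))
  · intro k ξ hξ
    exact (hf _).2 (Or.inr (Or.inr ⟨(exp_mul_I_eq_iff _ _).2 ⟨k, rfl⟩, hξ⟩))

end AngleField

section Escape

open scoped Topology

/-- The unit vector field making the angle `θ + π / 2` with the horizontal axis. -/
noncomputable def angleField (θ : ℝ × ℝ → ℝ) (z : ℝ × ℝ) : ℝ × ℝ := (-sin (θ z), cos (θ z))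

theorem exists_nhds_injOn_of_jac_ne_zero {G : ℝ × ℝ → ℝ × ℝ} (hG : ContDiff ℝ (⊤ : ℕ∞) G)
    {q : ℝ × ℝ} (hq : jac G q ≠ 0) :
    (∃ U ∈ 𝓝 q, InjOn G U) ∧ ∀ V ∈ 𝓝 q, G '' V ∈ 𝓝 (G q) := by
  have hs : HasStrictFDerivAt G (fderiv ℝ G q) q :=
    hG.contDiffAt.hasStrictFDerivAt (by simp)
  rw [← det_fderiv_eq_jac] at hq
  set L := (fderiv ℝ G q).toContinuousLinearEquivOfDetNeZero hq with hL
  have hs' : HasStrictFDerivAt G (L : ℝ × ℝ →L[ℝ] ℝ × ℝ) q := by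
    simpa [hL] using hs
  refine ⟨⟨(hs'.toOpenPartialHomeomorph G).source, ?_, ?_⟩, fun V hV => ?_⟩
  · exact (hs'.toOpenPartialHomeomorph G).open_source.mem_nhds
      hs'.mem_toOpenPartialHomeomorph_source
  · exact (hs'.toOpenPartialHomeomorph G).injOn
  · have := hs'.map_nhds_eq_of_equiv
    rw [← this]
    exact Filter.image_mem_map hV

section

variable {θ : ℝ × ℝ → ℝ} {Φ : ℝ × (ℝ × ℝ) → ℝ × ℝ} (hΦ : IsPlaneFlow (angleField θ) Φ)
include hΦ

theorem angleFlow_hasDerivAt (z : ℝ × ℝ) (s : ℝ) : HasDerivAt (fun s => Φ (s, z))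
    (1 * cos (θ (Φ (s, z)) + π / 2), 1 * sin (θ (Φ (s, z)) + π / 2)) s := by
  rw [Real.cos_add_pi_div_two, Real.sin_add_pi_div_two, one_mul, one_mul]
  exact hΦ.deriv z s

theorem jac_flowBox {η : ℝ → ℝ × ℝ} (hη : ContDiff ℝ (⊤ : ℕ∞) η) {t : ℝ} {η' : ℝ × ℝ}
    (hd : HasDerivAt η η' t) : jac (fun q : ℝ × ℝ => Φ (q.2, η q.1)) (t, 0)
      = η'.1 * cos (θ (η t)) + η'.2 * sin (θ (η t)) := by
  have hG : ContDiff ℝ (⊤ : ℕ∞) fun q : ℝ × ℝ => Φ (q.2, η q.1) :=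
    hΦ.smooth.comp (contDiff_snd.prodMk (hη.comp contDiff_fst))
  have e1 : d1 (fun q : ℝ × ℝ => Φ (q.2, η q.1)) (t, 0) = η' := by
    refine (hasDerivAt_d1 hG t 0).unique ?_
    simpa only [hΦ.zero] using hd
  have e2 : d2 (fun q : ℝ × ℝ => Φ (q.2, η q.1)) (t, 0) = angleField θ (η t) := by
    refine (hasDerivAt_d2 hG t 0).unique ?_
    have := hΦ.deriv (η t) 0
    rwa [hΦ.zero] at this
  rw [jac, e1, e2, angleField]
  ring

theorem no_return (hθ : Continuous θ) {η : ℝ → ℝ × ℝ} {α : ℝ → ℝ} {J : Set ℝ}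
    (hJ : J.OrdConnected)
    (hηd : ∀ t ∈ J, ∃ ρ ≥ 0, HasDerivAt η (ρ * cos (α t), ρ * sin (α t)) t)
    (hα : ∀ t ∈ J, |α t - θ (η t)| ≤ π / 8) (hηi : InjOn η J) (hcl : IsClosed (η '' J)) {t₀ : ℝ}
    (ht₀ : t₀ ∈ J) {ε : ℝ} (hε : 0 < ε) (hloc : ∀ s, 0 < s → s < ε → Φ (s, η t₀) ∉ η '' J) {s : ℝ}
    (hs : 0 < s) : Φ (s, η t₀) ∉ η '' J := by
  intro hmem
  have hpi := Real.pi_pos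
  have hsε : ε ≤ s := by
    by_contra hc
    exact hloc s hs (not_le.1 hc) hmem
  have hzc := hΦ.continuous_curve (η t₀)
  have hK : IsCompact (Icc ε s ∩ (fun s => Φ (s, η t₀)) ⁻¹' (η '' J)) :=
    isCompact_Icc.inter_right (hcl.preimage hzc)
  obtain ⟨a, ⟨ha, t₁, ht₁, hat⟩, hleast⟩ := hK.exists_isLeast ⟨s, ⟨hsε, le_rfl⟩, hmem⟩
  have hat : η t₁ = Φ (a, η t₀) := hat
  have ha0 : 0 < a := hε.trans_le ha.1
  have hnot : ∀ u, 0 < u → u < a → Φ (u, η t₀) ∉ η '' J := by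
    intro u h0 hu hm
    rcases lt_or_ge u ε with h1 | h1
    · exact hloc u h0 h1 hm
    · exact absurd (hleast ⟨⟨h1, hu.le.trans ha.2⟩, hm⟩) (not_le.2 hu)
  have hzi : InjOn (fun s => Φ (s, η t₀)) (Ico 0 a) := by
    have key : ∀ u v, 0 ≤ u → u < v → v < a → Φ (u, η t₀) ≠ Φ (v, η t₀) := by
      intro u v hu huv hv he
      refine hnot (v - u) (by linarith) (by linarith) ⟨t₀, ht₀, ?_⟩
      apply hΦ.injective u
      simp only
      rw [he, ← hΦ.add, add_sub_cancel]
    intro u hu v hv he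
    rcases lt_trichotomy u v with hlt | heq | hlt
    · exact absurd he (key u v hu.1 hlt hv.2)
    · exact heq
    · exact absurd he.symm (key v u hv.1 hlt hu.2)
  rcases lt_or_ge t₁ t₀ with hlt | hge
  · have hIJ : ∀ r ∈ Icc 0 (t₀ - t₁), t₁ + r ∈ J := fun r hr =>
      hJ.out ht₁ ht₀ ⟨by linarith [hr.1], by linarith [hr.2]⟩
    refine no_bigon (Θ := fun z => θ z + π / 4) (by fun_prop) (κ := π / 8) (by positivity) ha0
      (b := t₀ - t₁) (by linarith) (z := fun s => Φ (s, η t₀)) (η := fun r => η (t₁ + r))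
      (fun u _ => ⟨1, zero_le_one, _, ?_, angleFlow_hasDerivAt hΦ _ u⟩) (fun r hr => ?_)
      (by simpa using hat) (by simp [hΦ.zero]) hzi ?_ ?_
    · rw [show θ (Φ (u, η t₀)) + π / 2 - (θ (Φ (u, η t₀)) + π / 4) = π / 4 by ring,
        abs_of_pos (by positivity)]
      linarith
    · obtain ⟨ρ, hρ, hd⟩ := hηd _ (hIJ r hr)
      refine ⟨ρ, hρ, α (t₁ + r), ?_, hd.comp_const_add t₁ r⟩
      have := abs_le.1 (hα _ (hIJ r hr))
      rw [abs_le]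
      constructor <;> linarith
    · intro r hr r' hr' he
      have := hηi (hIJ r ⟨hr.1, hr.2.le⟩) (hIJ r' ⟨hr'.1, hr'.2.le⟩) he
      linarith
    · intro u hu r hr he
      rcases hu.1.eq_or_lt with h0 | h0
      · simp only [← h0, hΦ.zero] at he
        have := hηi ht₀ (hIJ r ⟨hr.1, hr.2.le⟩) he
        linarith [hr.2]
      · exact hnot u h0 hu.2 ⟨_, hIJ r ⟨hr.1, hr.2.le⟩, he.symm⟩
  · have hIJ : ∀ r ∈ Icc 0 (t₁ - t₀), t₁ - r ∈ J := fun r hr =>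
      hJ.out ht₀ ht₁ ⟨by linarith [hr.2], by linarith [hr.1]⟩
    refine no_bigon (Θ := fun z => θ z + 3 * π / 4) (by fun_prop) (κ := π / 8) (by positivity) ha0
      (b := t₁ - t₀) (by linarith) (z := fun s => Φ (s, η t₀)) (η := fun r => η (t₁ - r))
      (fun u _ => ⟨1, zero_le_one, _, ?_, angleFlow_hasDerivAt hΦ _ u⟩) (fun r hr => ?_)
      (by simpa using hat) (by simp [hΦ.zero]) hzi ?_ ?_
    · rw [show θ (Φ (u, η t₀)) + π / 2 - (θ (Φ (u, η t₀)) + 3 * π / 4) = -(π / 4) by ring, abs_neg,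
        abs_of_pos (by positivity)]
      linarith
    · obtain ⟨ρ, hρ, hd⟩ := hηd _ (hIJ r hr)
      refine ⟨ρ, hρ, α (t₁ - r) + π, ?_, ?_⟩
      · have := abs_le.1 (hα _ (hIJ r hr))
        rw [abs_le]
        constructor <;> linarith
      · refine (hd.comp_const_sub t₁ r).congr_deriv ?_
        rw [Real.cos_add_pi, Real.sin_add_pi]
        ext <;> simp
    · intro r hr r' hr' he
      have := hηi (hIJ r ⟨hr.1, hr.2.le⟩) (hIJ r' ⟨hr'.1, hr'.2.le⟩) he
      linarith
    · intro u hu r hr he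
      rcases hu.1.eq_or_lt with h0 | h0
      · simp only [← h0, hΦ.zero] at he
        have := hηi ht₀ (hIJ r ⟨hr.1, hr.2.le⟩) he
        linarith [hr.2]
      · exact hnot u h0 hu.2 ⟨_, hIJ r ⟨hr.1, hr.2.le⟩, he.symm⟩

end

theorem IsCylinderCurve.exists_bound {c : ℝ → ℝ × ℝ} (h : IsCylinderCurve c) :
    ∃ M, ∀ t, |(c t).1 - t| ≤ M := by
  have hp : Function.Periodic (fun t => (c t).1 - t) (2 * π) := fun t => by
    simp only [h.shift]; simp
  have hc : Continuous fun t => (c t).1 - t := by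
    have := h.smooth.continuous
    fun_prop
  obtain ⟨M, hM⟩ := isCompact_Icc.exists_bound_of_continuousOn (hc.continuousOn (s := Icc 0 (2 * π)))
  refine ⟨M, fun t => ?_⟩
  obtain ⟨y, hy, hyt⟩ := hp.exists_mem_Ico₀ Real.two_pi_pos t
  rw [hyt]
  exact hM y ⟨hy.1, hy.2.le⟩

theorem IsCylinderCurve.isClosedEmbedding {c : ℝ → ℝ × ℝ} (h : IsCylinderCurve c) :
    Topology.IsClosedEmbedding c := by
  obtain ⟨M, hM⟩ := h.exists_bound
  have hp : IsProperMap c := by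
    rw [isProperMap_iff_tendsto_cocompact]
    refine ⟨h.smooth.continuous, ?_⟩
    rw [← Metric.cobounded_eq_cocompact, ← Metric.cobounded_eq_cocompact,
      ← tendsto_norm_atTop_iff_cobounded]
    refine Filter.tendsto_atTop_mono (f := fun t => ‖t‖ - M) (fun t => ?_)
      (Filter.tendsto_atTop_add_const_right _ _ tendsto_norm_cobounded_atTop)
    have h1 := hM t
    have h2 : ‖(c t).1‖ ≤ ‖c t‖ := norm_fst_le _
    have h3 := abs_sub_abs_le_abs_sub t (c t).1
    rw [abs_sub_comm] at h3
    simp only [Real.norm_eq_abs] at *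
    linarith
  exact .of_continuous_injective_isClosedMap h.smooth.continuous h.injective hp.isClosedMap

namespace IsAngleField

variable {c : ℝ → ℝ × ℝ} {θc : ℝ → ℝ} {θ : ℝ × ℝ → ℝ} {R tA tB : ℝ}
  (h : IsAngleField c θc θ R tA tB) {Φ : ℝ × (ℝ × ℝ) → ℝ × ℝ}
  (hΦ : IsPlaneFlow (angleField θ) Φ)
include h

theorem smooth_field : ContDiff ℝ (⊤ : ℕ∞) (angleField θ) :=
  (h.smooth_angle.sin.neg).prodMk h.smooth_angle.cos

omit h in
theorem field_of_angle_eq_zero {z : ℝ × ℝ} (hz : θ z = 0) : angleField θ z = (0, 1) := by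
  simp [angleField, hz]

include hΦ

theorem jac_flowBox_pos (t : ℝ) : 0 < jac (fun q : ℝ × ℝ => Φ (q.2, c q.1)) (t, 0) := by
  obtain ⟨ρ, hρ, e⟩ := h.polar t
  rw [jac_flowBox hΦ h.smooth (h.hasDerivAt t), e]
  have h1 : 0 < cos (θ (c t) - θc t) := by
    have := abs_lt.1 (h.close t)
    apply Real.cos_pos_of_mem_Ioo
    constructor <;> linarith [Real.pi_pos]
  rw [Real.cos_sub] at h1
  nlinarith

theorem flow_notMem_range (t₀ : ℝ) {s : ℝ} (hs : 0 < s) : Φ (s, c t₀) ∉ range c := by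
  have hG : ContDiff ℝ (⊤ : ℕ∞) fun q : ℝ × ℝ => Φ (q.2, c q.1) :=
    hΦ.smooth.comp (contDiff_snd.prodMk (h.smooth.comp contDiff_fst))
  obtain ⟨⟨U, hU, hinj⟩, -⟩ := exists_nhds_injOn_of_jac_ne_zero hG (h.jac_flowBox_pos hΦ t₀).ne'
  rw [nhds_prod_eq] at hU
  obtain ⟨U₁, hU₁, U₂, hU₂, hsub⟩ := Filter.mem_prod_iff.1 hU
  obtain ⟨V, hV, hVc⟩ : ∃ V ∈ 𝓝 (c t₀), c ⁻¹' V ⊆ U₁ := by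
    rw [h.isClosedEmbedding.isInducing.nhds_eq_comap] at hU₁
    exact hU₁
  have hcont := (hΦ.continuous_curve (c t₀)).continuousAt (x := 0)
  have hV' : V ∈ 𝓝 (Φ (0, c t₀)) := by rwa [hΦ.zero]
  obtain ⟨ε, hε, hball⟩ := Metric.mem_nhds_iff.1 (Filter.inter_mem (hcont hV') hU₂)
  rw [← image_univ]
  refine no_return hΦ h.smooth_angle.continuous (α := θc) ordConnected_univ (fun t _ => ?_)
    (fun t _ => by rw [abs_sub_comm]; exact (h.close t).le) h.injective.injOn
    (by rw [image_univ]; exact h.isClosedEmbedding.isClosed_range) (mem_univ t₀) hε ?_ hs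
  · obtain ⟨ρ, hρ, e⟩ := h.polar t
    exact ⟨ρ, hρ.le, e ▸ h.hasDerivAt t⟩
  · rintro u hu huε ⟨t, -, ht⟩
    have hu' := hball (show u ∈ Metric.ball 0 ε by
      rw [Metric.mem_ball, dist_zero_right, Real.norm_eq_abs, abs_of_pos hu]; exact huε)
    have ht1 : t ∈ U₁ := hVc (by rw [mem_preimage, ht]; exact hu'.1)
    have := hinj (x₁ := (t, 0)) (hsub ⟨ht1, mem_of_mem_nhds hU₂⟩) (x₂ := (t₀, u))
      (hsub ⟨mem_of_mem_nhds hU₁, hu'.2⟩) (by simp only [hΦ.zero]; exact ht)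
    exact hu.ne (Prod.ext_iff.1 this).2

end IsAngleField

end Escape

section EscapeTop

open scoped Topology

namespace IsAngleField

variable {c : ℝ → ℝ × ℝ} {θc : ℝ → ℝ} {θ : ℝ × ℝ → ℝ} {R tA tB : ℝ}
  (h : IsAngleField c θc θ R tA tB) {Φ : ℝ × (ℝ × ℝ) → ℝ × ℝ}
  (hΦ : IsPlaneFlow (angleField θ) Φ)
include h

theorem radius_pos : 0 < R := (abs_nonneg _).trans_lt (h.bound 0)

include hΦ

theorem neg_radius_lt_flow (t₀ : ℝ) {s : ℝ} (hs : 0 ≤ s) : -R < (Φ (s, c t₀)).2 := by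
  by_contra hc
  push Not at hc
  have hR := h.radius_pos
  have := hΦ.eq_translation_neg (z := Φ (s, c t₀)) hs (fun t ht =>
    field_of_angle_eq_zero (h.outer _ (by
      simp only
      rw [abs_of_neg (by linarith [ht.1])]
      linarith [ht.1])))
  rw [hΦ.neg_left] at this
  have h2 := abs_lt.1 (h.bound t₀)
  have h3 := congrArg Prod.snd this
  simp only at h3
  linarith

/-- A bounded orbit of the angle field issued from the curve is impossible. -/
theorem not_bounded_orbit (t₀ : ℝ) {K : Set (ℝ × ℝ)} (hK : IsCompact K)
    (hmem : ∀ s, 1 ≤ s → Φ (s, c t₀) ∈ K) : False := by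
  have hpi := Real.pi_pos
  obtain ⟨m, -, φ, hφ, hlim⟩ := hK.tendsto_subseq (x := fun n : ℕ => Φ ((n : ℝ) + 1, c t₀))
    (fun n => hmem _ (by linarith [n.cast_nonneg (α := ℝ)]))
  set η : ℝ → ℝ × ℝ := fun r => (m.1 + r * cos (θ m), m.2 + r * sin (θ m)) with hη
  have hηs : ContDiff ℝ (⊤ : ℕ∞) η := by fun_prop
  have hηd : ∀ r, HasDerivAt η (1 * cos (θ m), 1 * sin (θ m)) r := fun r =>
    (((hasDerivAt_id r).mul_const _).const_add _).prodMk
      (((hasDerivAt_id r).mul_const _).const_add _)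
  have hη0 : η 0 = m := by simp [hη]
  have hηi : Function.Injective η := by
    intro r r' he
    rw [hη, Prod.ext_iff] at he
    have e1 : r * cos (θ m) = r' * cos (θ m) := by linarith [he.1]
    have e2 : r * sin (θ m) = r' * sin (θ m) := by linarith [he.2]
    calc r = (r * cos (θ m)) * cos (θ m) + (r * sin (θ m)) * sin (θ m) := by
          linear_combination -r * Real.sin_sq_add_cos_sq (θ m)
      _ = r' := by rw [e1, e2]; linear_combination r' * Real.sin_sq_add_cos_sq (θ m)
  have hG : ContDiff ℝ (⊤ : ℕ∞) fun q : ℝ × ℝ => Φ (q.2, η q.1) :=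
    hΦ.smooth.comp (contDiff_snd.prodMk (hηs.comp contDiff_fst))
  have hjac : jac (fun q : ℝ × ℝ => Φ (q.2, η q.1)) (0, 0) ≠ 0 := by
    rw [jac_flowBox hΦ hηs (hηd 0), hη0]
    have := Real.sin_sq_add_cos_sq (θ m)
    nlinarith
  obtain ⟨⟨U, hU, hinj⟩, hopen⟩ := exists_nhds_injOn_of_jac_ne_zero hG hjac
  have hθη : ∀ᶠ r in 𝓝 (0 : ℝ), |θ m - θ (η r)| < π / 8 := by
    have hc : Continuous fun r => |θ m - θ (η r)| := by
      have := h.smooth_angle.continuous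
      have := hηs.continuous
      fun_prop
    refine hc.continuousAt.eventually_lt continuousAt_const ?_
    simp only [hη0, sub_self, abs_zero]
    positivity
  obtain ⟨δ₁, hδ₁, hball⟩ := Metric.mem_nhds_iff.1 hU
  obtain ⟨δ₂, hδ₂, hball₂⟩ := Metric.eventually_nhds_iff_ball.1 hθη
  set δ := min (min (δ₁ / 2) (δ₂ / 2)) (1 / 2) with hδ
  have hδ0 : 0 < δ := by positivity
  have hδ1 : δ < δ₁ := by
    have : δ ≤ δ₁ / 2 := (min_le_left _ _).trans (min_le_left _ _)
    linarith
  have hδ2 : δ < δ₂ := by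
    have : δ ≤ δ₂ / 2 := (min_le_left _ _).trans (min_le_right _ _)
    linarith
  have hδ3 : δ ≤ 1 / 2 := min_le_right _ _
  have hUmem : ∀ a b : ℝ, |a| ≤ δ → |b| ≤ δ → (a, b) ∈ U := fun a b ha hb => hball (by
    rw [Metric.mem_ball, Prod.dist_eq, max_lt_iff]
    simp only [Real.dist_eq, sub_zero]
    exact ⟨ha.trans_lt hδ1, hb.trans_lt hδ1⟩)
  have hnear : ∀ᶠ n in Filter.atTop, Φ ((φ n : ℝ) + 1, c t₀)
      ∈ (fun q : ℝ × ℝ => Φ (q.2, η q.1)) '' Metric.ball (0, 0) δ := by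
    refine hlim ?_
    have := hopen _ (Metric.ball_mem_nhds (0, 0) hδ0)
    simp only [hΦ.zero, hη0] at this
    exact this
  obtain ⟨N, hN⟩ := Filter.eventually_atTop.1 hnear
  have hcross : ∀ n ≥ N, ∃ r x, |r| < δ ∧ |x| < δ ∧ Φ ((φ n : ℝ) + 1 - r, c t₀) = η x := by
    intro n hn
    obtain ⟨⟨x, r⟩, hq, he⟩ := hN n hn
    rw [Metric.mem_ball, Prod.dist_eq, max_lt_iff] at hq
    simp only [Real.dist_eq, sub_zero] at hq
    refine ⟨r, x, hq.2, hq.1, ?_⟩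
    apply hΦ.injective r
    simp only
    rw [← hΦ.add, add_sub_cancel]
    exact he.symm
  obtain ⟨r₁, x₁, hr₁, hx₁, e₁⟩ := hcross N le_rfl
  obtain ⟨r₂, x₂, hr₂, hx₂, e₂⟩ := hcross (N + 2) (by omega)
  have hφN : (φ N : ℝ) + 2 ≤ φ (N + 2) := by
    have h1 := hφ (Nat.lt_succ_self N)
    have h2 := hφ (Nat.lt_succ_self (N + 1))
    have : φ N + 2 ≤ φ (N + 2) := by
      simp only [Nat.succ_eq_add_one, show N + 1 + 1 = N + 2 from rfl] at h1 h2
      omega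
    exact_mod_cast this
  rw [abs_lt] at hr₁ hr₂
  have hJ : ∀ x ∈ Icc (-δ) δ, |x| ≤ δ := fun x hx => abs_le.2 hx
  refine no_return hΦ h.smooth_angle.continuous (η := η) (α := fun _ => θ m) (J := Icc (-δ) δ)
    ordConnected_Icc (fun t _ => ⟨1, zero_le_one, hηd t⟩) (fun t ht => ?_) hηi.injOn
    (isCompact_Icc.image hηs.continuous).isClosed (t₀ := x₁) (abs_le.1 hx₁.le) hδ0 ?_
    (s := ((φ (N + 2) : ℝ) + 1 - r₂) - ((φ N : ℝ) + 1 - r₁)) (by linarith) ?_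
  · refine (hball₂ t ?_).le
    rw [Metric.mem_ball, Real.dist_eq, sub_zero]
    exact (hJ t ht).trans_lt hδ2
  · rintro u hu huδ ⟨x, hx, hxe⟩
    have := hinj (x₁ := (x, 0)) (hUmem _ _ (hJ x hx) (by rw [abs_zero]; exact hδ0.le))
      (x₂ := (x₁, u)) (hUmem _ _ hx₁.le (by rw [abs_of_pos hu]; exact huδ.le))
      (by simp only [hΦ.zero]; exact hxe)
    exact hu.ne (Prod.ext_iff.1 this).2
  · refine ⟨x₂, abs_le.1 hx₂.le, ?_⟩
    rw [← e₂, ← e₁, ← hΦ.add, sub_add_cancel]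

/-- The orbits of the angle field issued from the curve reach the region where the field is
vertical. -/
theorem exists_escape (t₀ : ℝ) : ∃ s, 0 ≤ s ∧ R ≤ (Φ (s, c t₀)).2 := by
  by_contra hesc
  push Not at hesc
  have hR := h.radius_pos
  have hpi := Real.pi_pos
  have low := fun s (hs : 0 ≤ s) => h.neg_radius_lt_flow hΦ t₀ hs
  have rayA : ∀ s, 0 ≤ s → ∀ k : ℤ, (Φ (s, c t₀)).1 = (c tA).1 + k * (2 * π) →
      (c tA).2 ≤ (Φ (s, c t₀)).2 → False := by
    intro s hs k hk hle
    have hnn : 0 ≤ R - (Φ (s, c t₀)).2 := by linarith [hesc s hs]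
    have := hΦ.eq_translation (z := Φ (s, c t₀)) hnn (fun t ht => field_of_angle_eq_zero (by
      rw [hk]; exact h.ray_max k _ (by linarith [ht.1])))
    rw [← hΦ.add] at this
    have h2 := hesc (R - (Φ (s, c t₀)).2 + s) (by linarith)
    rw [this] at h2
    simp at h2
  have rayB : ∀ s, 0 < s → ∀ k : ℤ, (Φ (s, c t₀)).1 = (c tB).1 + k * (2 * π) →
      (Φ (s, c t₀)).2 ≤ (c tB).2 → False := by
    intro s hs k hk hle
    have := hΦ.eq_translation_neg (z := Φ (s, c t₀)) hs.le (fun t ht => field_of_angle_eq_zero (by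
      rw [hk]; exact h.ray_min k _ (by linarith [ht.1])))
    rw [hΦ.neg_left] at this
    have h2 := h.bot_le t₀
    rw [this] at h2
    simp only at h2
    linarith
  set b : ℤ → ℝ → ℝ × ℝ := fun k τ => c (tB + max 0 (min τ 1) * (tA - tB))
    + (k * (2 * π), min τ 0 + max (τ - 1) 0) with hb
  have hbc : ∀ k, Continuous (b k) := by
    intro k
    have := h.smooth.continuous
    fun_prop
  have avoid : ∀ s, 0 < s → ∀ k τ, Φ (s, c t₀) ≠ b k τ := by
    intro s hs k τ he
    rcases le_or_gt τ 0 with h0 | h0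
    · have e1 : max 0 (min τ 1) = 0 := by
        rw [min_eq_left (by linarith), max_eq_left h0]
      have e2 : min τ 0 + max (τ - 1) 0 = τ := by
        rw [min_eq_left h0, max_eq_right (by linarith), add_zero]
      simp only [hb, e1, e2, zero_mul, add_zero] at he
      exact rayB s hs k (by rw [he]; simp) (by rw [he]; simpa using h0)
    · rcases le_or_gt 1 τ with h1 | h1
      · have e1 : max 0 (min τ 1) = 1 := by
          rw [min_eq_right h1, max_eq_right zero_le_one]
        have e2 : min τ 0 + max (τ - 1) 0 = τ - 1 := by
          rw [min_eq_right h0.le, max_eq_left (by linarith), zero_add]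
        simp only [hb, e1, e2, one_mul, add_sub_cancel] at he
        exact rayA s hs.le k (by rw [he]; simp) (by rw [he]; simpa using h1)
      · have e2 : min τ 0 + max (τ - 1) 0 = 0 := by
          rw [min_eq_right h0.le, max_eq_right (by linarith), zero_add]
        simp only [hb, e2] at he
        rw [← h.shift_int] at he
        exact h.flow_notMem_range hΦ t₀ hs ⟨_, he.symm⟩
  obtain ⟨M, hM⟩ := h.exists_bound
  set C := M + |tB| + |tA - tB| with hC
  have hbC : ∀ k τ, |(b k τ).1 - k * (2 * π)| ≤ C := by
    intro k τ
    have h0 : 0 ≤ max 0 (min τ 1) := le_max_left _ _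
    have h1 : max 0 (min τ 1) ≤ 1 := max_le zero_le_one (min_le_right _ _)
    simp only [hb, Prod.fst_add, add_sub_cancel_right]
    have h2 := hM (tB + max 0 (min τ 1) * (tA - tB))
    have h3 := abs_add_le ((c (tB + max 0 (min τ 1) * (tA - tB))).1
      - (tB + max 0 (min τ 1) * (tA - tB))) (tB + max 0 (min τ 1) * (tA - tB))
    rw [sub_add_cancel] at h3
    have h4 := abs_add_le tB (max 0 (min τ 1) * (tA - tB))
    have h5 : |max 0 (min τ 1) * (tA - tB)| ≤ |tA - tB| := by
      rw [abs_mul, abs_of_nonneg h0]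
      exact mul_le_of_le_one_left (abs_nonneg _) h1
    linarith
  set β : ℤ → ℝ → ℝ × ℝ := fun k r => b k (-(2 * R) + (4 * R + 1) * r) with hβ
  have hβc : ∀ k, Continuous (β k) := fun k => (hbc k).comp (by fun_prop)
  have hβ0 : ∀ k, (β k 0).2 < -R := by
    intro k
    have e2 : min (-(2 * R)) 0 + max (-(2 * R) - 1) 0 = -(2 * R) := by
      rw [min_eq_left (by linarith), max_eq_right (by linarith), add_zero]
    have := abs_lt.1 (h.bound (tB + max 0 (min (-(2 * R)) 1) * (tA - tB)))
    simp only [hβ, hb, mul_zero, add_zero, e2, Prod.snd_add]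
    linarith
  have hβ1 : ∀ k, R < (β k 1).2 := by
    intro k
    have e0 : -(2 * R) + (4 * R + 1) * 1 = 2 * R + 1 := by ring
    have e2 : min (2 * R + 1) 0 + max (2 * R + 1 - 1) 0 = 2 * R := by
      rw [min_eq_right (by linarith), max_eq_left (by linarith)]; ring
    have := abs_lt.1 (h.bound (tB + max 0 (min (2 * R + 1) 1) * (tA - tB)))
    simp only [hβ, hb, e0, e2, Prod.snd_add]
    linarith
  have hzc := hΦ.continuous_curve (c t₀)
  have band : ∀ s s', 1 ≤ s → 1 ≤ s' → ∀ k : ℤ, (Φ (s, c t₀)).1 < k * (2 * π) - C →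
      k * (2 * π) + C < (Φ (s', c t₀)).1 → False := by
    intro s s' hs hs' k h1 h2
    have hpos : ∀ r ∈ Icc (0 : ℝ) 1, 1 ≤ s + r * (s' - s) := by
      intro r hr
      have e : s + r * (s' - s) - 1 = (1 - r) * (s - 1) + r * (s' - 1) := by ring
      have : 0 ≤ (1 - r) * (s - 1) + r * (s' - 1) :=
        add_nonneg (mul_nonneg (by linarith [hr.2]) (by linarith))
          (mul_nonneg hr.1 (by linarith))
      linarith
    obtain ⟨r, hr, τ, -, he⟩ := exists_crossing (a := fun r => Φ (s + r * (s' - s), c t₀))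
      (b := β k) (hzc.comp (by fun_prop)) (hβc k)
      (fun τ _ => by
        have := abs_le.1 (hbC k (-(2 * R) + (4 * R + 1) * τ))
        simp only [zero_mul, add_zero]
        exact h1.trans_le (by linarith))
      (fun τ _ => by
        have := abs_le.1 (hbC k (-(2 * R) + (4 * R + 1) * τ))
        simp only [one_mul, add_sub_cancel]
        refine lt_of_le_of_lt ?_ h2
        simp only [hβ]
        linarith)
      (fun r hr => (hβ0 k).trans (low _ (by linarith [hpos r hr])))
      (fun r hr => (hesc _ (by linarith [hpos r hr])).trans (hβ1 k))
    exact avoid _ (by linarith [hpos r hr]) k _ he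
  obtain ⟨k₂, hk₂⟩ := exists_int_gt (((Φ (1, c t₀)).1 + C) / (2 * π))
  obtain ⟨k₁, hk₁⟩ := exists_int_lt (((Φ (1, c t₀)).1 - C) / (2 * π))
  rw [div_lt_iff₀ (by positivity)] at hk₂
  rw [lt_div_iff₀ (by positivity)] at hk₁
  refine h.not_bounded_orbit hΦ t₀
    (K := Icc (k₁ * (2 * π) - C) (k₂ * (2 * π) + C) ×ˢ Icc (-R) R)
    (isCompact_Icc.prod isCompact_Icc) fun s hs => ⟨⟨?_, ?_⟩, ?_, ?_⟩
  · by_contra hc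
    exact band s 1 hs le_rfl k₁ (not_le.1 hc) (by linarith)
  · by_contra hc
    exact band 1 s le_rfl hs k₂ (by linarith) (not_le.1 hc)
  · exact (low s (by linarith)).le
  · exact (hesc s (by linarith)).le

end IsAngleField

end EscapeTop

section Collar

open scoped Topology

theorem exists_strip_of_periodic {U : Set (ℝ × ℝ)} (hU : IsOpen U)
    (hper : ∀ t s, (t + 2 * π, s) ∈ U ↔ (t, s) ∈ U) (h0 : ∀ t, (t, (0 : ℝ)) ∈ U) :
    ∃ δ > 0, ∀ t s, |s| ≤ δ → (t, s) ∈ U := by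
  have hsub : Icc 0 (2 * π) ×ˢ {(0 : ℝ)} ⊆ U := by
    rintro ⟨t, s⟩ ⟨-, hs⟩
    rw [mem_singleton_iff] at hs
    simp only at hs
    rw [hs]
    exact h0 t
  obtain ⟨A, V, -, hV, hA, hV0, hAV⟩ :=
    generalized_tube_lemma (isCompact_Icc (a := (0 : ℝ)) (b := 2 * π)) isCompact_singleton hU hsub
  obtain ⟨δ, hδ, hball⟩ := Metric.isOpen_iff.1 hV 0 (hV0 rfl)
  refine ⟨δ / 2, by positivity, fun t s hs => ?_⟩
  have hp : Function.Periodic (fun t => (t, s) ∈ U) (2 * π) := fun t => propext (hper t s)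
  obtain ⟨t', ht', e⟩ := hp.exists_mem_Ico₀ Real.two_pi_pos t
  refine e.mpr (hAV ⟨hA (Ico_subset_Icc_self ht'), hball ?_⟩)
  rw [Metric.mem_ball, Real.dist_eq, sub_zero]
  linarith

theorem exists_bound_of_periodic {f : ℝ → ℝ} (hf : Continuous f)
    (hper : ∀ t, f (t + 2 * π) = f t) : ∃ M, ∀ t, |f t| ≤ M := by
  obtain ⟨M, hM⟩ := (isCompact_Icc (a := (0 : ℝ)) (b := 2 * π)).exists_bound_of_continuousOn
    hf.continuousOn
  refine ⟨M, fun t => ?_⟩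
  have hp : Function.Periodic f (2 * π) := hper
  obtain ⟨t', ht', e⟩ := hp.exists_mem_Ico₀ Real.two_pi_pos t
  rw [e]
  exact hM _ (Ico_subset_Icc_self ht')

/-- An oriented parametrization `E` of a part of the plane by `(t, s)` with `E (t, 0) = c t`,
which is a vertical translation on every vertical line for `s ≥ S`. -/
structure IsCollar (c : ℝ → ℝ × ℝ) (E : ℝ × ℝ → ℝ × ℝ) (X τ : ℝ → ℝ) (S : ℝ) : Prop where
  smooth : ContDiff ℝ (⊤ : ℕ∞) E
  shift : ∀ t s, E (t + 2 * π, s) = E (t, s) + (2 * π, 0)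
  injective : Function.Injective E
  jac_pos : ∀ q, 0 < jac E q
  zero : ∀ t, E (t, 0) = c t
  smooth_fst : ContDiff ℝ (⊤ : ℕ∞) X
  smooth_snd : ContDiff ℝ (⊤ : ℕ∞) τ
  shift_fst : ∀ t, X (t + 2 * π) = X t + 2 * π
  shift_snd : ∀ t, τ (t + 2 * π) = τ t
  top : ∀ t s, S ≤ s → E (t, s) = (X t, τ t + s)

theorem IsAngleField.exists_uniform_escape {c : ℝ → ℝ × ℝ} {θc : ℝ → ℝ} {θ : ℝ × ℝ → ℝ}
    {R tA tB : ℝ} (h : IsAngleField c θc θ R tA tB) {Φ : ℝ × (ℝ × ℝ) → ℝ × ℝ}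
    (hΦ : IsPlaneFlow (angleField θ) Φ) :
    ∃ S, 0 ≤ S ∧ ∀ t ∈ Icc 0 (2 * π), R ≤ (Φ (S, c t)).2 := by
  have hup : ∀ (z : ℝ × ℝ), R ≤ z.2 → ∀ s, 0 ≤ s → Φ (s, z) = (z.1, z.2 + s) := by
    intro z hz s hs
    refine hΦ.eq_translation hs fun t ht => IsAngleField.field_of_angle_eq_zero (h.outer _ ?_)
    exact le_trans (by linarith [ht.1]) (le_abs_self _)
  refine isCompact_Icc.induction_on
    (p := fun A => ∃ S, 0 ≤ S ∧ ∀ t ∈ A, R ≤ (Φ (S, c t)).2) ⟨0, le_rfl, by simp⟩ ?_ ?_ ?_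
  · rintro A B hAB ⟨S, hS, hB⟩
    exact ⟨S, hS, fun t ht => hB t (hAB ht)⟩
  · rintro A B ⟨S, hS, hA⟩ ⟨S', hS', hB⟩
    refine ⟨S + S', by positivity, fun t ht => ?_⟩
    rcases ht with ht | ht
    · rw [add_comm, hΦ.add, hup _ (hA t ht) _ hS']
      linarith [hA t ht]
    · rw [hΦ.add, hup _ (hB t ht) _ hS]
      linarith [hB t ht]
  · intro t _
    obtain ⟨s, hs, he⟩ := h.exists_escape hΦ t
    refine ⟨{t | R < (Φ (s + 1, c t)).2}, mem_nhdsWithin_of_mem_nhds ?_, s + 1, by linarith,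
      fun t ht => le_of_lt ht⟩
    have hc : Continuous fun t => (Φ (s + 1, c t)).2 :=
      continuous_snd.comp (hΦ.smooth.continuous.comp
        (continuous_const.prodMk h.smooth.continuous))
    refine (isOpen_lt continuous_const hc).mem_nhds ?_
    rw [mem_ofPred, add_comm, hΦ.add, hup _ he _ zero_le_one]
    simp only
    linarith

theorem IsCylinderCurve.exists_collar {c : ℝ → ℝ × ℝ} (hc : IsCylinderCurve c) :
    ∃ E X τ S, IsCollar c E X τ S := by
  obtain ⟨θc, θ, R, tA, tB, h⟩ := hc.exists_angleField
  have hWper : ∀ z, angleField θ (z + (2 * π, 0)) = angleField θ z := by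
    rintro ⟨x, ξ⟩
    simp only [Prod.mk_add_mk, add_zero, angleField, h.periodic]
  obtain ⟨Φ, hΦ⟩ := exists_planeFlow (v := angleField θ) h.smooth_field
    (fun x ξ => by simp only [angleField, h.periodic]) (R := R) (w := (0, 1))
    (fun z hz => IsAngleField.field_of_angle_eq_zero (h.outer z hz))
  have hshift : ∀ s t, Φ (s, c (t + 2 * π)) = Φ (s, c t) + (2 * π, 0) := by
    intro s t
    rw [h.shift, hΦ.equivariant hWper]
  obtain ⟨S, hS, hescS⟩ := h.exists_uniform_escape hΦ
  have hesc : ∀ t, R ≤ (Φ (S, c t)).2 := by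
    intro t
    have hp : Function.Periodic (fun t => (Φ (S, c t)).2) (2 * π) := fun t => by
      simp only [hshift]; simp
    obtain ⟨t', ht', e⟩ := hp.exists_mem_Ico₀ Real.two_pi_pos t
    rw [e]
    exact hescS _ (Ico_subset_Icc_self ht')
  have hsm : ∀ s, ContDiff ℝ (⊤ : ℕ∞) fun t => Φ (s, c t) := fun s =>
    (hΦ.contDiff_slice s).comp h.smooth
  have hE : ContDiff ℝ (⊤ : ℕ∞) fun q : ℝ × ℝ => Φ (q.2, c q.1) :=
    hΦ.smooth.comp (contDiff_snd.prodMk (h.smooth.comp contDiff_fst))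
  have hcross : ∀ t t' s s' : ℝ, s ≤ s' → Φ (s, c t) = Φ (s', c t') → t = t' ∧ s = s' := by
    intro t t' s s' hss he
    have e : c t = Φ (s' - s, c t') := by
      have := congrArg (fun z => Φ (-s, z)) he
      simp only [hΦ.neg_left, ← hΦ.add] at this
      rw [this, neg_add_eq_sub]
    rcases hss.eq_or_lt with rfl | hlt
    · rw [sub_self, hΦ.zero] at e
      exact ⟨h.injective e, rfl⟩
    · exact absurd ⟨t, e⟩ (h.flow_notMem_range hΦ t' (sub_pos.2 hlt))
  refine ⟨fun q => Φ (q.2, c q.1), fun t => (Φ (S, c t)).1, fun t => (Φ (S, c t)).2 - S, S,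
    hE, fun t s => hshift s t, ?_, ?_, fun t => hΦ.zero _, (hsm S).fst,
    (hsm S).snd.sub contDiff_const, fun t => by rw [hshift]; simp, fun t => by rw [hshift]; simp,
    ?_⟩
  · rintro ⟨t, s⟩ ⟨t', s'⟩ he
    rcases le_total s s' with hss | hss
    · obtain ⟨h1, h2⟩ := hcross _ _ _ _ hss he
      exact Prod.ext h1 h2
    · obtain ⟨h1, h2⟩ := hcross _ _ _ _ hss he.symm
      exact (Prod.ext h1 h2).symm
  · rintro ⟨t, s⟩
    have h1 := jac_comp (hΦ.contDiff_slice s) hE (t, 0)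
    have h2 := jac_comp hE (H := fun q : ℝ × ℝ => (q.1, q.2 + s)) (by fun_prop) (t, 0)
    have h3 : jac (fun q : ℝ × ℝ => (q.1, q.2 + s)) (t, 0) = 1 := by
      have hK : ContDiff ℝ (⊤ : ℕ∞) fun q : ℝ × ℝ => (q.1, q.2 + s) := by fun_prop
      rw [jac, d1_of_hasDerivAt hK ((hasDerivAt_id t).prodMk (hasDerivAt_const t (0 + s))),
        d2_of_hasDerivAt hK ((hasDerivAt_const (0 : ℝ) t).prodMk
          ((hasDerivAt_id (0 : ℝ)).add_const s))]
      simp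
    simp only [← hΦ.add] at h1
    have h4 : (fun q : ℝ × ℝ => Φ (q.2 + s, c q.1)) = fun q => Φ (s + q.2, c q.1) :=
      funext fun q => by rw [add_comm]
    simp only [h3, mul_one, zero_add, h4] at h2
    rw [← h2, h1]
    exact mul_pos (hΦ.jac_pos _ _) (h.jac_flowBox_pos hΦ t)
  · intro t s hs
    have := hΦ.eq_translation (z := Φ (S, c t)) (sub_nonneg.2 hs) (fun u hu =>
      IsAngleField.field_of_angle_eq_zero
        (h.outer _ (le_trans (by linarith [hu.1, hesc t]) (le_abs_self _))))
    rw [← hΦ.add, sub_add_cancel] at this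
    simp only [this]
    ext <;> simp only
    ring

end Collar

section Well

open scoped Topology

variable {p : ℝ × ℝ → ℝ} {c : ℝ → ℝ × ℝ} {b₀ : ℝ} {Ω : Set (ℝ × ℝ)}

theorem isLocalMin_of_well (hΩ : IsOpen Ω) (hsub : range c ⊆ Ω) (hval : ∀ m ∈ range c, p m = b₀)
    (hgt : ∀ m ∈ Ω \ range c, b₀ < p m) (t : ℝ) : IsLocalMin p (c t) := by
  filter_upwards [hΩ.mem_nhds (hsub ⟨t, rfl⟩)] with z hz
  rw [hval _ ⟨t, rfl⟩]
  by_cases h : z ∈ range c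
  · rw [hval z h]
  · exact (hgt z ⟨hz, h⟩).le

/-- A vector transverse to a critical curve on which the Hessian degenerates forces the Hessian
to vanish. -/
theorem hessian_degenerate (hp : ContDiff ℝ (⊤ : ℕ∞) p) (hc : ContDiff ℝ (⊤ : ℕ∞) c)
    (hcrit : ∀ t, fderiv ℝ p (c t) = 0) {t : ℝ} {W : ℝ × ℝ}
    (hdet : (deriv c t).1 * W.2 - W.1 * (deriv c t).2 ≠ 0)
    (hW : fderiv ℝ (fderiv ℝ p) (c t) W W = 0) (ν : ℝ × ℝ) :
    fderiv ℝ (fderiv ℝ p) (c t) ν ν = 0 := by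
  have hω : ContDiff ℝ (⊤ : ℕ∞) (fderiv ℝ p) := hp.fderiv_right (m := (⊤ : ℕ∞)) (by simp)
  have hcd : HasDerivAt c (deriv c t) t := (hc.differentiable (by simp) t).hasDerivAt
  have h1 : fderiv ℝ (fderiv ℝ p) (c t) (deriv c t) = 0 := by
    have h2 : HasDerivAt (fun t => fderiv ℝ p (c t)) (fderiv ℝ (fderiv ℝ p) (c t) (deriv c t)) t :=
      HasFDerivAt.comp_hasDerivAt t
        ((hω.differentiable (by simp)) (c t)).hasFDerivAt hcd
    simp only [hcrit] at h2
    exact h2.unique (hasDerivAt_const t _)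
  have hsymm : IsSymmSndFDerivAt ℝ p (c t) :=
    hp.contDiffAt.isSymmSndFDerivAt (by
      rw [minSmoothness_of_isRCLikeNormedField]
      exact WithTop.coe_le_coe.2 le_top)
  set e := (deriv c t).1 * W.2 - W.1 * (deriv c t).2 with he
  have hν : e • ν = (ν.1 * W.2 - W.1 * ν.2) • deriv c t
      + ((deriv c t).1 * ν.2 - ν.1 * (deriv c t).2) • W := by
    ext
    · simp only [Prod.smul_fst, Prod.fst_add, smul_eq_mul, he]; ring
    · simp only [Prod.smul_snd, Prod.snd_add, smul_eq_mul, he]; ring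
  have h3 : fderiv ℝ (fderiv ℝ p) (c t) (e • ν) (e • ν) = 0 := by
    have h4 : fderiv ℝ (fderiv ℝ p) (c t) W (deriv c t) = 0 := by
      rw [hsymm.eq, h1]; simp
    rw [hν]
    simp [h1, hW, h4]
  simp only [map_smul, smul_apply, smul_eq_mul] at h3
  simpa [hdet] using h3

theorem exists_well_factor (hp : ContDiff ℝ (⊤ : ℕ∞) p)
    (hper : ∀ x ξ : ℝ, p (x + 2 * π, ξ) = p (x, ξ)) (hc : IsCylinderCurve c)
    (hΩ : IsOpen Ω) (hsub : range c ⊆ Ω) (hval : ∀ m ∈ range c, p m = b₀)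
    (hgt : ∀ m ∈ Ω \ range c, b₀ < p m)
    (hess : ∀ t, ∀ ν : ℝ × ℝ, ν ≠ 0 → ν.1 * (deriv c t).1 + ν.2 * (deriv c t).2 = 0 →
      iteratedFDeriv ℝ 2 p (c t) ![ν, ν] ≠ 0)
    {E : ℝ × ℝ → ℝ × ℝ} {X τ : ℝ → ℝ} {S : ℝ} (hE : IsCollar c E X τ S) :
    ∃ k : ℝ × ℝ → ℝ, ContDiff ℝ (⊤ : ℕ∞) k ∧ (∀ t s, p (E (t, s)) = b₀ + s ^ 2 * k (t, s)) ∧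
      (∀ t, 0 < k (t, 0)) ∧ ∀ t s, k (t + 2 * π, s) = k (t, s) := by
  have hmin := isLocalMin_of_well hΩ hsub hval hgt
  have hcrit : ∀ t, fderiv ℝ p (c t) = 0 := fun t => (hmin t).fderiv_eq_zero
  have hω : ContDiff ℝ (⊤ : ℕ∞) (fderiv ℝ p) := hp.fderiv_right (m := (⊤ : ℕ∞)) (by simp)
  have hP : ContDiff ℝ (⊤ : ℕ∞) fun q => p (E q) := hp.comp hE.smooth
  have hd2 : ∀ t s, HasDerivAt (fun s => p (E (t, s)))
      (fderiv ℝ p (E (t, s)) (d2 E (t, s))) s := fun t s =>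
    HasFDerivAt.comp_hasDerivAt s (hp.hasFDerivAt_fderiv _) (hasDerivAt_d2 hE.smooth t s)
  obtain ⟨k₁, hk₁, e₁⟩ := exists_smooth_quotient (fun q : ℝ × ℝ => p (E q) - b₀)
    (hP.sub contDiff_const) (fun t => by
      rw [hE.zero, hval _ ⟨t, rfl⟩, sub_self])
  have hk₁0 : ∀ t, k₁ (t, 0) = 0 := by
    intro t
    have h1 := (hd2 t 0).sub_const b₀
    simp only [e₁] at h1
    have h2 := (hasDerivAt_id (0 : ℝ)).smul (hasDerivAt_d2 hk₁ t 0)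
    have h3 := h1.unique h2
    rw [hE.zero, hcrit] at h3
    simpa using h3.symm
  obtain ⟨k, hk, e⟩ := exists_smooth_quotient k₁ hk₁ hk₁0
  have heq : ∀ t s, p (E (t, s)) = b₀ + s ^ 2 * k (t, s) := by
    intro t s
    have h1 := e₁ t s
    rw [e t s, smul_eq_mul, smul_eq_mul] at h1
    linarith
  have hlim : ∀ t, Filter.Tendsto (fun s => k (t, s)) (𝓝[≠] 0) (𝓝 (k (t, 0))) := fun t =>
    ((hasDerivAt_d2 hk t 0).continuousAt.tendsto).mono_left nhdsWithin_le_nhds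
  refine ⟨k, hk, heq, fun t => lt_of_le_of_ne ?_ ?_, ?_⟩
  · refine ge_of_tendsto (hlim t) ?_
    have h1 : ∀ᶠ s in 𝓝 (0 : ℝ), p (c t) ≤ p (E (t, s)) := by
      have h2 : Filter.Tendsto (fun s => E (t, s)) (𝓝 0) (𝓝 (c t)) := by
        rw [← hE.zero]
        exact (hasDerivAt_d2 hE.smooth t 0).continuousAt.tendsto
      exact h2.eventually (hmin t)
    filter_upwards [h1.filter_mono nhdsWithin_le_nhds, self_mem_nhdsWithin] with s hs hs0
    rw [heq, hval _ ⟨t, rfl⟩] at hs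
    have : 0 ≤ s ^ 2 * k (t, s) := by linarith
    exact nonneg_of_mul_nonneg_right this (by have : s ≠ 0 := hs0; positivity)
  · intro h0
    have hW : fderiv ℝ (fderiv ℝ p) (c t) (d2 E (t, 0)) (d2 E (t, 0)) = 0 := by
      have h1 : HasDerivAt (fun s => fderiv ℝ p (E (t, s)) (d2 E (t, s)))
          (fderiv ℝ (fderiv ℝ p) (E (t, 0)) (d2 E (t, 0)) (d2 E (t, 0))
            + fderiv ℝ p (E (t, 0)) (d2 (d2 E) (t, 0))) 0 := by
        have h2 : HasDerivAt (fun s => fderiv ℝ p (E (t, s)))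
          (fderiv ℝ (fderiv ℝ p) (E (t, 0)) (d2 E (t, 0))) 0 :=
          HasFDerivAt.comp_hasDerivAt (0 : ℝ) ((hω.differentiable (by simp)) _).hasFDerivAt
            (hasDerivAt_d2 hE.smooth t 0)
        exact h2.clm_apply (hasDerivAt_d2 (contDiff_d2 hE.smooth) t 0)
      have h3 : (fun s => fderiv ℝ p (E (t, s)) (d2 E (t, s)))
          = fun s => 2 * s * k (t, s) + s ^ 2 * d2 k (t, s) := by
        funext s
        refine (hd2 t s).unique ?_
        simp only [heq]
        have := (((hasDerivAt_pow 2 s).mul (hasDerivAt_d2 hk t s)).const_add b₀)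
        simpa using this
      have h4 : HasDerivAt (fun s => 2 * s * k (t, s) + s ^ 2 * d2 k (t, s)) 0 0 := by
        have := (((hasDerivAt_id (0 : ℝ)).const_mul 2).mul (hasDerivAt_d2 hk t 0)).add
          ((hasDerivAt_pow 2 (0 : ℝ)).mul (hasDerivAt_d2 (contDiff_d2 hk) t 0))
        refine this.congr_deriv ?_
        simp [← h0]
      rw [h3] at h1
      have h5 := h1.unique h4
      rw [hE.zero, hcrit] at h5
      simpa using h5
    have hd1 : d1 E (t, 0) = deriv c t := by
      refine d1_of_hasDerivAt hE.smooth ?_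
      simp only [hE.zero]
      exact hc.hasDerivAt t
    have hjac := (hE.jac_pos (t, 0)).ne'
    rw [jac, hd1] at hjac
    refine hess t (-(deriv c t).2, (deriv c t).1) ?_ (by simp only; ring) ?_
    · intro h
      rw [Prod.mk_eq_zero] at h
      exact hc.regular t (Prod.ext h.2 (by simpa using h.1))
    · rw [iteratedFDeriv_two_apply]
      exact hessian_degenerate hp hc.smooth hcrit hjac hW _
  · intro t s
    have key : ∀ s, s ≠ 0 → k (t + 2 * π, s) = k (t, s) := by
      intro s hs
      have h1 := heq (t + 2 * π) s
      have h2 := heq t s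
      have h3 : p (E (t + 2 * π, s)) = p (E (t, s)) := by
        rw [hE.shift]
        rw [show E (t, s) + (2 * π, 0) = ((E (t, s)).1 + 2 * π, (E (t, s)).2) by ext <;> simp]
        exact hper _ _
      have hs2 : s ^ 2 ≠ 0 := pow_ne_zero 2 hs
      exact mul_left_cancel₀ hs2 (by linarith)
    rcases eq_or_ne s 0 with rfl | hs
    · refine tendsto_nhds_unique (hlim (t + 2 * π)) ((hlim t).congr' ?_)
      filter_upwards [self_mem_nhdsWithin] with s hs
      exact (key s hs).symm
    · exact key s hs

end Well

section Profile

open scoped Topology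

/-- A smooth cutoff equal to `0` for `|s| ≤ δ / 2` and to `1` for `|s| ≥ δ`. -/
theorem exists_outer_cutoff {δ : ℝ} (hδ : 0 < δ) : ∃ χ : ℝ → ℝ, ContDiff ℝ (⊤ : ℕ∞) χ ∧
    (∀ s, 0 ≤ χ s) ∧ (∀ s, χ s ≤ 1) ∧ (∀ s, |s| ≤ δ / 2 → χ s = 0) ∧
    ∀ s, δ ≤ |s| → χ s = 1 := by
  refine ⟨fun s => Real.smoothTransition ((s ^ 2 - (δ / 2) ^ 2) / (δ ^ 2 - (δ / 2) ^ 2)),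
    Real.smoothTransition.contDiff.comp (by fun_prop), fun s => Real.smoothTransition.nonneg _,
    fun s => Real.smoothTransition.le_one _, fun s hs => ?_, fun s hs => ?_⟩
  · refine Real.smoothTransition.zero_of_nonpos (div_nonpos_of_nonpos_of_nonneg ?_ (by nlinarith))
    have := sq_le_sq' (by linarith [abs_nonneg s]) hs
    rw [sq_abs] at this
    linarith
  · refine Real.smoothTransition.one_of_one_le ?_
    rw [le_div_iff₀ (by nlinarith)]
    have := sq_le_sq' (by linarith) hs
    rw [sq_abs] at this
    linarith

theorem cutoff_combination_pos {a χ : ℝ} (h0 : 0 ≤ χ) (h1 : χ ≤ 1) (ha : χ = 1 ∨ 0 < a) :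
    0 < (1 - χ) * a + χ := by
  rcases ha with rfl | ha
  · norm_num
  · rcases h1.eq_or_lt with rfl | h1
    · norm_num
    · have : 0 < (1 - χ) * a := mul_pos (by linarith) ha
      linarith

/-- A smooth function of slope `1` far away, increasing in the second variable, whose square is
`s ^ 2 * k` near `s = 0`. -/
theorem exists_increasing_root {k : ℝ × ℝ → ℝ} (hk : ContDiff ℝ (⊤ : ℕ∞) k)
    (hper : ∀ t s, k (t + 2 * π, s) = k (t, s)) (hpos : ∀ t, 0 < k (t, 0)) :
    ∃ (f : ℝ × ℝ → ℝ) (δ ε : ℝ), 0 < ε ∧ 0 < δ ∧ ContDiff ℝ (⊤ : ℕ∞) f ∧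
      (∀ t s, f (t + 2 * π, s) = f (t, s)) ∧ (∀ t, f (t, 0) = 0) ∧ (∀ q, 0 < d2 f q) ∧
      (∀ t s, |s| ≤ ε → f (t, s) ^ 2 = s ^ 2 * k (t, s)) ∧
      ∀ t s, δ ≤ |s| → d2 f (t, s) = 1 := by
  obtain ⟨δ₁, hδ₁, hkpos⟩ := exists_strip_of_periodic (U := {q | 0 < k q})
    (isOpen_lt continuous_const hk.continuous)
    (fun t s => by simp only [mem_ofPred_eq, hper]) hpos
  obtain ⟨χ₁, hχ₁, n₁, l₁, z₁, o₁⟩ := exists_outer_cutoff hδ₁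
  set m : ℝ × ℝ → ℝ := fun q => (1 - χ₁ q.2) * k q + χ₁ q.2 with hm
  have hχ₁' : ContDiff ℝ (⊤ : ℕ∞) fun q : ℝ × ℝ => χ₁ q.2 := hχ₁.comp contDiff_snd
  have hms : ContDiff ℝ (⊤ : ℕ∞) m := ((contDiff_const.sub hχ₁').mul hk).add hχ₁'
  have hmpos : ∀ q, 0 < m q := by
    rintro ⟨t, s⟩
    refine cutoff_combination_pos (n₁ s) (l₁ s) ?_
    rcases le_total δ₁ |s| with h | h
    · exact Or.inl (o₁ s h)
    · exact Or.inr (hkpos t s h)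
  set f₀ : ℝ × ℝ → ℝ := fun q => q.2 * √(m q) with hf₀
  have hf₀s : ContDiff ℝ (⊤ : ℕ∞) f₀ :=
    contDiff_snd.mul (hms.sqrt fun q => (hmpos q).ne')
  have hf₀per : ∀ t s, f₀ (t + 2 * π, s) = f₀ (t, s) := fun t s => by simp only [hf₀, hm, hper]
  have hf₀0 : ∀ t, f₀ (t, 0) = 0 := fun t => by simp [hf₀]
  have hf₀d : ∀ t, 0 < d2 f₀ (t, 0) := by
    intro t
    have h1 : HasDerivAt (fun s => f₀ (t, s)) (√(m (t, 0))) 0 := by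
      have := (hasDerivAt_id (0 : ℝ)).mul
        (hasDerivAt_d2 (hms.sqrt fun q => (hmpos q).ne') t 0)
      refine this.congr_deriv ?_
      simp
    rw [d2_of_hasDerivAt hf₀s h1]
    exact Real.sqrt_pos.2 (hmpos _)
  have hd2per : ∀ t s, d2 f₀ (t + 2 * π, s) = d2 f₀ (t, s) := by
    intro t s
    refine d2_of_hasDerivAt hf₀s ?_
    simp only [hf₀per]
    exact hasDerivAt_d2 hf₀s t s
  obtain ⟨δ₂, hδ₂, hdpos⟩ := exists_strip_of_periodic (U := {q | 0 < d2 f₀ q})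
    (isOpen_lt continuous_const (contDiff_d2 hf₀s).continuous)
    (fun t s => by simp only [mem_ofPred_eq, hd2per]) hf₀d
  obtain ⟨χ₂, hχ₂, n₂, l₂, z₂, o₂⟩ := exists_outer_cutoff hδ₂
  set g : ℝ × ℝ → ℝ := fun q => (1 - χ₂ q.2) * d2 f₀ q + χ₂ q.2 with hg
  have hχ₂' : ContDiff ℝ (⊤ : ℕ∞) fun q : ℝ × ℝ => χ₂ q.2 := hχ₂.comp contDiff_snd
  have hgs : ContDiff ℝ (⊤ : ℕ∞) g :=
    ((contDiff_const.sub hχ₂').mul (contDiff_d2 hf₀s)).add hχ₂'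
  obtain ⟨f, hf, hf0, hfint, hfd⟩ := exists_smooth_antideriv g hgs 0
  have hd2f : ∀ q, d2 f q = g q := fun q => d2_of_hasDerivAt hf (hfd q.1 q.2)
  refine ⟨f, δ₂, min (δ₁ / 2) (δ₂ / 2), by positivity, hδ₂, hf, fun t s => ?_, hf0, fun q => ?_,
    fun t s hs => ?_, fun t s hs => ?_⟩
  · rw [hfint, hfint]
    simp only [hg, hd2per]
  · rw [hd2f]
    refine cutoff_combination_pos (n₂ _) (l₂ _) ?_
    rcases le_total δ₂ |q.2| with h | h
    · exact Or.inl (o₂ _ h)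
    · exact Or.inr (hdpos q.1 q.2 h)
  · have h1 : f (t, s) = f₀ (t, s) := by
      rw [hfint]
      have h2 : ∫ r in (0 : ℝ)..s, g (t, r) = ∫ r in (0 : ℝ)..s, d2 f₀ (t, r) := by
        refine intervalIntegral.integral_congr fun r hr => ?_
        have hr' : |r| ≤ |s| := by
          have := abs_sub_left_of_mem_uIcc hr
          simpa using this
        simp only [hg, z₂ r (hr'.trans (hs.trans (min_le_right _ _)))]
        ring
      rw [h2, intervalIntegral.integral_eq_sub_of_hasDerivAt
        (fun r _ => hasDerivAt_d2 hf₀s t r)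
        (((contDiff_d2 hf₀s).continuous.comp (by fun_prop)).intervalIntegrable _ _), hf₀0,
        sub_zero]
    rw [h1]
    simp only [hf₀, mul_pow, Real.sq_sqrt (hmpos _).le]
    simp only [hm, z₁ s (hs.trans (min_le_left _ _))]
    ring
  · rw [hd2f]
    simp only [hg, o₂ s hs]
    ring

/-- The increasing root of a well can be arranged to be `s + τ t - C` for large `s`. -/
theorem exists_energy_profile {k : ℝ × ℝ → ℝ} (hk : ContDiff ℝ (⊤ : ℕ∞) k)
    (hper : ∀ t s, k (t + 2 * π, s) = k (t, s)) (hpos : ∀ t, 0 < k (t, 0)) {τ : ℝ → ℝ}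
    (hτ : ContDiff ℝ (⊤ : ℕ∞) τ) (hτper : ∀ t, τ (t + 2 * π) = τ t) :
    ∃ (f : ℝ × ℝ → ℝ) (ε C S : ℝ), 0 < ε ∧ ContDiff ℝ (⊤ : ℕ∞) f ∧
      (∀ t s, f (t + 2 * π, s) = f (t, s)) ∧ (∀ t, f (t, 0) = 0) ∧ (∀ q, 0 < d2 f q) ∧
      (∀ t s, |s| ≤ ε → f (t, s) ^ 2 = s ^ 2 * k (t, s)) ∧
      (∀ t s, S ≤ s → f (t, s) = s + τ t - C) ∧ ∀ t e, ∃ s, f (t, s) = e := by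
  obtain ⟨f, δ, ε, hε, hδ, hf, hfper, hf0, hfpos, hfsq, hf1⟩ := exists_increasing_root hk hper hpos
  have hup : ∀ t s, δ ≤ s → f (t, s) = s + (f (t, δ) - δ) := by
    intro t s hs
    have h1 : ∫ r in δ..s, d2 f (t, r) = ∫ r in δ..s, (1 : ℝ) := by
      refine intervalIntegral.integral_congr fun r hr => hf1 t r ?_
      rw [uIcc_of_le hs] at hr
      exact hr.1.trans (le_abs_self _)
    rw [intervalIntegral.integral_eq_sub_of_hasDerivAt (fun r _ => hasDerivAt_d2 hf t r)
        (((contDiff_d2 hf).continuous.comp (by fun_prop)).intervalIntegrable _ _),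
        intervalIntegral.integral_const, smul_eq_mul, mul_one] at h1
    linarith
  have hdown : ∀ t s, s ≤ -δ → f (t, s) = s + (f (t, -δ) + δ) := by
    intro t s hs
    have h1 : ∫ r in s..(-δ), d2 f (t, r) = ∫ r in s..(-δ), (1 : ℝ) := by
      refine intervalIntegral.integral_congr fun r hr => hf1 t r ?_
      rw [uIcc_of_le hs] at hr
      have := neg_abs_le r
      linarith [hr.2]
    rw [intervalIntegral.integral_eq_sub_of_hasDerivAt (fun r _ => hasDerivAt_d2 hf t r)
        (((contDiff_d2 hf).continuous.comp (by fun_prop)).intervalIntegrable _ _),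
        intervalIntegral.integral_const, smul_eq_mul, mul_one] at h1
    linarith
  have hq : ContDiff ℝ (⊤ : ℕ∞) fun t => f (t, δ) - δ :=
    (hf.comp (contDiff_id.prodMk contDiff_const)).sub contDiff_const
  obtain ⟨M, hM⟩ := exists_bound_of_periodic (f := fun t => τ t - (f (t, δ) - δ))
    (hτ.sub hq).continuous (fun t => by simp only [hτper, hfper])
  have hb : ContDiff ℝ (⊤ : ℕ∞) fun s : ℝ => Real.smoothTransition (s - δ) :=
    Real.smoothTransition.contDiff.comp (by fun_prop)
  have hbmono : ∀ s, 0 ≤ deriv (fun s : ℝ => Real.smoothTransition (s - δ)) s := fun s =>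
    Monotone.deriv_nonneg fun a b hab => Real.smoothTransition.monotone (by linarith)
  set w : ℝ → ℝ := fun t => τ t - (f (t, δ) - δ) + M with hw
  have hw0 : ∀ t, 0 ≤ w t := fun t => by
    have := (abs_le.1 (hM t)).1
    simp only [hw]
    linarith
  have hws : ContDiff ℝ (⊤ : ℕ∞) w := (hτ.sub hq).add contDiff_const
  have hF : ContDiff ℝ (⊤ : ℕ∞) fun q : ℝ × ℝ => f q + Real.smoothTransition (q.2 - δ) * w q.1 :=
    hf.add ((hb.comp contDiff_snd).mul (hws.comp contDiff_fst))
  have hsmall : ∀ s, s ≤ δ → Real.smoothTransition (s - δ) = 0 := fun s hs =>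
    Real.smoothTransition.zero_of_nonpos (by linarith)
  have hlarge : ∀ s, δ + 1 ≤ s → Real.smoothTransition (s - δ) = 1 := fun s hs =>
    Real.smoothTransition.one_of_one_le (by linarith)
  have htop : ∀ t s, δ + 1 ≤ s →
      f (t, s) + Real.smoothTransition (s - δ) * w t = s + τ t - -M := by
    intro t s hs
    rw [hlarge s hs, hup t s (by linarith)]
    simp only [hw]
    ring
  refine ⟨fun q => f q + Real.smoothTransition (q.2 - δ) * w q.1, min ε δ, -M, δ + 1,
    lt_min hε hδ, hF, fun t s => ?_, fun t => ?_, ?_, fun t s hs => ?_, htop, fun t e => ?_⟩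
  · simp only [hw, hτper, hfper]
  · simp only [hf0, hsmall 0 hδ.le]
    ring
  · rintro ⟨t, s⟩
    rw [d2_of_hasDerivAt hF ((hasDerivAt_d2 hf t s).add
      ((hb.differentiable (by simp) s).hasDerivAt.mul_const (w t)))]
    exact add_pos_of_pos_of_nonneg (hfpos _) (mul_nonneg (hbmono s) (hw0 t))
  · dsimp only
    rw [hsmall s ((le_abs_self s).trans (hs.trans (min_le_right _ _))),
      ← hfsq t s (hs.trans (min_le_left _ _))]
    ring
  · have hcont : Continuous fun s => f (t, s) + Real.smoothTransition (s - δ) * w t :=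
      hF.continuous.comp (by fun_prop)
    refine mem_range_of_exists_le_of_exists_ge hcont
      ⟨min (-δ) (e - (f (t, -δ) + δ)), ?_⟩ ⟨max (δ + 1) (e - τ t - M), ?_⟩
    · dsimp only
      rw [hsmall _ ((min_le_left _ _).trans (by linarith)), hdown t _ (min_le_left _ _)]
      linarith [min_le_right (-δ) (e - (f (t, -δ) + δ))]
    · dsimp only
      rw [htop t _ (le_max_left _ _)]
      linarith [le_max_right (δ + 1) (e - τ t - M)]

end Profile

section Straightening

open scoped Topology

/-- An oriented parametrization of a part of the cylinder by `(t, e)` which is a vertical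
translation on every vertical line for `e ≥ e₁`. -/
structure IsStraightening (B : ℝ × ℝ → ℝ × ℝ) (X : ℝ → ℝ) (e₁ C : ℝ) : Prop where
  smooth : ContDiff ℝ (⊤ : ℕ∞) B
  shift : ∀ t e, B (t + 2 * π, e) = B (t, e) + (2 * π, 0)
  injective : Function.Injective B
  jac_pos : ∀ q, 0 < jac B q
  top : ∀ t e, e₁ ≤ e → B (t, e) = (X t, e + C)

theorem contDiff_of_inverse {Q G : ℝ × ℝ → ℝ × ℝ} (hQ : ContDiff ℝ (⊤ : ℕ∞) Q)
    (hjac : ∀ q, jac Q q ≠ 0) (hGQ : ∀ q, G (Q q) = q) (hQG : ∀ q, Q (G q) = q) :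
    ContDiff ℝ (⊤ : ℕ∞) G := by
  have h := (smooth_inverse isOpen_univ hQ.contDiffOn
    (fun q _ => by rw [det_fderiv_eq_jac]; exact hjac q) (fun q _ => hGQ q)).2
  exact contDiff_iff_contDiffAt.2 fun q => h q ⟨G q, mem_univ _, hQG q⟩

theorem jac_graph {f : ℝ × ℝ → ℝ} (hf : ContDiff ℝ (⊤ : ℕ∞) f) (q : ℝ × ℝ) :
    jac (fun q : ℝ × ℝ => (q.1, f q)) q = d2 f q := by
  have hQ : ContDiff ℝ (⊤ : ℕ∞) fun q : ℝ × ℝ => (q.1, f q) := contDiff_fst.prodMk hf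
  rw [jac, d1_of_hasDerivAt hQ ((hasDerivAt_id q.1).prodMk (hasDerivAt_d1 hf q.1 q.2)),
    d2_of_hasDerivAt hQ ((hasDerivAt_const q.2 q.1).prodMk (hasDerivAt_d2 hf q.1 q.2))]
  simp

theorem strictMono_of_d2_pos {f : ℝ × ℝ → ℝ} (hf : ContDiff ℝ (⊤ : ℕ∞) f) (h : ∀ q, 0 < d2 f q)
    (t : ℝ) : StrictMono fun s => f (t, s) :=
  strictMono_of_deriv_pos fun s => by
    rw [(hasDerivAt_d2 hf t s).deriv]
    exact h _

variable {p : ℝ × ℝ → ℝ} {c : ℝ → ℝ × ℝ} {b₀ : ℝ} {Ω : Set (ℝ × ℝ)}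

theorem exists_straightening (hp : ContDiff ℝ (⊤ : ℕ∞) p)
    (hper : ∀ x ξ : ℝ, p (x + 2 * π, ξ) = p (x, ξ)) (hc : IsCylinderCurve c)
    (hΩ : IsOpen Ω) (hsub : range c ⊆ Ω) (hval : ∀ m ∈ range c, p m = b₀)
    (hgt : ∀ m ∈ Ω \ range c, b₀ < p m)
    (hess : ∀ t, ∀ ν : ℝ × ℝ, ν ≠ 0 → ν.1 * (deriv c t).1 + ν.2 * (deriv c t).2 = 0 →
      iteratedFDeriv ℝ 2 p (c t) ![ν, ν] ≠ 0) :
    ∃ (B : ℝ × ℝ → ℝ × ℝ) (X : ℝ → ℝ) (e₁ C ε : ℝ), 0 < ε ∧ IsStraightening B X e₁ C ∧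
      (∀ t, B (t, 0) = c t) ∧ ∀ t e, |e| ≤ ε → p (B (t, e)) = b₀ + e ^ 2 := by
  obtain ⟨E, X, τ, S, hE⟩ := hc.exists_collar
  obtain ⟨k, hk, hpk, hkpos, hkper⟩ := exists_well_factor hp hper hc hΩ hsub hval hgt hess hE
  obtain ⟨f, δ, C, S', hδ, hf, hfper, hf0, hfpos, hfsq, hftop, honto⟩ :=
    exists_energy_profile hk hkper hkpos hE.smooth_snd hE.shift_snd
  choose ρ hρ using honto
  have hmono := strictMono_of_d2_pos hf hfpos
  have hρf : ∀ t s, ρ t (f (t, s)) = s := fun t s => (hmono t).injective (hρ t _)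
  have hρper : ∀ t e, ρ (t + 2 * π) e = ρ t e := fun t e => (hmono t).injective (by
    rw [hρ, ← hfper, hρ])
  have hQ : ContDiff ℝ (⊤ : ℕ∞) fun q : ℝ × ℝ => (q.1, f q) := contDiff_fst.prodMk hf
  have hG : ContDiff ℝ (⊤ : ℕ∞) fun q : ℝ × ℝ => (q.1, ρ q.1 q.2) :=
    contDiff_of_inverse hQ (fun q => by rw [jac_graph hf]; exact (hfpos q).ne')
      (fun q => by simp only [hρf]) (fun q => by simp only [hρ])
  have hρs : ContDiff ℝ (⊤ : ℕ∞) fun q : ℝ × ℝ => ρ q.1 q.2 := contDiff_snd.comp hG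
  have hB : ContDiff ℝ (⊤ : ℕ∞) fun q : ℝ × ℝ => E (q.1, ρ q.1 q.2) := hE.smooth.comp hG
  have hρ0 : ∀ t, ρ t 0 = 0 := fun t =>
    (congrArg (ρ t) (hf0 t)).symm.trans (hρf t 0)
  obtain ⟨M, hM⟩ := exists_bound_of_periodic hE.smooth_snd.continuous hE.shift_snd
  obtain ⟨ε, hε, hsmall⟩ := exists_strip_of_periodic (U := {q : ℝ × ℝ | |ρ q.1 q.2| < δ})
    (isOpen_lt hρs.continuous.abs continuous_const)
    (fun t s => by simp only [mem_ofPred_eq, hρper])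
    (fun t => by simpa only [mem_ofPred_eq, hρ0, abs_zero] using hδ)
  refine ⟨fun q => E (q.1, ρ q.1 q.2), X, max S S' + M - C, C, ε, hε,
    ⟨hB, fun t e => ?_, ?_, ?_, ?_⟩, fun t => ?_, fun t e he => ?_⟩
  · simp only [hρper, hE.shift]
  · rintro ⟨t, e⟩ ⟨t', e'⟩ h
    have h1 := Prod.ext_iff.1 (hE.injective h)
    simp only at h1
    obtain ⟨rfl, h2⟩ := h1
    refine Prod.ext rfl ?_
    rw [← hρ t e, h2, hρ]
  · rintro ⟨t, e⟩
    have h1 := jac_comp hB hQ (t, ρ t e)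
    simp only [hρf, hρ, jac_graph hf] at h1
    exact pos_of_mul_pos_left (h1 ▸ hE.jac_pos _) (hfpos _).le
  · intro t e he
    have h1 : max S S' ≤ ρ t e := by
      rw [← (hmono t).le_iff_le]
      rw [hρ, hftop _ _ (le_max_right _ _)]
      linarith [(abs_le.1 (hM t)).2]
    have h2 := hρ t e
    rw [hftop _ _ ((le_max_right _ _).trans h1)] at h2
    simp only
    rw [hE.top _ _ ((le_max_left _ _).trans h1)]
    ext <;> simp only
    linarith
  · simp only [hρ0, hE.zero]
  · simp only
    rw [hpk, ← hfsq t _ (hsmall t e he).le, hρ]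

end Straightening

section Action

open scoped Topology

theorem d2_shift {B : ℝ × ℝ → ℝ × ℝ} (hB : ContDiff ℝ (⊤ : ℕ∞) B)
    (hshift : ∀ t e, B (t + 2 * π, e) = B (t, e) + (2 * π, 0)) (t e : ℝ) :
    d2 B (t + 2 * π, e) = d2 B (t, e) := by
  refine d2_of_hasDerivAt hB ?_
  simp only [hshift]
  exact (hasDerivAt_d2 hB t e).add_const _

theorem d1_shift {B : ℝ × ℝ → ℝ × ℝ} (hB : ContDiff ℝ (⊤ : ℕ∞) B)
    (hshift : ∀ t e, B (t + 2 * π, e) = B (t, e) + (2 * π, 0)) (t e : ℝ) :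
    d1 B (t + 2 * π, e) = d1 B (t, e) := by
  have h1 : HasDerivAt (fun t => B (t + 2 * π, e)) (d1 B (t + 2 * π, e)) t :=
    (hasDerivAt_d1 hB (t + 2 * π) e).comp_add_const t (2 * π)
  simp only [hshift] at h1
  exact h1.unique ((hasDerivAt_d1 hB t e).add_const _)

theorem jac_shift {B : ℝ × ℝ → ℝ × ℝ} (hB : ContDiff ℝ (⊤ : ℕ∞) B)
    (hshift : ∀ t e, B (t + 2 * π, e) = B (t, e) + (2 * π, 0)) (t e : ℝ) :
    jac B (t + 2 * π, e) = jac B (t, e) := by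
  rw [jac, jac, d1_shift hB hshift, d2_shift hB hshift]

/-- The primitive of the Jacobian along the circles `e = const`, obtained from the action
integral of the Liouville form. -/
theorem exists_action_primitive {B : ℝ × ℝ → ℝ × ℝ} (hB : ContDiff ℝ (⊤ : ℕ∞) B)
    (hshift : ∀ t e, B (t + 2 * π, e) = B (t, e) + (2 * π, 0)) :
    ∃ F N : ℝ × ℝ → ℝ, ContDiff ℝ (⊤ : ℕ∞) F ∧ ContDiff ℝ (⊤ : ℕ∞) N ∧
      (∀ t e, F (t, e) = ∫ r in (0 : ℝ)..t, (B (r, e)).2 * (d1 B (r, e)).1) ∧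
      (∀ q, d1 N q = jac B q) ∧ (∀ e, N (0, e) = 0) ∧ (∀ e, d2 F (2 * π, e) = N (2 * π, e)) ∧
      ∀ t e, N (t, e) = d2 F (t, e) - (B (t, e)).2 * (d2 B (t, e)).1
        + (B (0, e)).2 * (d2 B (0, e)).1 := by
  have hω₁ : ContDiff ℝ (⊤ : ℕ∞) fun q => (B q).2 * (d1 B q).1 := hB.snd.mul (contDiff_d1 hB).fst
  have hω₂ : ContDiff ℝ (⊤ : ℕ∞) fun q => (B q).2 * (d2 B q).1 := hB.snd.mul (contDiff_d2 hB).fst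
  obtain ⟨G, hG, hG0, hGint, hGd⟩ := exists_smooth_antideriv
    (fun q : ℝ × ℝ => (B (q.2, q.1)).2 * (d1 B (q.2, q.1)).1)
    (hω₁.comp (contDiff_snd.prodMk contDiff_fst)) 0
  have hF : ContDiff ℝ (⊤ : ℕ∞) fun q : ℝ × ℝ => G (q.2, q.1) :=
    hG.comp (contDiff_snd.prodMk contDiff_fst)
  set F : ℝ × ℝ → ℝ := fun q => G (q.2, q.1) with hFdef
  have hd1F : d1 F = fun q => (B q).2 * (d1 B q).1 :=
    funext fun q => d1_of_hasDerivAt hF (hGd q.2 q.1)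
  have hω₂0 : ContDiff ℝ (⊤ : ℕ∞) fun q : ℝ × ℝ => (B (0, q.2)).2 * (d2 B (0, q.2)).1 :=
    hω₂.comp (contDiff_const.prodMk contDiff_snd)
  set N : ℝ × ℝ → ℝ := fun q => d2 F q - (B q).2 * (d2 B q).1
    + (B (0, q.2)).2 * (d2 B (0, q.2)).1 with hN
  have hNs : ContDiff ℝ (⊤ : ℕ∞) N := ((contDiff_d2 hF).sub hω₂).add hω₂0
  have hd2F0 : ∀ e, d2 F (0, e) = 0 := by
    intro e
    refine d2_of_hasDerivAt hF ?_
    simp only [hFdef, hG0]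
    exact hasDerivAt_const _ _
  refine ⟨F, N, hF, hNs, fun t e => hGint e t, ?_, fun e => ?_, fun e => ?_, fun t e => rfl⟩
  · rintro ⟨t, e⟩
    have h1 := hasDerivAt_d1 (contDiff_d2 hF) t e
    have h2 : d1 (d2 F) (t, e)
        = (d2 B (t, e)).2 * (d1 B (t, e)).1 + (B (t, e)).2 * (d2 (d1 B) (t, e)).1 := by
      rw [d1_d2_comm hF, hd1F]
      exact d2_of_hasDerivAt hω₁ ((hasDerivAt_snd (hasDerivAt_d2 hB t e)).mul
        (hasDerivAt_fst (hasDerivAt_d2 (contDiff_d1 hB) t e)))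
    have h3 := (hasDerivAt_snd (hasDerivAt_d1 hB t e)).mul
        (hasDerivAt_fst (hasDerivAt_d1 (contDiff_d2 hB) t e))
    rw [d1_of_hasDerivAt hNs ((h1.sub h3).add_const ((B (0, e)).2 * (d2 B (0, e)).1)), h2,
      d1_d2_comm hB, jac]
    ring
  · simp only [hN, hd2F0]
    ring
  · have h1 := d2_shift hB hshift 0 e
    have h2 := hshift 0 e
    rw [zero_add] at h1 h2
    simp only [hN, h1, h2]
    simp

/-- Action variable `L` and normalized angle variable `Y` of a straightening. -/
theorem IsStraightening.exists_action {B : ℝ × ℝ → ℝ × ℝ} {X : ℝ → ℝ} {e₁ C : ℝ}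
    (hB : IsStraightening B X e₁ C) :
    ∃ (Y : ℝ × ℝ → ℝ) (L : ℝ → ℝ), ContDiff ℝ (⊤ : ℕ∞) Y ∧ ContDiff ℝ (⊤ : ℕ∞) L ∧
      (∀ e, 0 < deriv L e) ∧ (∀ t e, Y (t + 2 * π, e) = Y (t, e) + 2 * π) ∧
      (∀ q, jac B q = d1 Y q * deriv L q.2) ∧
      (∀ t e, e₁ < e → Y (t, e) = X t ∧ L e = e + C) ∧
      ∀ e, L e = 1 / (2 * π) * ∫ t in (0 : ℝ)..(2 * π), (B (t, e)).2 * (d1 B (t, e)).1 := by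
  have hpi := Real.two_pi_pos
  obtain ⟨F, N, hF, hN, hFint, hd1N, hN0, hFN, hNeq⟩ := exists_action_primitive hB.smooth hB.shift
  set L : ℝ → ℝ := fun e => 1 / (2 * π) * F (2 * π, e) with hL
  have hLs : ContDiff ℝ (⊤ : ℕ∞) L :=
    contDiff_const.mul (hF.comp (contDiff_const.prodMk contDiff_id))
  have hLd : ∀ e, deriv L e = 1 / (2 * π) * N (2 * π, e) := fun e => by
    rw [← hFN]
    exact ((hasDerivAt_d2 hF (2 * π) e).const_mul _).deriv
  have hNmono : ∀ e, StrictMono fun t => N (t, e) := fun e => strictMono_of_deriv_pos fun t => by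
    rw [(hasDerivAt_d1 hN t e).deriv, hd1N]
    exact hB.jac_pos _
  have hLpos : ∀ e, 0 < deriv L e := by
    intro e
    rw [hLd]
    have := hNmono e hpi
    simp only [hN0] at this
    positivity
  have hNshift : ∀ t e, N (t + 2 * π, e) = N (t, e) + N (2 * π, e) := by
    intro t e
    have hd : ∀ t, HasDerivAt (fun t => N (t + 2 * π, e) - N (t, e)) 0 t := by
      intro t
      have h1 : HasDerivAt (fun t => N (t + 2 * π, e)) (d1 N (t + 2 * π, e)) t :=
        (hasDerivAt_d1 hN (t + 2 * π) e).comp_add_const t (2 * π)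
      refine (h1.sub (hasDerivAt_d1 hN t e)).congr_deriv ?_
      rw [hd1N, hd1N, jac_shift hB.smooth hB.shift, sub_self]
    have := is_const_of_deriv_eq_zero (fun t => (hd t).differentiableAt)
      (fun t => (hd t).deriv) t 0
    simp only [zero_add, hN0] at this
    linarith
  have hL's : ContDiff ℝ (⊤ : ℕ∞) (deriv L) := by
    have : deriv L = fun e => 1 / (2 * π) * N (2 * π, e) := funext hLd
    rw [this]
    exact contDiff_const.mul (hN.comp (contDiff_const.prodMk contDiff_id))
  have hYs : ContDiff ℝ (⊤ : ℕ∞) fun q : ℝ × ℝ => N q / deriv L q.2 + X 0 :=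
    (hN.div (hL's.comp contDiff_snd) fun q => (hLpos _).ne').add contDiff_const
  have hXs : X (2 * π) = X 0 + 2 * π := by
    have h1 := hB.shift 0 e₁
    rw [hB.top _ _ le_rfl, hB.top _ _ le_rfl] at h1
    simpa using (Prod.ext_iff.1 h1).1
  have hXd : ∀ t e, e₁ ≤ e → HasDerivAt X (d1 B (t, e)).1 t := by
    intro t e he
    have h1 := hasDerivAt_fst (hasDerivAt_d1 hB.smooth t e)
    simpa only [hB.top _ e he] using h1
  have hFtop : ∀ t e, e₁ ≤ e → F (t, e) = (e + C) * (X t - X 0) := by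
    intro t e he
    rw [hFint]
    simp only [hB.top _ e he]
    rw [intervalIntegral.integral_const_mul, intervalIntegral.integral_eq_sub_of_hasDerivAt
      (fun r _ => hXd r e he) (((contDiff_d1 hB.smooth).continuous.fst.comp
        (by fun_prop : Continuous fun r : ℝ => (r, e))).intervalIntegrable _ _)]
  have hNtop : ∀ t e, e₁ < e → N (t, e) = X t - X 0 := by
    intro t e he
    have h1 : d2 F (t, e) = X t - X 0 := by
      refine d2_of_hasDerivAt hF ?_
      have h2 : HasDerivAt (fun e => (e + C) * (X t - X 0)) (X t - X 0) e := by
        simpa using ((hasDerivAt_id e).add_const C).mul_const (X t - X 0)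
      refine h2.congr_of_eventuallyEq ?_
      filter_upwards [lt_mem_nhds he] with e' he'
      exact hFtop t e' he'.le
    have h3 : ∀ t, (d2 B (t, e)).1 = 0 := by
      intro t
      have h4 := hasDerivAt_fst (hasDerivAt_d2 hB.smooth t e)
      refine h4.unique ((hasDerivAt_const e (X t)).congr_of_eventuallyEq ?_)
      filter_upwards [lt_mem_nhds he] with e' he'
      rw [hB.top _ _ he'.le]
    rw [hNeq, h1, h3, h3]
    ring
  refine ⟨fun q => N q / deriv L q.2 + X 0, L, hYs, hLs, hLpos, fun t e => ?_, ?_, fun t e he => ?_,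
    fun e => ?_⟩
  · have h1 : N (2 * π, e) = deriv L e * (2 * π) := by
      rw [hLd]
      field_simp
    have := (hLpos e).ne'
    simp only [hNshift, h1]
    field_simp
    ring
  · rintro ⟨t, e⟩
    rw [d1_of_hasDerivAt hYs (((hasDerivAt_d1 hN t e).div_const (deriv L e)).add_const (X 0)),
      hd1N, div_mul_cancel₀ _ (hLpos e).ne']
  · have h1 : deriv L e = 1 := by
      rw [hLd, hNtop _ _ he, hXs]
      field_simp
      ring
    constructor
    · simp only [h1, hNtop _ _ he]
      ring
    · simp only [hL, hFtop _ _ he.le, hXs]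
      field_simp
      ring
  · simp only [hL, hFint]

end Action

section ActionChart

open scoped Topology

theorem jac_graph_left {f : ℝ × ℝ → ℝ} (hf : ContDiff ℝ (⊤ : ℕ∞) f) (q : ℝ × ℝ) :
    jac (fun q : ℝ × ℝ => (f q, q.2)) q = d1 f q := by
  have hQ : ContDiff ℝ (⊤ : ℕ∞) fun q : ℝ × ℝ => (f q, q.2) := hf.prodMk contDiff_snd
  rw [jac, d1_of_hasDerivAt hQ ((hasDerivAt_d1 hf q.1 q.2).prodMk (hasDerivAt_const q.1 q.2)),
    d2_of_hasDerivAt hQ ((hasDerivAt_d2 hf q.1 q.2).prodMk (hasDerivAt_id q.2))]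
  simp

theorem surjective_of_shift {f : ℝ → ℝ} (hf : Continuous f)
    (hshift : ∀ t, f (t + 2 * π) = f t + 2 * π) : Function.Surjective f := by
  obtain ⟨M, hM⟩ := exists_bound_of_periodic (f := fun t => f t - t) (by fun_prop)
    (fun t => by rw [hshift]; ring)
  intro y
  have h1 := (abs_le.1 (hM (y - M))).2
  have h2 := (abs_le.1 (hM (y + M))).1
  have hM0 : 0 ≤ M := (abs_nonneg _).trans (hM 0)
  obtain ⟨t, -, ht⟩ := intermediate_value_Icc (by linarith : y - M ≤ y + M) hf.continuousOn
    (show y ∈ Icc (f (y - M)) (f (y + M)) from ⟨by linarith, by linarith⟩)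
  exact ⟨t, ht⟩

/-- Passing to the normalized angle variable makes the Jacobian depend on `e` only. -/
theorem IsStraightening.exists_angle_chart {B : ℝ × ℝ → ℝ × ℝ} {X : ℝ → ℝ} {e₁ C : ℝ}
    (hB : IsStraightening B X e₁ C) :
    ∃ (D : ℝ × ℝ → ℝ × ℝ) (L : ℝ → ℝ), ContDiff ℝ (⊤ : ℕ∞) D ∧ ContDiff ℝ (⊤ : ℕ∞) L ∧
      (∀ e, 0 < deriv L e) ∧ (∀ y e, D (y + 2 * π, e) = D (y, e) + (2 * π, 0)) ∧
      Function.Injective D ∧ (∀ q, jac D q = deriv L q.2) ∧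
      (∀ y e, e₁ < e → D (y, e) = (y, L e) ∧ L e = e + C) ∧ (∀ y e, ∃ t, D (y, e) = B (t, e)) ∧
      ∀ e, L e = 1 / (2 * π) * ∫ t in (0 : ℝ)..(2 * π), (B (t, e)).2 * (d1 B (t, e)).1 := by
  obtain ⟨Y, L, hY, hL, hLpos, hYshift, hjac, htop, h_int⟩ := hB.exists_action
  have hd : ∀ q, 0 < d1 Y q := fun q =>
    pos_of_mul_pos_left (hjac q ▸ hB.jac_pos q) (hLpos _).le
  have hmono : ∀ e, StrictMono fun t => Y (t, e) := fun e => strictMono_of_deriv_pos fun t => by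
    rw [(hasDerivAt_d1 hY t e).deriv]
    exact hd _
  have honto : ∀ e y, ∃ t, Y (t, e) = y := fun e => surjective_of_shift
    (hY.continuous.comp (by fun_prop : Continuous fun t : ℝ => (t, e))) (fun t => hYshift t e)
  choose T hT using honto
  have hTY : ∀ t e, T e (Y (t, e)) = t := fun t e => (hmono e).injective (hT e _)
  have hQ : ContDiff ℝ (⊤ : ℕ∞) fun q : ℝ × ℝ => (Y q, q.2) := hY.prodMk contDiff_snd
  have hG : ContDiff ℝ (⊤ : ℕ∞) fun q : ℝ × ℝ => (T q.2 q.1, q.2) :=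
    contDiff_of_inverse hQ (fun q => by rw [jac_graph_left hY]; exact (hd q).ne')
      (fun q => by simp only [hTY]) (fun q => by simp only [hT])
  have hD := hB.smooth.comp hG
  refine ⟨fun q => B (T q.2 q.1, q.2), L, hD, hL, hLpos, fun y e => ?_, ?_, ?_, fun y e he => ?_,
    fun y e => ⟨_, rfl⟩, h_int⟩
  · have h1 : T e (y + 2 * π) = T e y + 2 * π :=
      (hmono e).injective (by simp only [hT, hYshift])
    simp only [h1, hB.shift]
  · rintro ⟨y, e⟩ ⟨y', e'⟩ h
    have h1 := Prod.ext_iff.1 (hB.injective h)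
    simp only at h1
    obtain ⟨h2, rfl⟩ := h1
    refine Prod.ext ?_ rfl
    rw [← hT e y, h2, hT]
  · rintro ⟨y, e⟩
    have h1 := jac_comp hD hQ (T e y, e)
    simp only [Function.comp_def, hTY, hT, jac_graph_left hY, hjac] at h1
    exact mul_right_cancel₀ (hd (T e y, e)).ne' (h1.symm.trans (mul_comm _ _))
  · have h1 := (htop (T e y) e he).1
    have h2 := (htop y e he).2
    rw [hT] at h1
    simp only [hB.top _ _ he.le, ← h1, h2, and_self]

/-- A global smooth inverse of an increasing function, modified to the left of `a`. -/
theorem exists_smooth_right_inverse {L : ℝ → ℝ} (hL : ContDiff ℝ (⊤ : ℕ∞) L)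
    (hLpos : ∀ e, 0 < deriv L e) {e₁ C : ℝ} (htop : ∀ e, e₁ < e → L e = e + C) (a : ℝ) :
    ∃ ℓ : ℝ → ℝ, ContDiff ℝ (⊤ : ℕ∞) ℓ ∧ (∀ J, 0 < deriv ℓ J) ∧ (∀ e, a ≤ e → ℓ (L e) = e) ∧
      ∀ J, L a ≤ J → L (ℓ J) = J := by
  have hL' : ContDiff ℝ (⊤ : ℕ∞) (deriv L) := (contDiff_infty_iff_deriv.1 hL).2
  have hχ : ContDiff ℝ (⊤ : ℕ∞) fun r : ℝ => Real.smoothTransition (r - a + 1) :=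
    Real.smoothTransition.contDiff.comp (by fun_prop)
  set m : ℝ → ℝ := fun r => (1 - Real.smoothTransition (r - a + 1))
    + Real.smoothTransition (r - a + 1) * deriv L r with hm
  have hms : ContDiff ℝ (⊤ : ℕ∞) m := (contDiff_const.sub hχ).add (hχ.mul hL')
  have hmpos : ∀ r, 0 < m r := fun r => by
    have h1 := cutoff_combination_pos (a := deriv L r)
      (sub_nonneg.2 (Real.smoothTransition.le_one (r - a + 1)))
      (sub_le_self _ (Real.smoothTransition.nonneg (r - a + 1))) (Or.inr (hLpos r))
    simp only [hm]
    linarith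
  obtain ⟨G, hG, hG0, hGint, hGd⟩ := exists_smooth_antideriv (fun q : ℝ × ℝ => m q.2)
    (hms.comp contDiff_snd) a
  set K : ℝ → ℝ := fun e => L a + G (0, e) with hK
  have hKs : ContDiff ℝ (⊤ : ℕ∞) K :=
    contDiff_const.add (hG.comp (contDiff_const.prodMk contDiff_id))
  have hKd : ∀ e, HasDerivAt K (m e) e := fun e => (hGd 0 e).const_add _
  have hmono : StrictMono K := strictMono_of_deriv_pos fun e => by
    rw [(hKd e).deriv]
    exact hmpos e
  have hKL : ∀ e, a ≤ e → K e = L e := by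
    intro e he
    have h1 : ∫ r in a..e, m r = L e - L a := by
      rw [← intervalIntegral.integral_eq_sub_of_hasDerivAt
        (fun r _ => (hL.differentiable (by simp) r).hasDerivAt)
        (hL'.continuous.intervalIntegrable _ _)]
      refine intervalIntegral.integral_congr fun r hr => ?_
      rw [uIcc_of_le he] at hr
      simp only [hm]
      rw [Real.smoothTransition.one_of_one_le (by linarith [hr.1])]
      ring
    simp only [hK, hGint, h1]
    ring
  have hKlow : ∀ e, e ≤ a - 1 → K e = K (a - 1) + (e - (a - 1)) := by
    intro e he
    have h1 : ∫ r in e..(a - 1), m r = K (a - 1) - K e :=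
      intervalIntegral.integral_eq_sub_of_hasDerivAt (fun r _ => hKd r)
        (hms.continuous.intervalIntegrable _ _)
    have h2 : ∫ r in e..(a - 1), m r = ∫ r in e..(a - 1), (1 : ℝ) := by
      refine intervalIntegral.integral_congr fun r hr => ?_
      rw [uIcc_of_le he] at hr
      simp only [hm]
      rw [Real.smoothTransition.zero_of_nonpos (by linarith [hr.2])]
      ring
    rw [intervalIntegral.integral_const, smul_eq_mul, mul_one] at h2
    linarith
  have honto : ∀ J, ∃ e, K e = J := by
    intro J
    set u := min (a - 1) (J - K (a - 1) + (a - 1)) with hu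
    set v := max (max a (e₁ + 1)) (J - C) with hv
    have h1 : K u ≤ J := by
      rw [hKlow u (min_le_left _ _)]
      linarith [min_le_right (a - 1) (J - K (a - 1) + (a - 1))]
    have h4 : max a (e₁ + 1) ≤ v := le_max_left _ _
    have h2 : J ≤ K v := by
      rw [hKL v ((le_max_left _ _).trans h4),
        htop v (by linarith [(le_max_right a (e₁ + 1)).trans h4])]
      linarith [le_max_right (max a (e₁ + 1)) (J - C)]
    have h3 : u ≤ v := by
      linarith [min_le_left (a - 1) (J - K (a - 1) + (a - 1)), (le_max_left a (e₁ + 1)).trans h4]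
    obtain ⟨e, -, he⟩ := intermediate_value_Icc h3 hKs.continuous.continuousOn ⟨h1, h2⟩
    exact ⟨e, he⟩
  choose ℓ hℓ using honto
  have hℓK : ∀ e, ℓ (K e) = e := fun e => hmono.injective (hℓ _)
  have hf : ContDiff ℝ (⊤ : ℕ∞) fun q : ℝ × ℝ => K q.2 := hKs.comp contDiff_snd
  have hℓs : ContDiff ℝ (⊤ : ℕ∞) ℓ := by
    have h1 : ContDiff ℝ (⊤ : ℕ∞) fun q : ℝ × ℝ => (q.1, ℓ q.2) :=
      contDiff_of_inverse (contDiff_fst.prodMk hf)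
        (fun q => by
          rw [jac_graph hf, d2_of_hasDerivAt (x := q.1) (r := q.2) hf (hKd q.2)]
          exact (hmpos _).ne')
        (fun q => by simp only [hℓK]) (fun q => by simp only [hℓ])
    exact (contDiff_snd.comp h1).comp (contDiff_const (c := (0 : ℝ)).prodMk contDiff_id)
  refine ⟨ℓ, hℓs, fun J => ?_, fun e he => by rw [← hKL e he, hℓK], fun J hJ => ?_⟩
  · have h1 := (hKd (ℓ J)).comp J (hℓs.differentiable (by simp) J).hasDerivAt
    have h2 : HasDerivAt (K ∘ ℓ) 1 J := by
      have : K ∘ ℓ = id := funext hℓ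
      rw [this]
      exact hasDerivAt_id J
    exact pos_of_mul_pos_right (by rw [h1.unique h2]; exact one_pos) (hmpos _).le
  · have h1 : a ≤ ℓ J := by
      rw [← hmono.le_iff_le, hℓ, hKL a le_rfl]
      exact hJ
    rw [← hKL _ h1, hℓ]

/-- A chart of the cylinder which is the identity for large `J` and area-preserving for
`J ≥ J₀`. -/
structure IsActionChart (A : ℝ × ℝ → ℝ × ℝ) (J₀ J₁ : ℝ) : Prop where
  smooth : ContDiff ℝ (⊤ : ℕ∞) A
  shift : ∀ y J, A (y + 2 * π, J) = A (y, J) + (2 * π, 0)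
  injective : Function.Injective A
  jac_ne_zero : ∀ q, jac A q ≠ 0
  jac_eq_one : ∀ q : ℝ × ℝ, J₀ ≤ q.2 → jac A q = 1
  top : ∀ y J, J₁ ≤ J → A (y, J) = (y, J)

/-- Action-angle chart of a straightening, together with the energy as a function of the
action. -/
theorem IsStraightening.exists_actionChart {B : ℝ × ℝ → ℝ × ℝ} {X : ℝ → ℝ} {e₁ C : ℝ}
    (hB : IsStraightening B X e₁ C) {I₀ : ℝ}
    (hI₀ : I₀ = 1 / (2 * π) * ∫ t in (0 : ℝ)..(2 * π), (B (t, 0)).2 * (d1 B (t, 0)).1) :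
    ∃ (A : ℝ × ℝ → ℝ × ℝ) (J₀ J₁ : ℝ) (ℓ : ℝ → ℝ), IsActionChart A J₀ J₁ ∧ J₀ < I₀ ∧
      ContDiff ℝ (⊤ : ℕ∞) ℓ ∧ ℓ I₀ = 0 ∧ 0 < deriv ℓ I₀ ∧
      ∀ y J, ∃ t, A (y, J) = B (t, ℓ J) := by
  obtain ⟨D, L, hD, hL, hLpos, hDshift, hDinj, hDjac, htop, hDB, h_int⟩ := hB.exists_angle_chart
  obtain ⟨ℓ, hℓ, hℓpos, hℓL, hLℓ⟩ := exists_smooth_right_inverse hL hLpos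
    (fun e he => (htop 0 e he).2) (-1)
  have hLmono : StrictMono L := strictMono_of_deriv_pos hLpos
  have hℓmono : StrictMono ℓ := strictMono_of_deriv_pos hℓpos
  have hL0 : L 0 = I₀ := by rw [h_int, hI₀]
  have hQ : ContDiff ℝ (⊤ : ℕ∞) fun q : ℝ × ℝ => (q.1, ℓ q.2) :=
    contDiff_fst.prodMk (hℓ.comp contDiff_snd)
  have hjac : ∀ q : ℝ × ℝ, jac (fun q : ℝ × ℝ => D (q.1, ℓ q.2)) q
      = deriv L (ℓ q.2) * deriv ℓ q.2 := fun q => by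
    have hf : ContDiff ℝ (⊤ : ℕ∞) fun q : ℝ × ℝ => ℓ q.2 := hℓ.comp contDiff_snd
    rw [jac_comp hD hQ q, hDjac, jac_graph hf, d2_of_hasDerivAt (x := q.1) (r := q.2) hf
      (hℓ.differentiable (by simp) q.2).hasDerivAt]
  refine ⟨fun q => D (q.1, ℓ q.2), L (-1) + (I₀ - L (-1)) / 2, max (L (-1)) (L (e₁ + 1)), ℓ,
    ⟨hD.comp hQ, fun y J => ?_, ?_, fun q => ?_, ?_, fun y J hJ => ?_⟩, ?_, hℓ, ?_, hℓpos _,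
    fun y J => hDB y (ℓ J)⟩
  · simp only [hDshift]
  · rintro ⟨y, J⟩ ⟨y', J'⟩ h
    have h1 := Prod.ext_iff.1 (hDinj h)
    simp only at h1
    exact Prod.ext h1.1 (hℓmono.injective h1.2)
  · rw [hjac]
    exact (mul_pos (hLpos _) (hℓpos _)).ne'
  · rintro ⟨y, J⟩ hJ
    simp only at hJ
    have h0 : L (-1) < J := by linarith [hLmono (by norm_num : (-1 : ℝ) < 0)]
    rw [hjac]
    have h1 := (hL.differentiable (by simp) (ℓ J)).hasDerivAt.comp J
      (hℓ.differentiable (by simp) J).hasDerivAt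
    refine h1.unique ((hasDerivAt_id J).congr_of_eventuallyEq ?_)
    filter_upwards [lt_mem_nhds h0] with J' hJ'
    exact hLℓ J' hJ'.le
  · have h1 : L (-1) ≤ J := (le_max_left _ _).trans hJ
    have h2 : L (e₁ + 1) ≤ L (ℓ J) := by
      rw [hLℓ J h1]
      exact (le_max_right _ _).trans hJ
    have h3 := hLmono.le_iff_le.1 h2
    simp only
    rw [(htop y (ℓ J) (by linarith)).1, hLℓ J h1]
  · linarith [hLmono (by norm_num : (-1 : ℝ) < 0)]
  · rw [← hL0]
    exact hℓL 0 (by norm_num)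

end ActionChart

section HamiltonianLift

open scoped Topology NNReal
open Filter

namespace IsActionChart

variable {A : ℝ × ℝ → ℝ × ℝ} {J₀ J₁ : ℝ} (hA : IsActionChart A J₀ J₁)
include hA

theorem exists_displacement_bound : ∃ M : ℝ≥0, ∀ q : ℝ × ℝ, J₀ ≤ q.2 → ‖A q - q‖ ≤ M := by
  obtain ⟨M, hM⟩ := bounded_of_periodic
    (G := fun q : ℝ × ℝ => A (q.1, J₀ + |q.2 - J₀|) - (q.1, J₀ + |q.2 - J₀|))
    (R := |J₁| + 2 * |J₀|) (M := 0)
    ((hA.smooth.continuous.comp (by fun_prop)).sub (by fun_prop))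
    (fun y J => by
      simp only [hA.shift]
      ext <;> simp)
    (fun q hq => by
      have h1 : J₁ ≤ J₀ + |q.2 - J₀| := by
        linarith [abs_sub_abs_le_abs_sub q.2 J₀, le_abs_self J₁, neg_abs_le J₀]
      simp only [hA.top _ _ h1, sub_self, norm_zero, le_refl])
  refine ⟨M, fun q hq => ?_⟩
  have h1 := hM q
  rwa [abs_of_nonneg (sub_nonneg.2 hq), add_sub_cancel] at h1

theorem isClosed_image : IsClosed (A '' {q | J₀ ≤ q.2}) := by
  obtain ⟨M, hM⟩ := hA.exists_displacement_bound
  refine IsSeqClosed.isClosed fun x z hx hxz => ?_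
  choose q hq hqx using hx
  have h1 : ∃ᶠ n in atTop, q n ∈ Metric.closedBall z (M + 1) := by
    refine Eventually.frequently ?_
    filter_upwards [hxz (Metric.ball_mem_nhds z one_pos)] with n hn
    have h2 : dist (x n) z < 1 := hn
    have h3 := hM (q n) (hq n)
    rw [hqx, ← dist_eq_norm, dist_comm] at h3
    rw [Metric.mem_closedBall]
    linarith [dist_triangle (q n) (x n) z]
  obtain ⟨a, -, φ, hφ, ha⟩ := tendsto_subseq_of_frequently_bounded Metric.isBounded_closedBall h1
  refine ⟨a, ?_, ?_⟩
  · exact (isClosed_le continuous_const continuous_snd).mem_of_tendsto ha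
      (Eventually.of_forall fun n => hq (φ n))
  · have h2 := (hA.smooth.continuous.tendsto a).comp ha
    refine tendsto_nhds_unique (h2.congr fun n => ?_) (hxz.comp hφ.tendsto_atTop)
    exact hqx (φ n)

/-- The Hamiltonian which generates, together with the vertical translation, the field
`∂_J` of the chart in the region `J ≥ J₂`. -/
theorem exists_hamiltonian {J₂ : ℝ} (hJ : J₀ < J₂) :
    ∃ (h : ℝ × ℝ → ℝ) (R : ℝ), 0 < R ∧ ContDiff ℝ (⊤ : ℕ∞) h ∧
      (∀ x ξ, h (x + 2 * π, ξ) = h (x, ξ)) ∧ (∀ z : ℝ × ℝ, R ≤ |z.2| → h z = 0) ∧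
      ∀ y J, J₂ ≤ J → h (A (y, J)) = (A (y, J)).1 - y := by
  classical
  obtain ⟨M, hM⟩ := hA.exists_displacement_bound
  set χ : ℝ → ℝ := fun J => Real.smoothTransition ((J - J₀) / (J₂ - J₀)) with hχ
  have hχs : ContDiff ℝ (⊤ : ℕ∞) χ := Real.smoothTransition.contDiff.comp (by fun_prop)
  have hχ0 : ∀ J, J ≤ J₀ → χ J = 0 := fun J h => Real.smoothTransition.zero_of_nonpos
    (div_nonpos_of_nonpos_of_nonneg (by linarith) (by linarith))
  have hχ1 : ∀ J, J₂ ≤ J → χ J = 1 := fun J h => Real.smoothTransition.one_of_one_le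
    ((one_le_div (by linarith)).2 (by linarith))
  have hleft : ∀ q, Function.invFun A (A q) = q := Function.leftInverse_invFun hA.injective
  obtain ⟨hopen, hinv⟩ := smooth_inverse isOpen_univ hA.smooth.contDiffOn
    (fun q _ => by rw [det_fderiv_eq_jac]; exact hA.jac_ne_zero q) (fun q _ => hleft q)
  rw [image_univ] at hopen hinv
  set h : ℝ × ℝ → ℝ := fun z => if z ∈ range A then
    χ (Function.invFun A z).2 * (z.1 - (Function.invFun A z).1) else 0 with hh
  have hval : ∀ q, h (A q) = χ q.2 * ((A q).1 - q.1) := fun q => by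
    simp only [hh, mem_range_self, if_true, hleft]
  have hout : ∀ z, z ∉ range A → h z = 0 := fun z hz => by simp only [hh, hz, if_false]
  refine ⟨h, M + |J₀| + |J₁| + 1, by positivity, contDiff_iff_contDiffAt.2 fun z => ?_,
    fun x ξ => ?_, fun z hz => ?_, fun y J hJ2 => ?_⟩
  · by_cases hz : z ∈ A '' {q | J₀ ≤ q.2}
    · have hz' : z ∈ range A := image_subset_range _ _ hz
      have h1 := hinv z hz'
      have h2 : ContDiffAt ℝ (⊤ : ℕ∞)
          (fun z => χ (Function.invFun A z).2 * (z.1 - (Function.invFun A z).1)) z :=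
        (hχs.contDiffAt.comp z (contDiffAt_snd.comp z h1)).mul
          (contDiffAt_fst.sub (contDiffAt_fst.comp z h1))
      refine h2.congr_of_eventuallyEq ?_
      filter_upwards [hopen.mem_nhds hz'] with w hw
      simp only [hh, hw, if_true]
    · refine contDiffAt_const (c := (0 : ℝ)).congr_of_eventuallyEq ?_
      filter_upwards [hA.isClosed_image.isOpen_compl.mem_nhds hz] with w hw
      by_cases hw' : w ∈ range A
      · obtain ⟨q, rfl⟩ := hw'
        rw [hval, hχ0, zero_mul]
        by_contra hq
        exact hw ⟨q, (not_le.1 hq).le, rfl⟩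
      · exact hout w hw'
  · have hxξ : ((x + 2 * π, ξ) : ℝ × ℝ) = (x, ξ) + (2 * π, 0) := by simp
    by_cases hz : ((x, ξ) : ℝ × ℝ) ∈ range A
    · obtain ⟨⟨y, J⟩, hq⟩ := hz
      rw [hxξ, ← hq, ← hA.shift, hval, hval, hA.shift]
      simp
    · rw [hout _ hz, hout]
      rintro ⟨⟨y, J⟩, hq⟩
      refine hz ⟨(y - 2 * π, J), ?_⟩
      have h1 := hA.shift (y - 2 * π) J
      rw [sub_add_cancel, hq, hxξ] at h1
      exact (add_right_cancel h1).symm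
  · by_cases hz' : z ∈ range A
    · obtain ⟨q, rfl⟩ := hz'
      rw [hval]
      rcases le_or_gt q.2 J₀ with hq | hq
      · rw [hχ0 _ hq, zero_mul]
      · have h1 := (norm_snd_le (A q - q)).trans (hM q hq.le)
        rw [Real.norm_eq_abs, Prod.snd_sub] at h1
        have h2 : |J₀| + |J₁| + 1 ≤ |q.2| := by
          linarith [abs_sub_abs_le_abs_sub (A q).2 q.2]
        have h3 : J₁ ≤ q.2 := by
          rcases le_abs.1 h2 with h | h
          · linarith [le_abs_self J₁, abs_nonneg J₀]
          · linarith [neg_abs_le J₀, abs_nonneg J₁]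
        have h4 : A q = q := hA.top _ _ h3
        rw [h4, sub_self, mul_zero]
    · exact hout z hz'
  · rw [hval, hχ1 _ hJ2, one_mul]

theorem field_eq {h : ℝ × ℝ → ℝ} (hh : ContDiff ℝ (⊤ : ℕ∞) h) {J₂ : ℝ} (hJ : J₀ ≤ J₂)
    (hval : ∀ y J, J₂ ≤ J → h (A (y, J)) = (A (y, J)).1 - y) {y J : ℝ} (hlt : J₂ < J) :
    (d2 h (A (y, J)), 1 - d1 h (A (y, J))) = d2 A (y, J) := by
  have ha := hasDerivAt_d1 hA.smooth y J
  have hb := hasDerivAt_d2 hA.smooth y J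
  have h1 := hasDerivAt_comp_curve hh (hasDerivAt_fst ha) (hasDerivAt_snd ha)
  have h2 := hasDerivAt_comp_curve hh (hasDerivAt_fst hb) (hasDerivAt_snd hb)
  simp only [Prod.mk.eta, smul_eq_mul] at h1 h2
  have h3 : HasDerivAt (fun t => h (A (t, J))) ((d1 A (y, J)).1 - 1) y :=
    ((hasDerivAt_fst ha).sub (hasDerivAt_id y)).congr_of_eventuallyEq
      (Eventually.of_forall fun t => hval t J hlt.le)
  have h4 : HasDerivAt (fun t => h (A (y, t))) (d2 A (y, J)).1 J := by
    refine ((hasDerivAt_fst hb).sub_const y).congr_of_eventuallyEq ?_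
    filter_upwards [lt_mem_nhds hlt] with t ht
    exact hval y t ht.le
  have e1 := h1.unique h3
  have e2 := h2.unique h4
  have e3 := hA.jac_eq_one (y, J) (hJ.trans hlt.le)
  rw [jac] at e3
  refine Prod.ext ?_ ?_ <;> simp only
  · linear_combination (-(d2 A (y, J)).1) * e1 + (d1 A (y, J)).1 * e2
      + (-d2 h (A (y, J))) * e3
  · linear_combination (-(d2 A (y, J)).2) * e1 + (d1 A (y, J)).2 * e2
      + (-(1 - d1 h (A (y, J)))) * e3

end IsActionChart

theorem hamiltonian_field_vertical {h : ℝ × ℝ → ℝ} {R : ℝ}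
    (hR : ∀ z : ℝ × ℝ, R ≤ |z.2| → h z = 0) {z : ℝ × ℝ} (hz : R < |z.2|) :
    (d2 h z, 1 - d1 h z) = (0, 1) := by
  have h0 : h =ᶠ[𝓝 z] fun _ => 0 := by
    filter_upwards [(isOpen_lt continuous_const continuous_snd.abs).mem_nhds hz] with w hw
    exact hR w (le_of_lt hw)
  have h1 : d1 h z = 0 := by rw [d1, h0.fderiv_eq]; simp
  have h2 : d2 h z = 0 := by rw [d2, h0.fderiv_eq]; simp
  rw [h1, h2, sub_zero]

theorem exists_hamiltonian_flow {h : ℝ × ℝ → ℝ} (hh : ContDiff ℝ (⊤ : ℕ∞) h)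
    (hper : ∀ x ξ, h (x + 2 * π, ξ) = h (x, ξ)) {R : ℝ}
    (hR : ∀ z : ℝ × ℝ, R ≤ |z.2| → h z = 0) :
    ∃ Φ, IsPlaneFlow (fun z => (d2 h z, 1 - d1 h z)) Φ ∧
      (∀ s z, Φ (s, z + (2 * π, 0)) = Φ (s, z) + (2 * π, 0)) ∧
      ∀ s z, jac (fun z => Φ (s, z)) z = 1 := by
  have hv : ContDiff ℝ (⊤ : ℕ∞) fun z => (d2 h z, 1 - d1 h z) :=
    (contDiff_d2 hh).prodMk (contDiff_const.sub (contDiff_d1 hh))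
  have hp2 : ∀ x ξ, d2 h (x + 2 * π, ξ) = d2 h (x, ξ) := fun x ξ => by
    refine d2_of_hasDerivAt hh ?_
    simp only [hper]
    exact hasDerivAt_d2 hh x ξ
  have hp1 : ∀ x ξ, d1 h (x + 2 * π, ξ) = d1 h (x, ξ) := fun x ξ => by
    have h1 : HasDerivAt (fun x => h (x + 2 * π, ξ)) (d1 h (x + 2 * π, ξ)) x :=
      (hasDerivAt_d1 hh (x + 2 * π) ξ).comp_add_const x (2 * π)
    simp only [hper] at h1
    exact h1.unique (hasDerivAt_d1 hh x ξ)
  obtain ⟨Φ, hΦ⟩ := exists_planeFlow hv (fun x ξ => by simp only [hp1, hp2]) (R := R + 1)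
    (w := (0, 1)) (fun z hz => hamiltonian_field_vertical hR (by linarith))
  refine ⟨Φ, hΦ, hΦ.equivariant fun z => ?_, hΦ.jac_eq_one fun z => ?_⟩
  · have h1 : z + (2 * π, 0) = (z.1 + 2 * π, z.2) := by ext <;> simp
    simp only [h1, hp1, hp2]
  · have e1 := d1_of_hasDerivAt hv ((hasDerivAt_d1 (contDiff_d2 hh) z.1 z.2).prodMk
      ((hasDerivAt_d1 (contDiff_d1 hh) z.1 z.2).const_sub 1))
    have e2 := d2_of_hasDerivAt hv ((hasDerivAt_d2 (contDiff_d2 hh) z.1 z.2).prodMk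
      ((hasDerivAt_d2 (contDiff_d1 hh) z.1 z.2).const_sub 1))
    rw [Prod.mk.eta] at e1 e2
    rw [e1, e2]
    simp only [d1_d2_comm hh]
    ring

/-- An area-preserving chart which is the identity for large `J` agrees, in the region `J ≥ J₂`,
with a Hamiltonian diffeomorphism. -/
theorem IsActionChart.exists_hamiltonian_extension {A : ℝ × ℝ → ℝ × ℝ} {J₀ J₁ J₂ : ℝ}
    (hA : IsActionChart A J₀ J₁) (hJ : J₀ < J₂) :
    ∃ (R : ℝ) (σ τ : ℝ × ℝ → ℝ × ℝ), 0 < R ∧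
      ContDiff ℝ (⊤ : ℕ∞) σ ∧ ContDiff ℝ (⊤ : ℕ∞) τ ∧ (∀ z, τ (σ z) = z) ∧ (∀ z, σ (τ z) = z) ∧
      (∀ x ξ, σ (x + 2 * π, ξ) = σ (x, ξ) + (2 * π, 0)) ∧ (∀ z, jac σ z = 1) ∧
      (∀ x ξ : ℝ, R < |ξ| → σ (x, ξ) = (x, ξ)) ∧
      (∃ (H : ℝ × (ℝ × ℝ) → ℝ) (Ψ : ℝ × (ℝ × ℝ) → ℝ × ℝ),
        ContDiff ℝ (⊤ : ℕ∞) H ∧ ContDiff ℝ (⊤ : ℕ∞) Ψ ∧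
        (∀ s x ξ : ℝ, H (s, (x + 2 * π, ξ)) = H (s, (x, ξ))) ∧
        (∀ s x ξ : ℝ, R < |ξ| → H (s, (x, ξ)) = 0) ∧
        (∀ z, Ψ (0, z) = z) ∧ (∀ z, Ψ (1, z) = σ z) ∧
        ∀ s z, HasDerivAt (fun s' => Ψ (s', z))
          (d2 (fun w => H (s, w)) (Ψ (s, z)), -d1 (fun w => H (s, w)) (Ψ (s, z))) s) ∧
      ∀ y J, J₂ ≤ J → σ (y, J) = A (y, J) := by
  obtain ⟨h, R, hR0, hh, hper, hR, hval⟩ :=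
    hA.exists_hamiltonian (J₂ := (J₀ + J₂) / 2) (by linarith)
  obtain ⟨Φ, hΦ, hΦshift, hΦjac⟩ := exists_hamiltonian_flow hh hper hR
  have hΦA : ∀ y J s, J₂ ≤ J → 0 ≤ s → Φ (s, A (y, J)) = A (y, J + s) := by
    intro y J s hJ2 hs
    have h1 := hΦ.unique_of_nonneg (β := fun t => A (y, J + t)) hs (fun t ht => by
      have h2 := hA.field_eq hh (by linarith) hval (y := y)
        (show (J₀ + J₂) / 2 < J + t by linarith [ht.1])
      rw [h2]
      exact (hasDerivAt_d2 hA.smooth y (J + t)).comp_const_add J t)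
    simp only [add_zero] at h1
    exact h1.symm
  set S : ℝ := max 0 (J₁ - J₂) with hS
  have hS0 : 0 ≤ S := le_max_left _ _
  have hS1 : J₁ - J₂ ≤ S := le_max_right _ _
  set β := Real.smoothTransition with hβdef
  have hβ : ContDiff ℝ (⊤ : ℕ∞) β := Real.smoothTransition.contDiff
  have hβ' : ContDiff ℝ (⊤ : ℕ∞) (deriv β) := (contDiff_infty_iff_deriv.1 hβ).2
  have hβ0 : ∀ s, 0 ≤ β s := Real.smoothTransition.nonneg
  have hβ1 : ∀ s, β s ≤ 1 := Real.smoothTransition.le_one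
  have hlift : ContDiff ℝ (⊤ : ℕ∞) fun q : ℝ × (ℝ × ℝ) =>
      q.2 + ((0, (1 - β q.1) * S) : ℝ × ℝ) :=
    contDiff_snd.add (contDiff_const.prodMk
      ((contDiff_const.sub (hβ.comp contDiff_fst)).mul contDiff_const))
  have hup : ContDiff ℝ (⊤ : ℕ∞) fun z : ℝ × ℝ => z + ((0, S) : ℝ × ℝ) :=
    contDiff_id.add contDiff_const
  have hdown : ContDiff ℝ (⊤ : ℕ∞) fun z : ℝ × ℝ => z - ((0, S) : ℝ × ℝ) :=
    contDiff_id.sub contDiff_const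
  have hfield : ∀ z : ℝ × ℝ, R < |z.2| → (d2 h z, 1 - d1 h z) = (0, 1) := fun z hz =>
    hamiltonian_field_vertical hR hz
  refine ⟨R + S, fun z => Φ (-S, z + (0, S)), fun z => Φ (S, z) - (0, S), by positivity,
    (hΦ.contDiff_slice (-S)).comp hup, hdown.comp (hΦ.contDiff_slice S), fun z => ?_, fun z => ?_,
    fun x ξ => ?_, fun z => ?_, fun x ξ hξ => ?_,
    ⟨fun q => -(deriv β q.1 * S) * h (q.2 + (0, (1 - β q.1) * S)),
      fun q => Φ (-(β q.1 * S), q.2 + (0, S)) - (0, (1 - β q.1) * S),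
      ((hβ'.comp contDiff_fst).mul contDiff_const).neg.mul (hh.comp hlift), ?_, fun s x ξ => ?_,
      fun s x ξ hξ => ?_, fun z => ?_, fun z => ?_, fun s z => ?_⟩, fun y J hJ2 => ?_⟩
  · simp only [hΦ.neg_right, add_sub_cancel_right]
  · simp only [sub_add_cancel, hΦ.neg_left]
  · have h1 : ((x + 2 * π, ξ) : ℝ × ℝ) + (0, S) = (x, ξ) + (0, S) + (2 * π, 0) := by
      ext <;> simp
    simp only [h1, hΦshift]
  · have h1 := fderiv_comp_add_right (𝕜 := ℝ) (f := fun z => Φ (-S, z)) (x := z) ((0, S) : ℝ × ℝ)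
    rw [← det_fderiv_eq_jac, h1, det_fderiv_eq_jac, hΦjac]
  · have h1 := hΦ.eq_translation_neg (z := (x, ξ + S)) hS0 (fun t ht => hfield _ (by
      have := abs_sub_abs_le_abs_sub ξ (t - S)
      have h2 : |t - S| ≤ S := abs_le.2 ⟨by linarith [ht.1], by linarith [ht.2]⟩
      have h3 : ξ + S - t = ξ - (t - S) := by ring
      simp only [h3]
      linarith))
    simpa using h1
  · exact (hΦ.smooth.comp (((hβ.comp contDiff_fst).mul contDiff_const).neg.prodMk
      (hup.comp contDiff_snd))).sub (contDiff_const.prodMk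
      ((contDiff_const.sub (hβ.comp contDiff_fst)).mul contDiff_const))
  · simp only [Prod.mk_add_mk, add_zero, hper]
  · simp only [Prod.mk_add_mk]
    rw [hR, mul_zero]
    have h1 : 0 ≤ (1 - β s) * S := mul_nonneg (by linarith [hβ1 s]) hS0
    have h2 : (1 - β s) * S ≤ S := mul_le_of_le_one_left hS0 (by linarith [hβ0 s])
    have h3 := abs_sub_abs_le_abs_sub ξ (-((1 - β s) * S))
    rw [abs_neg, abs_of_nonneg h1, sub_neg_eq_add] at h3
    simp only
    linarith
  · simp [hβdef, hΦ.zero]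
  · simp [hβdef]
  · set a : ℝ × ℝ := (0, (1 - β s) * S) with ha
    set w := Φ (-(β s * S), z + (0, S)) with hw
    have hws : w - a + a = w := sub_add_cancel _ _
    have hfd : HasFDerivAt (fun w : ℝ × ℝ => -(deriv β s * S) * h (w + a))
        (-(deriv β s * S) • fderiv ℝ h w) (w - a) := by
      have h1 : HasFDerivAt (fun w : ℝ × ℝ => h (w + a)) (fderiv ℝ h w) (w - a) := by
        rw [hasFDerivAt_comp_add_right, hws]
        exact hh.hasFDerivAt_fderiv w
      exact h1.const_mul _
    have hβs := (hβ.differentiable (by simp) s).hasDerivAt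
    have h1 := (hΦ.deriv (z + (0, S)) (-(β s * S))).scomp s (hβs.mul_const S).neg
    have h2 : HasDerivAt (fun s => ((0, (1 - β s) * S) : ℝ × ℝ)) (0, -deriv β s * S) s :=
      (hasDerivAt_const s (0 : ℝ)).prodMk ((hβs.const_sub 1).mul_const S)
    refine (h1.sub h2).congr_deriv ?_
    change -(deriv β s * S) • (d2 h w, 1 - d1 h w) - ((0, -deriv β s * S) : ℝ × ℝ)
      = (d2 (fun w : ℝ × ℝ => -(deriv β s * S) * h (w + a)) (w - a),
        -d1 (fun w : ℝ × ℝ => -(deriv β s * S) * h (w + a)) (w - a))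
    simp only [d1, d2, hfd.fderiv]
    ext <;> simp
    ring
  · have h1 := hΦA y J S hJ2 hS0
    rw [hA.top y (J + S) (by linarith)] at h1
    have h2 := hΦ.neg_left S (A (y, J))
    rw [h1] at h2
    simpa using h2

end HamiltonianLift

section NormalForm

open scoped Topology

theorem isCylinderCurve_of_injective_mod {c : ℝ → ℝ × ℝ} (hc : ContDiff ℝ (⊤ : ℕ∞) c)
    (hshift : ∀ t, c (t + 2 * π) = c t + (2 * π, 0)) (hreg : ∀ t, deriv c t ≠ 0)
    (hinj : ∀ t s : ℝ, (∃ k : ℤ, c t - c s = (2 * π * k, 0)) → ∃ k : ℤ, t - s = 2 * π * k) :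
    IsCylinderCurve c := by
  refine ⟨hc, hshift, hreg, fun s t k hk => ?_⟩
  obtain ⟨m, hm⟩ := hinj t s ⟨k, hk⟩
  have hp : Function.Periodic (fun t => c t - (t, 0)) (2 * π) := fun t => by
    simp only [hshift]
    ext <;> simp
  have h1 := hp.int_mul m s
  have h2 : s + m * (2 * π) = t := by linarith
  rw [h2] at h1
  have h3 := congrArg Prod.fst h1
  have h4 := congrArg Prod.fst hk
  simp only [Prod.fst_sub] at h3 h4
  linarith

end NormalForm

/-- Semiglobal Hamiltonian normal form on `T*S¹`: there is a compactly supported (in `ξ`)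
Hamiltonian diffeomorphism `σ` of the cylinder such that `p ∘ σ = b₀ + g(ξ − I₀)²` on the
band `{|ξ − I₀| < ε}`, where `I₀` is the Liouville class of `γ`. -/
theorem semiglobal_hamiltonian_normal_form_cylinder
    (p : ℝ × ℝ → ℝ) (c : ℝ → ℝ × ℝ) (b₀ : ℝ)
    (hwell : NondegenerateWellCylinder p c b₀)
    (I₀ : ℝ)
    (hI₀ : I₀ = (1 / (2 * π)) * ∫ t in (0:ℝ)..(2 * π), (c t).2 * (deriv c t).1) :
    ∃ (ε R : ℝ) (g : ℝ → ℝ) (σ τ : ℝ × ℝ → ℝ × ℝ),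
      0 < ε ∧ 0 < R ∧
      ContDiffOn ℝ (⊤ : ℕ∞) g (Set.Ioo (-ε) ε) ∧ g 0 = 0 ∧ deriv g 0 ≠ 0 ∧
      Function.Bijective σ ∧
      ContDiff ℝ (⊤ : ℕ∞) σ ∧ ContDiff ℝ (⊤ : ℕ∞) τ ∧
      (∀ z, τ (σ z) = z) ∧ (∀ z, σ (τ z) = z) ∧
      (∀ x ξ : ℝ, σ (x + 2 * π, ξ) = σ (x, ξ) + (2 * π, 0)) ∧
      (∀ z, (fderiv ℝ σ z).det = 1) ∧
      (∀ x ξ : ℝ, R < |ξ| → σ (x, ξ) = (x, ξ)) ∧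
      (∃ (H : ℝ × (ℝ × ℝ) → ℝ) (Ψ : ℝ × (ℝ × ℝ) → ℝ × ℝ),
        ContDiff ℝ (⊤ : ℕ∞) H ∧ ContDiff ℝ (⊤ : ℕ∞) Ψ ∧
        (∀ s x ξ : ℝ, H (s, (x + 2 * π, ξ)) = H (s, (x, ξ))) ∧
        (∀ s x ξ : ℝ, R < |ξ| → H (s, (x, ξ)) = 0) ∧
        (∀ z : ℝ × ℝ, Ψ (0, z) = z) ∧
        (∀ z : ℝ × ℝ, Ψ (1, z) = σ z) ∧
        (∀ s : ℝ, ∀ z : ℝ × ℝ, HasDerivAt (fun s' => Ψ (s', z))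
          ((fderiv ℝ (fun w => H (s, w)) (Ψ (s, z))) (0, 1),
           -(fderiv ℝ (fun w => H (s, w)) (Ψ (s, z))) (1, 0)) s)) ∧
      (∀ x ξ : ℝ, ξ ∈ Set.Ioo (I₀ - ε) (I₀ + ε) →
        p (σ (x, ξ)) = b₀ + (g (ξ - I₀)) ^ 2) := by
  obtain ⟨hp, hper, hcs, hshift, hreg, hinj, ⟨Ω, hΩ, hsub, -, hval, hgt⟩, hess⟩ := hwell
  have hc := isCylinderCurve_of_injective_mod hcs hshift hreg hinj
  obtain ⟨B, X, e₁, C, ε₀, hε₀, hB, hB0, hpB⟩ :=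
    exists_straightening hp hper hc hΩ hsub hval hgt hess
  have hBd : ∀ t, d1 B (t, 0) = deriv c t := fun t => by
    refine d1_of_hasDerivAt hB.smooth ?_
    simp only [hB0]
    exact hc.hasDerivAt t
  obtain ⟨A, J₀, J₁, ℓ, hA, hJ₀, hℓ, hℓ0, hℓ', hAB⟩ :=
    hB.exists_actionChart (I₀ := I₀) (by simpa only [hB0, hBd] using hI₀)
  obtain ⟨R, σ, τ, hR, hσ, hτ, hτσ, hστ, hσshift, hjac, hid, hham, hσA⟩ :=
    hA.exists_hamiltonian_extension (J₂ := (J₀ + I₀) / 2) (by linarith)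
  have hnear : {J | (J₀ + I₀) / 2 < J ∧ |ℓ J| < ε₀} ∈ nhds I₀ :=
    ((isOpen_lt continuous_const continuous_id).inter
      (isOpen_lt hℓ.continuous.abs continuous_const)).mem_nhds
      ⟨by simp only [mem_ofPred_eq, id]; linarith, by simpa [hℓ0] using hε₀⟩
  obtain ⟨ε, hε, hball⟩ := Metric.mem_nhds_iff.1 hnear
  rw [Real.ball_eq_Ioo] at hball
  refine ⟨ε, R, fun j => ℓ (j + I₀), σ, τ, hε, hR,
    (hℓ.comp (contDiff_id.add contDiff_const)).contDiffOn, by simpa using hℓ0, ?_,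
    ⟨fun a b hab => by rw [← hτσ a, hab, hτσ], fun z => ⟨τ z, hστ z⟩⟩, hσ, hτ, hτσ, hστ, hσshift,
    fun z => by rw [det_fderiv_eq_jac, hjac], hid, hham, fun x ξ hξ => ?_⟩
  · rw [deriv_comp_add_const, zero_add]
    exact hℓ'.ne'
  · obtain ⟨h1, h2⟩ := hball hξ
    obtain ⟨t, ht⟩ := hAB x ξ
    simp only [sub_add_cancel]
    rw [hσA x ξ h1.le, ht, hpB t _ h2.le]
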